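/- arXiv:2508.10151 — 4 statements merged into one kernel-verified Lean document; each statement's English description precedes it below -/
import Mathlib

section
/- For each integer n > 1 there exist a complex polynomial p of degree n, a complex polynomial q of degree 1, and a complex number w such that the set {z ∈ ℂ : p(z)·conj(q(z)) = w} has exactly 3n − 1 elements. -/
open Polynomial in
/-- The polynomial `1 + 16 (z + z² + ⋯ + zⁿ)`. -/
noncomputable def extremalPoly (n : ℕ) : ℂ[X] :=
  C 16 * (X * ∑ k ∈ Finset.range n, X ^ k) + C 1

open Polynomial in
theorem natDegree_extremalPoly {n : ℕ} (hn : 1 ≤ n) : (extremalPoly n).natDegree = n := by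
  have h := geom_sum_mul (X : ℂ[X]) n
  have hne : (X ^ n - 1 : ℂ[X]) ≠ 0 := X_pow_sub_C_ne_zero (by omega) 1
  have hs : (∑ k ∈ Finset.range n, (X : ℂ[X]) ^ k) ≠ 0 := by
    intro h0
    rw [h0, zero_mul] at h
    exact hne h.symm
  have hX : (X - 1 : ℂ[X]) ≠ 0 := X_sub_C_ne_zero 1
  have hd := congrArg natDegree h
  rw [natDegree_mul hs hX] at hd
  have h1 : (X - 1 : ℂ[X]).natDegree = 1 := natDegree_X_sub_C 1
  have h2 : (X ^ n - 1 : ℂ[X]).natDegree = n := natDegree_X_pow_sub_C (r := (1 : ℂ))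
  rw [h1, h2] at hd
  rw [extremalPoly, natDegree_add_C, natDegree_C_mul (by norm_num), natDegree_mul X_ne_zero hs,
    natDegree_X]
  omega

/-- After multiplication by `1 - z`, the equation forces `z ^ n` to be real. -/
theorem extremalPoly_eval_mul_conj_eq_one_iff {n : ℕ} (hn : 1 ≤ n) (z : ℂ) :
    (extremalPoly n).eval z * (starRingEnd ℂ) z = 1 ↔
      z ≠ 1 ∧ 16 * (z * (starRingEnd ℂ) z) * (1 - z ^ n) = (1 - z) * (1 - (starRingEnd ℂ) z) := by
  have hg := geom_sum_mul z n
  simp only [extremalPoly, Polynomial.eval_add, Polynomial.eval_mul, Polynomial.eval_C,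
    Polynomial.eval_X, Polynomial.eval_finsetSum, Polynomial.eval_pow]
  set s := ∑ k ∈ Finset.range n, z ^ k with hs
  constructor
  · intro h
    constructor
    · rintro rfl
      simp only [one_pow, Finset.sum_const, Finset.card_range, nsmul_eq_mul, mul_one] at hs
      rw [hs] at h
      simp only [map_one, mul_one, one_mul] at h
      have h' : ((16 * n + 1 : ℕ) : ℂ) = (1 : ℕ) := by push_cast; exact h
      have := Nat.cast_injective h'
      omega
    · linear_combination (1 - z) * h + 16 * z * (starRingEnd ℂ) z * hg
  · rintro ⟨hz, h⟩
    have hz' : (1 - z) ≠ 0 := sub_ne_zero.2 (Ne.symm hz)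
    apply mul_left_cancel₀ hz'
    linear_combination h - 16 * z * (starRingEnd ℂ) z * hg

/-- The equation along the ray through a point `u` of the unit circle with `u ^ n = ε`. -/
theorem extremalPoly_eval_ray_iff {n : ℕ} (hn : 1 ≤ n) {u : ℂ} (hu : ‖u‖ = 1) {ε : ℝ}
    (hε : u ^ n = ε) {t : ℝ} :
    (extremalPoly n).eval (t * u) * (starRingEnd ℂ) (t * u) = 1 ↔
      (t * u : ℂ) ≠ 1 ∧ 16 * t ^ 2 * (1 - ε * t ^ n) = 1 - 2 * t * u.re + t ^ 2 := by
  have h1 : u * (starRingEnd ℂ) u = 1 := by simp [Complex.mul_conj', hu]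
  have h2 : u + (starRingEnd ℂ) u = ((2 * u.re : ℝ) : ℂ) := Complex.add_conj u
  rw [extremalPoly_eval_mul_conj_eq_one_iff hn, mul_pow, hε, map_mul, Complex.conj_ofReal,
    ← Complex.ofReal_inj]
  push_cast at h2 ⊢
  refine and_congr_right fun _ => ⟨fun h => ?_, fun h => ?_⟩
  · linear_combination h + (t ^ 2 - 16 * t ^ 2 * (1 - ε * t ^ n)) * h1 - t * h2
  · linear_combination h - (t ^ 2 - 16 * t ^ 2 * (1 - ε * t ^ n)) * h1 + t * h2

theorem exists_pow_eq_ofReal_of_extremalPoly_eval {n : ℕ} (hn : 1 ≤ n) {z : ℂ}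
    (h : (extremalPoly n).eval z * (starRingEnd ℂ) z = 1) :
    ∃ r : ℝ, z ^ n = r := by
  have hz : z ≠ 0 := by rintro rfl; simp at h
  have h' := ((extremalPoly_eval_mul_conj_eq_one_iff hn z).1 h).2
  have e : (1 - z) * (1 - (starRingEnd ℂ) z) = ((Complex.normSq (1 - z) : ℝ) : ℂ) := by
    rw [← Complex.mul_conj]; simp
  rw [e, Complex.mul_conj] at h'
  have hN : ((Complex.normSq z : ℝ) : ℂ) ≠ 0 := by
    exact_mod_cast (Complex.normSq_pos.2 hz).ne'
  refine ⟨1 - Complex.normSq (1 - z) / (16 * Complex.normSq z), ?_⟩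
  push_cast
  field_simp
  linear_combination -h'

theorem exists_ray_root_neg (n : ℕ) {c : ℝ} (hc : |c| ≤ 1) :
    ∃ a : ℝ, ∀ t : ℝ,
      (0 < t ∧ 16 * t ^ 2 * (1 - (-1) * t ^ n) = 1 - 2 * t * c + t ^ 2) ↔ t = a := by
  obtain ⟨hc1, hc2⟩ := abs_le.1 hc
  have hcont : Continuous fun t : ℝ => 16 * t ^ 2 * (1 - (-1) * t ^ n) - (1 - 2 * t * c + t ^ 2) := by
    fun_prop
  obtain ⟨a, ha, ha'⟩ := intermediate_value_Icc (zero_le_one' ℝ) hcont.continuousOn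
    (show (0 : ℝ) ∈ Set.Icc _ _ by
      constructor
      · norm_num
      · simp only [one_pow]; linarith)
  have ha0 : 0 < a := by
    refine lt_of_le_of_ne ha.1 ?_
    rintro rfl
    norm_num at ha'
  have key : ∀ s t : ℝ, 0 < s → s < t →
      16 * s ^ 2 * (1 - (-1) * s ^ n) = 1 - 2 * s * c + s ^ 2 →
      16 * t ^ 2 * (1 - (-1) * t ^ n) = 1 - 2 * t * c + t ^ 2 → False := by
    intro s t hs hst h1 h2
    have ht := hs.trans hst
    have hp : s ^ n ≤ t ^ n := pow_le_pow_left₀ hs.le hst.le n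
    have hsn : 0 < s ^ n := pow_pos hs n
    have h3 : t * (15 * s ^ 2 + 16 * s ^ 2 * s ^ n - 1)
        = s * (15 * t ^ 2 + 16 * t ^ 2 * t ^ n - 1) := by
      linear_combination t * h1 - s * h2
    have h4 : s * s ^ n ≤ t * t ^ n := mul_le_mul hst.le hp hsn.le ht.le
    have h5 : 0 < s * t := mul_pos hs ht
    nlinarith [mul_le_mul_of_nonneg_left h4 h5.le, mul_pos h5 (sub_pos.2 hst)]
  refine ⟨a, fun t => ⟨?_, ?_⟩⟩
  · rintro ⟨ht, h⟩
    rcases lt_trichotomy t a with h' | h' | h'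
    · exact (key t a ht h' h (sub_eq_zero.1 ha')).elim
    · exact h'
    · exact (key a t ha0 h' (sub_eq_zero.1 ha') h).elim
  · rintro rfl
    exact ⟨ha0, sub_eq_zero.1 ha'⟩

theorem strictConcaveOn_ray {n : ℕ} (hn : 1 ≤ n) (c : ℝ) :
    StrictConcaveOn ℝ (Set.Ioi 0) fun t : ℝ => (15 * t + 2 * c - t⁻¹) - 16 * t ^ (n + 1) := by
  have h1 : StrictConvexOn ℝ (Set.Ioi (0 : ℝ)) fun t : ℝ => t ^ (n + 1) :=
    (strictConvexOn_pow (by omega)).subset Set.Ioi_subset_Ici_self (convex_Ioi 0)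
  have h2 : ConvexOn ℝ (Set.Ioi (0 : ℝ)) fun t : ℝ => t⁻¹ := by
    simpa using convexOn_zpow (-1 : ℤ) (𝕜 := ℝ)
  refine ⟨convex_Ioi 0, fun x hx y hy hxy a b ha hb hab => ?_⟩
  have e1 := h1.2 hx hy hxy ha hb hab
  have e2 := h2.2 hx hy ha.le hb.le hab
  simp only [smul_eq_mul] at e1 e2 ⊢
  have e3 : 2 * c = (a + b) * (2 * c) := by rw [hab, one_mul]
  linarith

theorem exists_ray_roots_pos {n : ℕ} (hn : 1 < n) {c : ℝ} (hc : |c| ≤ 1) :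
    ∃ a b : ℝ, a < b ∧ (c = 1 → b = 1) ∧ ∀ t : ℝ,
      (0 < t ∧ 16 * t ^ 2 * (1 - 1 * t ^ n) = 1 - 2 * t * c + t ^ 2) ↔ (t = a ∨ t = b) := by
  obtain ⟨hc1, hc2⟩ := abs_le.1 hc
  set f : ℝ → ℝ := fun t => 16 * t ^ 2 * (1 - 1 * t ^ n) - (1 - 2 * t * c + t ^ 2) with hf
  have hcont : Continuous f := by fun_prop
  have hhalf : 0 < f (1 / 2) := by
    have : ((1 : ℝ) / 2) ^ n ≤ (1 / 2) ^ 2 := pow_le_pow_of_le_one (by norm_num) (by norm_num) hn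
    simp only [hf]
    linarith
  have h0 : f 0 < 0 := by norm_num [hf]
  have h1 : f 1 ≤ 0 := by simp only [hf, one_pow]; linarith
  obtain ⟨a, ha, ha'⟩ := intermediate_value_Icc (by norm_num : (0 : ℝ) ≤ 1 / 2)
    hcont.continuousOn (show (0 : ℝ) ∈ Set.Icc _ _ from ⟨h0.le, hhalf.le⟩)
  obtain ⟨b, hb, hb'⟩ : ∃ b ∈ Set.Icc (1 / 2 : ℝ) 1, f b = 0 ∧ (c = 1 → b = 1) := by
    by_cases hc' : c = 1
    · refine ⟨1, by norm_num, ?_, fun _ => rfl⟩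
      simp only [hf, hc', one_pow]; norm_num
    · obtain ⟨b, hb, hb'⟩ := intermediate_value_Icc' (by norm_num : (1 / 2 : ℝ) ≤ 1)
        hcont.continuousOn (show (0 : ℝ) ∈ Set.Icc _ _ from ⟨h1, hhalf.le⟩)
      exact ⟨b, hb, hb', fun h => (hc' h).elim⟩
  obtain ⟨hb', hb1⟩ := hb'
  have ha0 : 0 < a := lt_of_le_of_ne ha.1 (by rintro rfl; exact h0.ne ha')
  have hah : a < 1 / 2 := lt_of_le_of_ne ha.2 (by rintro rfl; exact hhalf.ne' ha')
  have hab : a < b := hah.trans_le hb.1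
  have hG : ∀ t : ℝ, 0 < t → f t = 0 → (15 * t + 2 * c - t⁻¹) - 16 * t ^ (n + 1) = 0 := by
    intro t ht h
    have ht' := ht.ne'
    simp only [hf] at h
    field_simp
    rw [pow_succ]
    linear_combination h
  have key : ∀ x y z : ℝ, 0 < x → x < y → y < z → f x = 0 → f y = 0 → f z = 0 → False := by
    intro x y z hx hxy hyz fx fy fz
    have hy := hx.trans hxy
    have hz := hy.trans hyz
    have := (strictConcaveOn_ray hn.le c).slope_anti_adjacent (Set.mem_Ioi.2 hx)
      (Set.mem_Ioi.2 hz) hxy hyz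
    rw [hG x hx fx, hG y hy fy, hG z hz fz] at this
    simp at this
  refine ⟨a, b, hab, hb1, fun t => ⟨?_, ?_⟩⟩
  · rintro ⟨ht, h⟩
    have h : f t = 0 := sub_eq_zero.2 h
    by_contra! hne
    rcases lt_or_gt_of_ne hne.1 with h1 | h1
    · exact key t a b ht h1 hab h ha' hb'
    · rcases lt_or_gt_of_ne hne.2 with h2 | h2
      · exact key a t b ha0 h1 h2 ha' h hb'
      · exact key a b t ha0 hab h2 ha' hb' h
  · rintro (rfl | rfl)
    · exact ⟨ha0, sub_eq_zero.1 ha'⟩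
    · exact ⟨ha0.trans hab, sub_eq_zero.1 hb'⟩

/-- The solutions on the ray through `u` are parametrised by a finset of known cardinality. -/
theorem exists_finset_ray_solutions {n : ℕ} (hn : 1 < n) {u : ℂ} (hu : u ^ (2 * n) = 1) :
    ∃ T : Finset ℝ,
      (∀ t : ℝ, t ∈ T ↔
        0 < t ∧ (extremalPoly n).eval (t * u) * (starRingEnd ℂ) (t * u) = 1) ∧
      T.card + (if u = 1 then 1 else 0) = 1 + if u ^ n = 1 then 1 else 0 := by
  have hnorm : ‖u‖ = 1 := Complex.norm_eq_one_of_pow_eq_one hu (by omega)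
  have hre : |u.re| ≤ 1 := hnorm ▸ Complex.abs_re_le_norm u
  have hone : ∀ t : ℝ, 0 < t → (t * u : ℂ) = 1 → u = 1 ∧ t = 1 := by
    intro t ht h
    have h' := congrArg norm h
    rw [norm_mul, hnorm, mul_one, norm_one, Complex.norm_real, Real.norm_of_nonneg ht.le] at h'
    subst h'
    simpa using h
  have hsq : (u ^ n) ^ 2 = 1 := by rw [← pow_mul, mul_comm n 2, hu]
  rcases eq_or_eq_neg_of_sq_eq_sq (u ^ n) 1 (by rw [hsq, one_pow]) with hun | hun
  · have hray := fun t : ℝ =>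
      extremalPoly_eval_ray_iff hn.le hnorm (ε := 1) (by simpa using hun) (t := t)
    obtain ⟨a, b, hab, hb1, hroots⟩ := exists_ray_roots_pos hn hre
    by_cases h1 : u = 1
    · have hb : b = 1 := hb1 (by simp [h1])
      refine ⟨{a}, fun t => ?_, by simp [h1]⟩
      rw [hray, Finset.mem_singleton]
      constructor
      · rintro rfl
        obtain ⟨h0, h⟩ := (hroots t).2 (Or.inl rfl)
        exact ⟨h0, fun h' => hab.ne ((hone t h0 h').2.trans hb.symm), h⟩
      · rintro ⟨h0, hne, h⟩
        refine ((hroots t).1 ⟨h0, h⟩).resolve_right ?_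
        rintro rfl
        exact hne (by simp [h1, hb])
    · refine ⟨{a, b}, fun t => ?_, by rw [Finset.card_pair hab.ne]; simp [h1, hun]⟩
      rw [hray, Finset.mem_insert, Finset.mem_singleton, ← hroots]
      exact ⟨fun h => ⟨h.1, fun h' => h1 (hone t h.1 h').1, h.2⟩, fun h => ⟨h.1, h.2.2⟩⟩
  · have hray := fun t : ℝ =>
      extremalPoly_eval_ray_iff hn.le hnorm (ε := -1) (by simpa using hun) (t := t)
    have hun1 : u ^ n ≠ 1 := by rw [hun]; norm_num
    have h1 : u ≠ 1 := by rintro rfl; exact hun1 (one_pow n)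
    obtain ⟨a, hroots⟩ := exists_ray_root_neg n hre
    refine ⟨{a}, fun t => ?_, by simp [h1, hun1]⟩
    rw [hray, Finset.mem_singleton, ← hroots]
    exact ⟨fun h => ⟨h.1, fun h' => h1 (hone t h.1 h').1, h.2⟩, fun h => ⟨h.1, h.2.2⟩⟩

theorem logharmonic_valence_sharp (n : ℕ) (hn : 1 < n) :
    ∃ (p q : Polynomial ℂ) (w : ℂ),
      p.natDegree = n ∧ q.natDegree = 1 ∧
      {z : ℂ | p.eval z * (starRingEnd ℂ) (q.eval z) = w}.ncard = 3 * n - 1 := by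
  classical
  refine ⟨extremalPoly n, Polynomial.X, 1, natDegree_extremalPoly hn.le,
    Polynomial.natDegree_X, ?_⟩
  simp only [Polynomial.eval_X]
  have : NeZero n := ⟨by omega⟩
  set U := Polynomial.nthRootsFinset (2 * n) (1 : ℂ) with hU
  have hmem : ∀ u : ℂ, u ∈ U ↔ u ^ (2 * n) = 1 := fun u =>
    Polynomial.mem_nthRootsFinset (by omega) 1
  have hUcard : U.card = 2 * n :=
    (Complex.isPrimitiveRoot_exp (2 * n) (by omega)).card_nthRootsFinset
  have hAcard : (U.filter fun u => u ^ n = 1).card = n := by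
    refine Eq.trans ?_ (Complex.isPrimitiveRoot_exp n (by omega)).card_nthRootsFinset
    congr 1
    ext u
    rw [Finset.mem_filter, hmem, Polynomial.mem_nthRootsFinset (by omega)]
    exact ⟨fun h => h.2, fun h => ⟨by rw [mul_comm, pow_mul, h, one_pow], h⟩⟩
  have h1U : (1 : ℂ) ∈ U := (hmem 1).2 (one_pow _)
  choose! T hT hTcard using fun u (hu : u ∈ U) => exists_finset_ray_solutions hn ((hmem u).1 hu)
  have hnorm : ∀ u ∈ U, ‖u‖ = 1 := fun u hu =>
    Complex.norm_eq_one_of_pow_eq_one ((hmem u).1 hu) (by omega)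
  have hset : {z : ℂ | (extremalPoly n).eval z * (starRingEnd ℂ) z = 1} =
      ↑((U.sigma T).image fun x : (_ : ℂ) × ℝ => (x.2 * x.1 : ℂ)) := by
    ext z
    simp only [Set.mem_ofPred_eq, Finset.coe_image, Set.mem_image, Finset.mem_coe,
      Finset.mem_sigma]
    constructor
    · intro h
      obtain ⟨r, hr⟩ := exists_pow_eq_ofReal_of_extremalPoly_eval hn.le h
      have hz : z ≠ 0 := by rintro rfl; simp at h
      have hz' : (‖z‖ : ℂ) ≠ 0 := by simpa using hz
      have hmul : (‖z‖ : ℂ) * (z / ‖z‖) = z := by field_simp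
      have huU : z / ‖z‖ ∈ U := by
        have hr2 : r ^ 2 = ‖z‖ ^ (2 * n) := by
          have := congrArg norm hr
          rw [norm_pow, Complex.norm_real, Real.norm_eq_abs] at this
          rw [mul_comm, pow_mul, this, sq_abs]
        rw [hmem, div_pow, mul_comm, pow_mul, hr, mul_comm, ← Complex.ofReal_pow,
          ← Complex.ofReal_pow, hr2]
        exact div_self (by exact_mod_cast pow_ne_zero _ hz')
      refine ⟨⟨z / ‖z‖, ‖z‖⟩, ⟨huU, ?_⟩, hmul⟩
      rw [hT _ huU]
      exact ⟨norm_pos_iff.2 hz, by rwa [hmul]⟩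
    · rintro ⟨⟨u, t⟩, ⟨hu, ht⟩, rfl⟩
      exact ((hT u hu t).1 ht).2
  rw [hset, Set.ncard_coe_finset, Finset.card_image_of_injOn, Finset.card_sigma]
  · have hsum := Finset.sum_congr (rfl : U = U) hTcard
    rw [Finset.sum_add_distrib, Finset.sum_add_distrib, Finset.sum_ite_eq' U (1 : ℂ), if_pos h1U,
      Finset.sum_const, hUcard, ← Finset.card_filter, hAcard] at hsum
    simp only [smul_eq_mul] at hsum
    omega
  · rintro ⟨u, t⟩ hx ⟨v, s⟩ hy h
    simp only [Finset.mem_coe, Finset.mem_sigma] at hx hy h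
    have ht := ((hT u hx.1 t).1 hx.2).1
    have hs := ((hT v hy.1 s).1 hy.2).1
    have h' := congrArg norm h
    rw [norm_mul, norm_mul, hnorm u hx.1, hnorm v hy.1, Complex.norm_real, Complex.norm_real,
      Real.norm_of_nonneg ht.le, Real.norm_of_nonneg hs.le, mul_one, mul_one] at h'
    subst h'
    have : u = v := mul_left_cancel₀ (by exact_mod_cast ht.ne') h
    rw [this]
end

section
/- For each integer n > 1, if p is a complex polynomial of degree n and q is a complex polynomial of degree 1, then for every w ∈ ℂ the solution set {z ∈ ℂ : p(z)·conj(q(z)) = w} is finite and has at most 3n − 1 elements. -/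
section Dynamics

open Polynomial Metric Set Filter Topology ComplexConjugate

/-- The anti-holomorphic map `z ↦ conj (w / p z)`, whose fixed points (away from the zeros of `p`)
are the solutions of `p z * conj z = w`. -/
noncomputable def conjDivEval (p : ℂ[X]) (w z : ℂ) : ℂ := conj (w / p.eval z)

/-- The norm of the derivative of `z ↦ w / p z`. -/
noncomputable def normDerivDivEval (p : ℂ[X]) (w z : ℂ) : ℝ :=
  ‖w * p.derivative.eval z / p.eval z ^ 2‖

theorem exists_differentiableOn_lift_eval {p : ℂ[X]} {ρ : ℝ} (hρ : 0 < ρ) {T : ℂ → ℂ}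
    (hT : DifferentiableOn ℂ T (ball 0 ρ))
    (hreg : ∀ t ∈ ball (0 : ℂ) ρ, ∀ c, p.eval c = T t → p.derivative.eval c ≠ 0)
    {b : ℂ} (hb : p.eval b = T 0) :
    ∃ φ : ℂ → ℂ, DifferentiableOn ℂ φ (ball 0 ρ) ∧ φ 0 = b ∧
      (∀ t ∈ ball (0 : ℂ) ρ, p.eval (φ t) = T t) := by
  have h0 : (0 : ℂ) ∈ ball (0 : ℂ) ρ := by simpa using hρ
  have : ContractibleSpace (ball (0 : ℂ) ρ) :=
    (convex_ball (0 : ℂ) ρ).contractibleSpace ⟨0, h0⟩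
  have : LocallyPathConnectedSpace (ball (0 : ℂ) ρ) := isOpen_ball.locallyPathConnectedSpace
  obtain ⟨F, ⟨hF0, hF⟩, -⟩ := p.isCoveringMapOn_eval.existsUnique_continuousMap_lifts
    (⟨fun t : ball (0 : ℂ) ρ ↦ T t, hT.continuousOn.domRestrict⟩ : C(ball (0 : ℂ) ρ, ℂ))
    (a₀ := ⟨0, h0⟩) (e₀ := b) hb (by
      rintro ⟨t, ht⟩ ⟨c, hc, hct⟩
      exact hreg t ht c hct hc)
  classical
  let φ : ℂ → ℂ := fun t ↦ if h : t ∈ ball (0 : ℂ) ρ then F ⟨t, h⟩ else 0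
  have hφ : ∀ t (h : t ∈ ball (0 : ℂ) ρ), φ t = F ⟨t, h⟩ := fun t h ↦ dif_pos h
  have hpφ : ∀ t ∈ ball (0 : ℂ) ρ, p.eval (φ t) = T t := fun t ht ↦ by
    rw [hφ t ht]; exact congrFun hF ⟨t, ht⟩
  have hcont : ContinuousOn φ (ball 0 ρ) := by
    rw [continuousOn_iff_continuous_domRestrict]
    convert F.continuous using 1
    ext t
    exact hφ t t.2
  refine ⟨φ, fun t ht ↦ DifferentiableAt.differentiableWithinAt ?_, by rw [hφ 0 h0, hF0], hpφ⟩
  have hnhds : ball (0 : ℂ) ρ ∈ 𝓝 t := isOpen_ball.mem_nhds ht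
  have hd := p.hasStrictDerivAt (φ t)
  have hne := hreg t ht (φ t) (hpφ t ht)
  have hinv := hd.to_localInverse hne
  have hleft := (hd.hasStrictFDerivAt_equiv hne).eventually_left_inverse
  have hcomp : DifferentiableAt ℂ (fun s ↦ hd.localInverse _ _ _ hne (T s)) t := by
    have h2 := hinv.hasDerivAt.differentiableAt
    rw [hpφ t ht] at h2
    exact h2.comp t (hT.differentiableAt hnhds)
  refine hcomp.congr_of_eventuallyEq ?_
  filter_upwards [(hcont.continuousAt hnhds).eventually hleft, hnhds] with s hs hs'
  rw [← hpφ s hs']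
  exact hs.symm

theorem exists_lift_conjDivEval {p : ℂ[X]} {w : ℂ} (hw : w ≠ 0) {B : Set ℂ}
    (hB : ∀ z, conjDivEval p w z ∈ B → z ∈ B) (h0 : 0 ∉ B)
    (hcrit : ∀ c ∈ B, p.derivative.eval c ≠ 0) {ρ : ℝ} (hρ : 0 < ρ) {ψ : ℂ → ℂ}
    (hψ : DifferentiableOn ℂ ψ (ball 0 ρ)) (hψB : MapsTo ψ (ball 0 ρ) B) {b : ℂ}
    (hb : conjDivEval p w b = ψ 0) :
    ∃ φ : ℂ → ℂ, DifferentiableOn ℂ φ (ball 0 ρ) ∧ MapsTo φ (ball 0 ρ) B ∧ φ 0 = b ∧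
      ‖deriv φ 0‖ * normDerivDivEval p w b = ‖deriv ψ 0‖ := by
  have hz : (0 : ℂ) ∈ ball (0 : ℂ) ρ := by simpa using hρ
  have hconj : ∀ t ∈ ball (0 : ℂ) ρ, conj t ∈ ball (0 : ℂ) ρ := fun t ht ↦ by simpa using ht
  have hne : ∀ t ∈ ball (0 : ℂ) ρ, ψ t ≠ 0 := fun t ht h ↦ h0 (h ▸ hψB ht)
  let χ : ℂ → ℂ := conj ∘ ψ ∘ conj
  have hχ : ∀ t ∈ ball (0 : ℂ) ρ, DifferentiableAt ℂ χ t := fun t ht ↦ by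
    exact differentiableAt_conj_conj_iff.2
      (hψ.differentiableAt (isOpen_ball.mem_nhds (hconj t ht)))
  have hχne : ∀ t ∈ ball (0 : ℂ) ρ, χ t ≠ 0 := fun t ht ↦ by
    simpa [χ] using hne _ (hconj t ht)
  have hg : ∀ c t, p.eval c = w / χ t → conjDivEval p w c = ψ (conj t) := fun c t h ↦ by
    rw [conjDivEval, h, div_div_cancel₀ hw]; simp [χ]
  have hbχ : p.eval b = w / χ 0 := by
    have : χ 0 = w / p.eval b := by
      simp only [χ, Function.comp, map_zero, ← hb, conjDivEval, Complex.conj_conj]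
    rw [this, div_div_cancel₀ hw]
  obtain ⟨φ, hφ, hφ0, hpφ⟩ := exists_differentiableOn_lift_eval (p := p) hρ
    (T := fun t ↦ w / χ t) (b := b)
    (fun t ht ↦ ((differentiableAt_const w).div (hχ t ht) (hχne t ht)).differentiableWithinAt)
    (fun t ht c hc ↦ hcrit c (hB c (by rw [hg c t hc]; exact hψB (hconj t ht)))) hbχ
  refine ⟨φ, hφ, fun t ht ↦ hB _ (by rw [hg _ t (hpφ t ht)]; exact hψB (hconj t ht)), hφ0, ?_⟩
  have hd : HasDerivAt (fun t ↦ p.eval (φ t)) (p.derivative.eval b * deriv φ 0) 0 := by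
    have := (p.hasDerivAt (φ 0)).comp (0 : ℂ)
      (hφ.differentiableAt (isOpen_ball.mem_nhds hz)).hasDerivAt
    rwa [hφ0] at this
  have hd' : HasDerivAt (fun t ↦ w / χ t) (p.derivative.eval b * deriv φ 0) 0 :=
    hd.congr_of_eventuallyEq
      (by filter_upwards [isOpen_ball.mem_nhds hz] with t ht using (hpφ t ht).symm)
  have hd'' := (hasDerivAt_const (0 : ℂ) w).div (hχ 0 hz).hasDerivAt (hχne 0 hz)
  have heq := hd'.unique hd''
  have hχ' : ‖deriv χ 0‖ = ‖deriv ψ 0‖ := by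
    simp only [χ, deriv_conj_conj]; simp
  have hb0 : p.eval b ≠ 0 := by rw [hbχ]; exact div_ne_zero hw (hχne 0 hz)
  have hn : χ 0 ≠ 0 := hχne 0 hz
  rw [← hχ', normDerivDivEval, ← norm_mul, hbχ]
  have : deriv φ 0 * (w * p.derivative.eval b / (w / χ 0) ^ 2) = - deriv χ 0 := by
    have h3 : p.derivative.eval b * deriv φ 0 = - (w * deriv χ 0) / χ 0 ^ 2 := by
      rw [heq]; ring
    calc _ = (p.derivative.eval b * deriv φ 0) * (w / (w / χ 0) ^ 2) := by ring
      _ = _ := by rw [h3]; field_simp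
  rw [this, norm_neg]

theorem radius_mul_le_of_inverse_branches {p : ℂ[X]} {w : ℂ} (hw : w ≠ 0) {B : Set ℂ}
    (hB : ∀ z, conjDivEval p w z ∈ B → z ∈ B) (h0 : 0 ∉ B)
    (hcrit : ∀ c ∈ B, p.derivative.eval c ≠ 0) {δ : ℝ} {a : ℂ} (hδ : 0 < δ)
    (ha : ∀ z ∈ B, δ ≤ ‖z - a‖) (b : ℂ) (k : ℕ) {ρ : ℝ} (hρ : 0 < ρ)
    (hball : ball ((conjDivEval p w)^[k] b) ρ ⊆ B) :
    ρ ≤ ‖b - a‖ ^ 2 / δ * ∏ j ∈ Finset.range k, normDerivDivEval p w ((conjDivEval p w)^[j] b) := by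
  set g := conjDivEval p w with hg
  have hz : (0 : ℂ) ∈ ball (0 : ℂ) ρ := by simpa using hρ
  have key : ∀ i ≤ k, ∃ ψ : ℂ → ℂ, DifferentiableOn ℂ ψ (ball 0 ρ) ∧ MapsTo ψ (ball 0 ρ) B ∧
      ψ 0 = g^[k - i] b ∧
      ‖deriv ψ 0‖ * ∏ j ∈ Finset.Ico (k - i) k, normDerivDivEval p w (g^[j] b) = 1 := by
    intro i
    induction i with
    | zero =>
      intro _
      refine ⟨fun t ↦ g^[k] b + t, by fun_prop, fun t ht ↦ hball (by simpa using ht), by simp, ?_⟩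
      simp
    | succ i ih =>
      intro hi
      obtain ⟨ψ, h1, h2, h3, h4⟩ := ih (by omega)
      obtain ⟨φ, h5, h6, h7, h8⟩ := exists_lift_conjDivEval hw hB h0 hcrit hρ h1 h2
        (b := g^[k - (i + 1)] b) (by
          rw [h3, ← hg, ← Function.iterate_succ_apply' g]
          congr 2; omega)
      refine ⟨φ, h5, h6, h7, ?_⟩
      rw [Finset.prod_eq_prod_Ico_succ_bot (by omega), ← mul_assoc, h8,
        show k - (i + 1) + 1 = k - i by omega, h4]
  obtain ⟨ψ, h1, h2, h3, h4⟩ := key k le_rfl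
  simp only [Nat.sub_self, Function.iterate_zero, id, ← Finset.range_eq_Ico] at h3 h4
  set M := ∏ j ∈ Finset.range k, normDerivDivEval p w (g^[j] b)
  have hne : ∀ t ∈ ball (0 : ℂ) ρ, ψ t - a ≠ 0 := fun t ht h ↦ by
    have := ha _ (h2 ht); rw [h, norm_zero] at this; linarith
  have hba : b - a ≠ 0 := h3 ▸ hne 0 hz
  have hder : HasDerivAt (fun t ↦ (ψ t - a)⁻¹) (-deriv ψ 0 / (ψ 0 - a) ^ 2) 0 :=
    (((h1.differentiableAt (isOpen_ball.mem_nhds hz)).hasDerivAt).sub_const a).fun_inv (hne 0 hz)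
  have hest : ∀ r ∈ Ioo 0 ρ, ‖deriv (fun t ↦ (ψ t - a)⁻¹) 0‖ ≤ δ⁻¹ / r := by
    intro r hr
    have hsub : closedBall (0 : ℂ) r ⊆ ball 0 ρ := closedBall_subset_ball hr.2
    refine Complex.norm_deriv_le_of_forall_mem_sphere_norm_le hr.1 ?_ fun z hz' ↦ ?_
    · refine DifferentiableOn.diffContOnCl_ball (U := ball 0 ρ) (fun t ht ↦ ?_) hsub
      exact ((h1 t ht).sub_const a).inv (hne t ht)
    · rw [norm_inv]
      exact inv_anti₀ hδ (ha _ (h2 (hsub (sphere_subset_closedBall hz'))))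
  rw [hder.deriv, h3, norm_div, norm_neg, norm_pow] at hest
  have hpos : 0 < ‖b - a‖ ^ 2 := by positivity
  have hprod : 0 ≤ M := Finset.prod_nonneg fun _ _ ↦ norm_nonneg _
  refine le_of_forall_lt_imp_le_of_dense fun r hr ↦ ?_
  rcases le_or_gt r 0 with hr0 | hr0
  · exact hr0.trans (by positivity)
  have h5 := hest r ⟨hr0, hr⟩
  rw [div_le_div_iff₀ hpos hr0] at h5
  have h6 := mul_le_mul_of_nonneg_right h5 hprod
  calc r = ‖deriv ψ 0‖ * r * M := by rw [mul_right_comm, h4, one_mul]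
    _ ≤ _ := h6
    _ = _ := by ring

theorem HasDerivAt.tendsto_sub_div {ι : Type*} {F : Filter ι} {φ : ℂ → ℂ} {d l : ℂ}
    (hφ : HasDerivAt φ d 0) {x y : ι → ℂ} (hy : Tendsto y F (𝓝 0))
    (hyx : Tendsto (fun i ↦ y i / x i) F (𝓝 l)) :
    Tendsto (fun i ↦ (φ (y i) - φ 0) / x i) F (𝓝 (l * d)) := by
  have h1 : Tendsto (fun i ↦ dslope φ 0 (y i)) F (𝓝 d) := by
    have := (continuousAt_dslope_same.2 hφ.differentiableAt).tendsto.comp hy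
    rwa [dslope_same, hφ.deriv] at this
  refine (hyx.mul h1).congr fun i ↦ ?_
  have := sub_smul_dslope φ 0 (y i)
  rw [smul_eq_mul, sub_zero] at this
  rw [← this]; ring

theorem eventually_norm_le_one_of_cone {ι : Type*} {F : Filter ι} {H x : ι → ℂ} {α : ℝ}
    (hα : 0 < α) (hx : Tendsto x F (𝓝 0)) (hx0 : ∀ᶠ i in F, x i ≠ 0)
    (hH : Tendsto (fun i ↦ (H i - 1) / x i) F (𝓝 (-α : ℂ))) :
    ∀ᶠ i in F, |(x i).im| < 2 * (x i).re → ‖H i‖ ≤ 1 := by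
  have h1 : ∀ᶠ i in F, ‖(H i - 1) / x i - (-α : ℂ)‖ < α / 8 := by
    filter_upwards [hH (ball_mem_nhds _ (show 0 < α / 8 by positivity))] with i hi
    simpa [dist_eq_norm] using hi
  have h2 : ∀ᶠ i in F, ‖x i‖ < 1 / (20 * α) := by
    filter_upwards [hx (ball_mem_nhds _ (show 0 < 1 / (20 * α) by positivity))] with i hi
    simpa using hi
  filter_upwards [h1, h2, hx0] with i h1 h2 h3 hc
  set κ := (H i - 1) / x i with hκ
  have hHi : H i = 1 + x i * κ := by rw [hκ]; field_simp; ring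
  have hre := (Complex.abs_re_le_norm _).trans h1.le
  have him := (Complex.abs_im_le_norm _).trans h1.le
  simp only [Complex.sub_re, Complex.neg_re, Complex.ofReal_re, Complex.sub_im, Complex.neg_im,
    Complex.ofReal_im, neg_zero, sub_zero] at hre him
  have hxre := (Complex.re_le_norm (x i)).trans h2.le
  rw [lt_div_iff₀ (by positivity)] at h2
  rw [le_div_iff₀ (by positivity)] at hxre
  rw [abs_le] at hre him
  rw [abs_lt] at hc
  have hpos : 0 < (x i).re := by linarith
  suffices ‖H i‖ ^ 2 ≤ 1 by nlinarith [norm_nonneg (H i)]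
  rw [hHi, ← Complex.normSq_eq_norm_sq, Complex.normSq_apply]
  simp only [Complex.add_re, Complex.one_re, Complex.mul_re, Complex.add_im, Complex.one_im,
    Complex.mul_im]
  set X := (x i).re
  set Y := (x i).im
  set P := κ.re
  set S := κ.im
  have e1 : X * P ≤ -(7 / 8 * α) * X := by nlinarith
  have e2 : -(Y * S) ≤ 2 * X * (α / 8) := by
    have : |Y * S| ≤ 2 * X * (α / 8) := by
      rw [abs_mul]
      exact mul_le_mul (abs_le.2 ⟨by linarith, by linarith⟩) (abs_le.2 ⟨by linarith, by linarith⟩)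
        (abs_nonneg _) (by linarith)
    linarith [neg_abs_le (Y * S)]
  have e3 : X ^ 2 + Y ^ 2 ≤ 5 * X ^ 2 := by nlinarith
  have e4 : P ^ 2 + S ^ 2 ≤ 2 * α ^ 2 := by nlinarith
  have e5 : (X ^ 2 + Y ^ 2) * (P ^ 2 + S ^ 2) ≤ 5 * X ^ 2 * (2 * α ^ 2) := by gcongr
  have e6 : 5 * X ^ 2 * (2 * α ^ 2) ≤ α * X / 2 := by
    have : X * (20 * α) * (α * X) ≤ 1 * (α * X) := by gcongr
    nlinarith
  nlinarith [mul_pos hα hpos]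

theorem exists_parabolic_expansion {q : ℂ → ℂ} {z₀ : ℂ} (hq : AnalyticAt ℂ q z₀)
    (hfix : q z₀ = z₀) (hder : deriv q z₀ = 1) (hid : ¬ ∀ᶠ z in 𝓝 z₀, q z = z) :
    ∃ (m : ℕ) (A : ℂ → ℂ), m ≠ 0 ∧ AnalyticAt ℂ A z₀ ∧ A z₀ ≠ 0 ∧
      ∀ᶠ z in 𝓝 z₀, q z = z + (z - z₀) ^ (m + 1) * A z := by
  have hh : AnalyticAt ℂ (fun z ↦ q z - z) z₀ := hq.sub analyticAt_id
  obtain ⟨N, A, hA, hA0, hev⟩ := hh.exists_eventuallyEq_pow_smul_nonzero_iff.2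
    (fun h ↦ hid (h.mono fun z hz ↦ sub_eq_zero.1 hz))
  simp only [smul_eq_mul] at hev
  have hN0 : N ≠ 0 := by
    rintro rfl
    have := hev.self_of_nhds
    simp [hfix, eq_comm, hA0] at this
  have hN1 : N ≠ 1 := by
    rintro rfl
    have h1 : HasDerivAt (fun z ↦ q z - z) (1 - 1) z₀ :=
      (hder ▸ hq.differentiableAt.hasDerivAt).sub (hasDerivAt_id z₀)
    have h2 : HasDerivAt (fun z ↦ (z - z₀) ^ 1 * A z) (1 * A z₀ + (z₀ - z₀) * deriv A z₀) z₀ := by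
      simpa using ((hasDerivAt_id z₀).sub_const z₀).fun_mul hA.differentiableAt.hasDerivAt
    have := (h1.congr_of_eventuallyEq (hev.mono fun z hz ↦ hz.symm)).unique h2
    simp [eq_comm, hA0] at this
  refine ⟨N - 1, A, by omega, hA, hA0, hev.mono fun z hz ↦ ?_⟩
  rw [show N - 1 + 1 = N by omega, ← hz]; ring

theorem exists_parabolic_estimates {q : ℂ → ℂ} {z₀ : ℂ} (hq : AnalyticAt ℂ q z₀)
    (hfix : q z₀ = z₀) (hder : deriv q z₀ = 1) (hid : ¬ ∀ᶠ z in 𝓝 z₀, q z = z) :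
    ∃ (m : ℕ) (a : ℂ) (r : ℝ), m ≠ 0 ∧ a ≠ 0 ∧ 0 < r ∧ ∀ z, z ≠ z₀ → ‖z - z₀‖ < r →
      q z ≠ z₀ ∧ ‖(-a * (q z - z₀) ^ m)⁻¹ - (-a * (z - z₀) ^ m)⁻¹ - m‖ ≤ 1 / 4 ∧
      (|(-a * (z - z₀) ^ m).im| < 2 * (-a * (z - z₀) ^ m).re →
        ‖q z - z₀‖ ≤ ‖z - z₀‖ ∧ ‖deriv q z‖ ^ 2 * ‖z - z₀‖ ^ 3 ≤ ‖q z - z₀‖ ^ 3) := by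
  obtain ⟨m, A, hm, hA, hA0, hev⟩ := exists_parabolic_expansion hq hfix hder hid
  set a := A z₀ with ha
  set x : ℂ → ℂ := fun z ↦ -a * (z - z₀) ^ m with hx
  set F := 𝓝[≠] z₀ with hF
  have hFle : F ≤ 𝓝 z₀ := nhdsWithin_le_nhds
  have hxne : ∀ z, z ≠ z₀ → x z ≠ 0 := fun z hz ↦
    mul_ne_zero (neg_ne_zero.2 hA0) (pow_ne_zero _ (sub_ne_zero.2 hz))
  have hne : ∀ᶠ z in F, z ≠ z₀ := self_mem_nhdsWithin
  have hx0 : ∀ᶠ z in F, x z ≠ 0 := hne.mono hxne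
  have hAt : Tendsto A F (𝓝 a) := hA.continuousAt.tendsto.mono_left hFle
  have hζ : Tendsto (fun z ↦ z - z₀) F (𝓝 0) := by
    have : Tendsto (fun z ↦ z - z₀) (𝓝 z₀) (𝓝 (z₀ - z₀)) :=
      (show Continuous fun z ↦ z - z₀ by fun_prop).tendsto z₀
    rw [sub_self] at this; exact this.mono_left hFle
  have hxt : Tendsto x F (𝓝 0) := by
    have := (hζ.pow m).const_mul (-a)
    simpa [hm, hx] using this
  -- the ratio `(q z - z₀) / (z - z₀) = 1 + y z`
  set y : ℂ → ℂ := fun z ↦ (z - z₀) ^ m * A z with hy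
  have hyx : Tendsto (fun z ↦ y z / x z) F (𝓝 (-1)) := by
    have h1 : Tendsto (fun z ↦ A z / (-a)) F (𝓝 (a / (-a))) := hAt.div_const _
    rw [div_neg, div_self hA0] at h1
    refine h1.congr' (hne.mono fun z hz ↦ ?_)
    have := pow_ne_zero m (sub_ne_zero.2 hz)
    simp only [hy, hx]; field_simp
  have hyt : Tendsto y F (𝓝 0) := by
    have := (hyx.mul hxt)
    rw [mul_zero] at this
    exact this.congr' (hx0.mono fun z hz ↦ by field_simp)
  have hqy : ∀ᶠ z in F, q z - z₀ = (z - z₀) * (1 + y z) := by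
    filter_upwards [hev.filter_mono hFle] with z hz
    rw [hz, hy]; ring
  -- the derivative `deriv q z = 1 + v z`
  set v : ℂ → ℂ := fun z ↦ deriv q z - 1 with hv
  have hvx : Tendsto (fun z ↦ v z / x z) F (𝓝 (-(m + 1))) := by
    have h1 : Tendsto (fun z ↦ ((m + 1) * A z + (z - z₀) * deriv A z) / (-a)) F
        (𝓝 (((m + 1) * a + 0 * deriv A z₀) / (-a))) :=
      (((hAt.const_mul _).add
        (hζ.mul (hA.deriv.continuousAt.tendsto.mono_left hFle))).div_const _)
    rw [zero_mul, add_zero, div_neg, mul_div_cancel_right₀ _ hA0] at h1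
    refine h1.congr' ?_
    filter_upwards [hne, (hev.eventually_nhds).filter_mono hFle,
      hA.eventually_analyticAt.filter_mono hFle] with z hz hz2 hz3
    have hd : HasDerivAt (fun z ↦ z + (z - z₀) ^ (m + 1) * A z)
        (1 + ((((m + 1 : ℕ) : ℂ) * (z - z₀) ^ m * 1) * A z + (z - z₀) ^ (m + 1) * deriv A z)) z :=
      (hasDerivAt_id z).add
        ((((hasDerivAt_id z).sub_const z₀).pow (m + 1)).mul hz3.differentiableAt.hasDerivAt)
    have hd2 : deriv q z = _ := (hd.congr_of_eventuallyEq hz2).deriv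
    have := pow_ne_zero m (sub_ne_zero.2 hz)
    simp only [hv, hx, hd2]
    field_simp
    push_cast
    ring
  have hvt : Tendsto v F (𝓝 0) := by
    have := (hvx.mul hxt)
    rw [mul_zero] at this
    exact this.congr' (hx0.mono fun z hz ↦ by field_simp)
  have hs1 : Tendsto (fun z ↦ 1 + y z) F (𝓝 1) := by simpa using hyt.const_add 1
  have hsne : ∀ᶠ z in F, 1 + y z ≠ 0 := hs1.eventually_ne one_ne_zero
  have E1 : ∀ᶠ z in F, ‖(x z)⁻¹ * (((1 + y z) ^ m)⁻¹ - 1) - m‖ ≤ 1 / 4 := by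
    have hφ : HasDerivAt (fun t : ℂ ↦ ((1 + t) ^ m)⁻¹) (-m) 0 := by
      have := (((hasDerivAt_id (0 : ℂ)).const_add 1).pow m).fun_inv (by simp)
      simpa using this
    have := hφ.tendsto_sub_div hyt hyx
    simp only [add_zero, one_pow, inv_one, neg_mul, one_mul, neg_neg] at this
    filter_upwards [this (closedBall_mem_nhds _ (show (0 : ℝ) < 1 / 4 by norm_num))] with z hz
    rw [mem_preimage, mem_closedBall, dist_eq_norm, div_eq_inv_mul] at hz
    exact hz
  have E2 : ∀ᶠ z in F, |(x z).im| < 2 * (x z).re → ‖1 + y z‖ ≤ 1 :=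
    eventually_norm_le_one_of_cone one_pos hxt hx0 (by simpa using hyx)
  have E3 : ∀ᶠ z in F, |(x z).im| < 2 * (x z).re → ‖(1 + v z) ^ 2 / (1 + y z) ^ 3‖ ≤ 1 := by
    have hα : (0 : ℝ) < 2 * m - 1 := by
      have : (1 : ℝ) ≤ m := by exact_mod_cast Nat.one_le_iff_ne_zero.2 hm
      linarith
    refine eventually_norm_le_one_of_cone hα hxt hx0 ?_
    have hφ2 : HasDerivAt (fun t : ℂ ↦ (1 + t) ^ 2) 2 0 := by
      simpa using ((hasDerivAt_id (0 : ℂ)).const_add 1).fun_pow 2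
    have hφ3 : HasDerivAt (fun t : ℂ ↦ (1 + t) ^ 3) 3 0 := by
      simpa using ((hasDerivAt_id (0 : ℂ)).const_add 1).fun_pow 3
    have h := ((hφ2.tendsto_sub_div hvt hvx).sub (hφ3.tendsto_sub_div hyt hyx)).div (hs1.pow 3)
      (by norm_num)
    have hlim : ((-(m + 1) * 2 - -1 * 3) / 1 ^ 3 : ℂ) = -((2 * m - 1 : ℝ) : ℂ) := by
      push_cast; ring
    rw [hlim] at h
    refine h.congr' ?_
    filter_upwards [hx0, hsne] with z h1 h2
    have h2' := pow_ne_zero 3 h2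
    simp only [Pi.div_apply]
    field_simp
    ring
  have Eall := (hne.and hqy).and (hsne.and (E1.and (E2.and E3)))
  rw [hF, eventually_nhdsWithin_iff, Metric.eventually_nhds_iff] at Eall
  obtain ⟨r, hr, hall⟩ := Eall
  refine ⟨m, a, r, hm, hA0, hr, fun z hz hzr ↦ ?_⟩
  obtain ⟨⟨-, h1⟩, h2, h3, h4, h5⟩ := hall (by rwa [dist_eq_norm]) hz
  have hz' := sub_ne_zero.2 hz
  refine ⟨fun h ↦ ?_, ?_, fun hc ↦ ⟨?_, ?_⟩⟩
  · rw [h, sub_self] at h1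
    exact mul_ne_zero hz' h2 h1.symm
  · rw [h1, mul_pow, ← mul_assoc, mul_inv]
    convert h3 using 3
    simp only [hx]; ring
  · rw [h1, norm_mul]
    exact mul_le_of_le_one_right (norm_nonneg _) (h4 hc)
  · have h6 := h5 hc
    rw [norm_div, norm_pow, norm_pow, div_le_one (by positivity)] at h6
    rw [h1, norm_mul, mul_pow, mul_comm (‖z - z₀‖ ^ 3)]
    have : deriv q z = 1 + v z := by simp [hv]
    rw [this]
    gcongr

theorem cone_add {u u' : ℂ} {σ : ℝ} (hσ : 1 ≤ σ) (hσ2 : σ ≤ 2) {m : ℕ} (hm : m ≠ 0)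
    (hu : |u.im| < σ * u.re) (h : ‖u' - u - m‖ ≤ 1 / 4) :
    |u'.im| < σ * u'.re ∧ u.re + 3 / 4 ≤ u'.re := by
  have hre := (Complex.abs_re_le_norm _).trans h
  have him := (Complex.abs_im_le_norm _).trans h
  simp only [Complex.sub_re, Complex.sub_im, Complex.natCast_re, Complex.natCast_im] at hre him
  have hm1 : (1 : ℝ) ≤ m := by exact_mod_cast Nat.one_le_iff_ne_zero.2 hm
  rw [abs_le] at hre him
  rw [abs_lt] at hu ⊢
  have h1 : u.re + 3 / 4 ≤ u'.re := by linarith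
  refine ⟨⟨?_, ?_⟩, h1⟩ <;> nlinarith

theorem cone_inv {x : ℂ} {σ : ℝ} : |x⁻¹.im| < σ * x⁻¹.re ↔ |x.im| < σ * x.re := by
  rcases eq_or_ne x 0 with rfl | hx
  · simp
  rw [Complex.inv_im, Complex.inv_re, abs_div, abs_neg, abs_of_pos (Complex.normSq_pos.2 hx),
    ← mul_div_assoc, div_lt_div_iff_of_pos_right (Complex.normSq_pos.2 hx)]

theorem cone_mul {x ξ : ℂ} (hx : |x.im| < 1 * x.re) (hξ : ‖ξ - 1‖ ≤ 1 / 20) :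
    |(x * ξ).im| < 2 * (x * ξ).re := by
  have hre := (Complex.abs_re_le_norm _).trans hξ
  have him := (Complex.abs_im_le_norm _).trans hξ
  simp only [Complex.sub_re, Complex.sub_im, Complex.one_re, Complex.one_im, sub_zero] at hre him
  rw [abs_le] at hre him
  rw [abs_lt] at hx ⊢
  simp only [Complex.mul_re, Complex.mul_im]
  have hpos : 0 < x.re := by linarith
  constructor <;> nlinarith

/-- Attracting directions of a parabolic fixed point: there is an orbit converging to the fixed
point, around which the basin contains discs of radius proportional to the distance to the fixed
point, and along which the derivative of the iterates decays faster than this distance. -/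
theorem exists_parabolic_orbit {q : ℂ → ℂ} {z₀ : ℂ} (hq : AnalyticAt ℂ q z₀)
    (hfix : q z₀ = z₀) (hder : deriv q z₀ = 1) (hid : ¬ ∀ᶠ z in 𝓝 z₀, q z = z) :
    ∃ b : ℂ, ∃ c : ℝ, 0 < c ∧ b ≠ z₀ ∧ Tendsto (fun k ↦ q^[k] b) atTop (𝓝 z₀) ∧ ∀ k,
      q^[k] b ≠ z₀ ∧
      ball (q^[k] b) (c * ‖q^[k] b - z₀‖) ⊆ {x | Tendsto (fun j ↦ q^[j] x) atTop (𝓝 z₀)} ∧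
      (∏ j ∈ Finset.range k, ‖deriv q (q^[j] b)‖) ^ 2 ≤ (‖q^[k] b - z₀‖ / ‖b - z₀‖) ^ 3 := by
  obtain ⟨m, a, r, hm, ha, hr, hest⟩ := exists_parabolic_estimates hq hfix hder hid
  set x : ℂ → ℂ := fun z ↦ -a * (z - z₀) ^ m with hx
  have hxz : x z₀ = 0 := by simp [hx, hm]
  let V : ℝ → ℝ → Set ℂ := fun σ s ↦ {z | ‖z - z₀‖ < s ∧ |(x z).im| < σ * (x z).re}
  have hVne : ∀ {σ s z}, z ∈ V σ s → z ≠ z₀ := by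
    rintro σ s _ ⟨-, h⟩ rfl
    simp [hxz] at h
  have hstep : ∀ {σ s z}, 1 ≤ σ → σ ≤ 2 → s ≤ r → z ∈ V σ s →
      q z ∈ V σ s ∧ (x z)⁻¹.re + 3 / 4 ≤ (x (q z))⁻¹.re := by
    intro σ s z hσ hσ2 hs hz
    obtain ⟨h1, h2, h3⟩ := hest z (hVne hz) (hz.1.trans_le hs)
    have h4 := cone_add hσ hσ2 hm (cone_inv.2 hz.2) h2
    have hpos : 0 < (x z).re := by
      have := (abs_nonneg _).trans_lt hz.2
      nlinarith
    exact ⟨⟨(h3 (hz.2.trans_le (by gcongr))).1.trans_lt hz.1, cone_inv.1 h4.1⟩, h4.2⟩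
  have hiter : ∀ {σ s z}, 1 ≤ σ → σ ≤ 2 → s ≤ r → z ∈ V σ s → ∀ k : ℕ,
      q^[k] z ∈ V σ s ∧ k * (3 / 4 : ℝ) ≤ (x (q^[k] z))⁻¹.re := by
    intro σ s z hσ hσ2 hs hz k
    induction k with
    | zero =>
      refine ⟨hz, ?_⟩
      have := (abs_nonneg _).trans_lt (cone_inv.2 hz.2)
      simp only [Nat.cast_zero, zero_mul, Function.iterate_zero, id]
      nlinarith
    | succ k ih =>
      rw [Function.iterate_succ_apply']
      obtain ⟨h1, h2⟩ := hstep hσ hσ2 hs ih.1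
      refine ⟨h1, ?_⟩
      push_cast
      linarith [ih.2]
  have hconv : ∀ {σ s z}, 1 ≤ σ → σ ≤ 2 → s ≤ r → z ∈ V σ s →
      Tendsto (fun k ↦ q^[k] z) atTop (𝓝 z₀) := by
    intro σ s z hσ hσ2 hs hz
    have h1 : Tendsto (fun k ↦ ‖(x (q^[k] z))⁻¹‖) atTop atTop :=
      tendsto_atTop_mono (fun k ↦ (hiter hσ hσ2 hs hz k).2.trans (Complex.re_le_norm _))
        (tendsto_natCast_atTop_atTop.atTop_mul_const (by norm_num))
    have h2 : Tendsto (fun k ↦ ‖x (q^[k] z)‖ / ‖a‖) atTop (𝓝 0) := by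
      have := (h1.inv_tendsto_atTop).div_const ‖a‖
      simpa [norm_inv] using this
    have h3 : Tendsto (fun k ↦ ‖q^[k] z - z₀‖ ^ m) atTop (𝓝 0) := by
      refine h2.congr fun k ↦ ?_
      simp only [hx, norm_mul, norm_neg, norm_pow]
      field_simp
    rw [tendsto_iff_norm_sub_tendsto_zero]
    have h4 := (Real.continuousAt_rpow_const 0 ((m : ℝ)⁻¹) (Or.inr (by positivity))).tendsto.comp h3
    rw [Real.zero_rpow (by positivity)] at h4
    exact h4.congr fun k ↦ Real.pow_rpow_inv_natCast (norm_nonneg _) hm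
  obtain ⟨c, hc, hc1, hcξ⟩ : ∃ c : ℝ, 0 < c ∧ c ≤ 1 ∧
      ∀ ξ : ℂ, ‖ξ‖ < c → ‖(1 + ξ) ^ m - 1‖ ≤ 1 / 20 := by
    have : Tendsto (fun ξ : ℂ ↦ (1 + ξ) ^ m) (𝓝 0) (𝓝 ((1 + 0) ^ m)) :=
      (show Continuous fun ξ : ℂ ↦ (1 + ξ) ^ m by fun_prop).tendsto 0
    rw [add_zero, one_pow] at this
    obtain ⟨ε, hε, h⟩ := Metric.eventually_nhds_iff.1
      (this.eventually (closedBall_mem_nhds 1 (show (0 : ℝ) < 1 / 20 by norm_num)))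
    refine ⟨min ε 1, by positivity, min_le_right _ _, fun ξ hξ ↦ ?_⟩
    have := h (y := ξ) (by simpa using hξ.trans_le (min_le_left _ _))
    simpa [dist_eq_norm] using this
  have hballs : ∀ z ∈ V 1 (r / 2), ball z (c * ‖z - z₀‖) ⊆ V 2 r := by
    intro z hz z' hz'
    have hne : z - z₀ ≠ 0 := sub_ne_zero.2 (hVne hz)
    rw [mem_ball, dist_eq_norm] at hz'
    have heq : z' - z₀ = (z - z₀) * (1 + (z' - z) / (z - z₀)) := by field_simp; ring
    have hξ : ‖(z' - z) / (z - z₀)‖ < c := by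
      rwa [norm_div, div_lt_iff₀ (norm_pos_iff.2 hne)]
    refine ⟨?_, ?_⟩
    · calc ‖z' - z₀‖ = ‖(z' - z) + (z - z₀)‖ := by ring_nf
        _ ≤ ‖z' - z‖ + ‖z - z₀‖ := norm_add_le _ _
        _ < c * ‖z - z₀‖ + ‖z - z₀‖ := by gcongr
        _ ≤ 1 * ‖z - z₀‖ + ‖z - z₀‖ := by gcongr
        _ < r := by linarith [hz.1]
    · have : x z' = x z * (1 + (z' - z) / (z - z₀)) ^ m := by
        simp only [hx]; rw [heq, mul_pow]; ring
      rw [this]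
      exact cone_mul hz.2 (hcξ _ hξ)
  obtain ⟨κ, hκ⟩ := IsAlgClosed.exists_pow_nat_eq (-a⁻¹) (Nat.pos_of_ne_zero hm)
  set t : ℝ := r / (4 * (‖κ‖ + 1)) with ht
  have htpos : 0 < t := by positivity
  set b : ℂ := z₀ + t * κ with hb
  have hbV : b ∈ V 1 (r / 2) := by
    refine ⟨?_, ?_⟩
    · have : ‖b - z₀‖ = t * ‖κ‖ := by simp [hb, abs_of_pos htpos]
      rw [this, ht, div_mul_eq_mul_div, div_lt_div_iff₀ (by positivity) (by norm_num)]
      nlinarith [norm_nonneg κ]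
    · have : x b = ((t ^ m : ℝ) : ℂ) := by
        simp only [hx, hb, add_sub_cancel_left, mul_pow, hκ]
        push_cast
        field_simp
      rw [this, Complex.ofReal_im, Complex.ofReal_re, abs_zero, one_mul]
      positivity
  have hb0 : 0 < ‖b - z₀‖ := norm_pos_iff.2 (sub_ne_zero.2 (hVne hbV))
  have hrr : r / 2 ≤ r := by linarith
  have hk := fun k ↦ (hiter le_rfl one_le_two hrr hbV k).1
  refine ⟨b, c, hc, hVne hbV, hconv le_rfl one_le_two hrr hbV, fun k ↦ ⟨hVne (hk k),
    fun z hz ↦ hconv one_le_two le_rfl le_rfl (hballs _ (hk k) hz), ?_⟩⟩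
  induction k with
  | zero => simp [hb0.ne']
  | succ k ih =>
    have hz := hk k
    have hpos : 0 < (x (q^[k] b)).re := by
      have := (abs_nonneg _).trans_lt hz.2
      linarith
    have h1 := ((hest _ (hVne hz) (hz.1.trans_le hrr)).2.2 (by
      have := hz.2
      simp only [hx] at this hpos
      linarith)).2
    have hzpos : 0 < ‖q^[k] b - z₀‖ := norm_pos_iff.2 (sub_ne_zero.2 (hVne hz))
    rw [Finset.prod_range_succ, mul_pow, Function.iterate_succ_apply', div_pow]
    calc _ ≤ (‖q^[k] b - z₀‖ / ‖b - z₀‖) ^ 3 * ‖deriv q (q^[k] b)‖ ^ 2 := by gcongr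
      _ = (‖deriv q (q^[k] b)‖ ^ 2 * ‖q^[k] b - z₀‖ ^ 3) / ‖b - z₀‖ ^ 3 := by ring
      _ ≤ _ := by gcongr

theorem finite_fixedPoints_conjDivEval_sq {p : ℂ[X]} (hp : 1 < p.natDegree) {w : ℂ} (hw : w ≠ 0) :
    {z | p.eval z ≠ 0 ∧ conjDivEval p w (conjDivEval p w z) = z}.Finite := by
  set n := p.natDegree with hn
  let S : ℂ[X] := ∑ j ∈ Finset.range n, C (conj (p.coeff j) * w ^ j) * p ^ (n - j)
  let R : ℂ[X] := X * (S + C (conj (p.coeff n) * w ^ n)) - C (conj w) * p ^ n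
  have hp0 : p ≠ 0 := by rintro rfl; simp at hn; omega
  have hR : R ≠ 0 := by
    intro h
    have h1 : p ∣ S := Finset.dvd_sum fun j hj ↦
      (dvd_pow_self p (by have := Finset.mem_range.1 hj; omega)).mul_left _
    have h2 : p ∣ C (conj w) * p ^ n := (dvd_pow_self p (by omega)).mul_left _
    have h3 : p ∣ X * C (conj (p.coeff n) * w ^ n) := by
      have : X * C (conj (p.coeff n) * w ^ n) = R - X * S + C (conj w) * p ^ n := by
        simp only [R]; ring
      rw [this, h]
      exact dvd_add (dvd_sub (dvd_zero _) (h1.mul_left _)) h2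
    have hc : conj (p.coeff n) * w ^ n ≠ 0 := by
      simp only [ne_eq, mul_eq_zero, map_eq_zero, not_or]
      exact ⟨by simpa [hn] using hp0, pow_ne_zero _ hw⟩
    have h4 := natDegree_le_of_dvd h3 (mul_ne_zero X_ne_zero (C_ne_zero.2 hc))
    rw [mul_comm, natDegree_C_mul_X _ hc] at h4
    omega
  refine ((R.roots.toFinset.finite_toSet).union (finite_singleton 0)).subset ?_
  rintro z ⟨hz, hfix⟩
  by_cases hz0 : z = 0
  · exact Or.inr hz0
  left
  simp only [Finset.mem_coe, Multiset.mem_toFinset, mem_roots hR, IsRoot.def]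
  set D : ℂ := p.eval (conj (w / p.eval z)) with hD
  have hD0 : D ≠ 0 := by
    intro h
    apply hz0
    rw [← hfix]
    simp only [conjDivEval]
    rw [← hD, h]; simp
  have h5 : z * conj D = conj w := by
    have : conj w / conj D = z := by rw [← map_div₀]; exact hfix
    rw [← this, div_mul_cancel₀ _ (by simpa using hD0)]
  have h6 : conj D * p.eval z ^ n = (S + C (conj (p.coeff n) * w ^ n)).eval z := by
    rw [hD, eval_eq_sum_range, map_sum, Finset.sum_range_succ, add_mul, eval_add, eval_C,
      Finset.sum_mul, eval_finsetSum]
    congr 1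
    · refine Finset.sum_congr rfl fun j hj ↦ ?_
      have hj' : n = j + (n - j) := by have := Finset.mem_range.1 hj; omega
      simp only [map_mul, map_pow, Complex.conj_conj, eval_mul, eval_pow, eval_C]
      rw [hj', pow_add, div_pow, ← hj']
      field_simp
    · simp only [map_mul, map_pow, Complex.conj_conj, ← hn]
      rw [div_pow]
      field_simp
  simp only [R, eval_sub, eval_mul, eval_X, eval_pow, eval_C, ← h6, ← h5]
  ring

theorem conjDivEval_eq_self {p : ℂ[X]} {w z : ℂ} (hw : w ≠ 0) (hz : p.eval z * conj z = w) :
    conjDivEval p w z = z := by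
  have h0 : p.eval z ≠ 0 := by rintro h; apply hw; rw [← hz, h, zero_mul]
  rw [conjDivEval, ← hz, mul_div_cancel_left₀ _ h0, Complex.conj_conj]

theorem hasDerivAt_div_eval {p : ℂ[X]} (w : ℂ) {z : ℂ} (hz : p.eval z ≠ 0) :
    HasDerivAt (fun z ↦ w / p.eval z) (-(w * p.derivative.eval z / p.eval z ^ 2)) z := by
  refine ((hasDerivAt_const z w).fun_div (p.hasDerivAt z) hz).congr_deriv ?_
  ring

theorem exists_ball_subset_basin_of_attracting {p : ℂ[X]} {w z₀ : ℂ} (hw : w ≠ 0)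
    (hz : p.eval z₀ * conj z₀ = w) (hN : normDerivDivEval p w z₀ < 1) :
    ∃ r > 0, ball z₀ r ⊆ {x | Tendsto (fun j ↦ (conjDivEval p w)^[j] x) atTop (𝓝 z₀)} := by
  have h0 : p.eval z₀ ≠ 0 := by rintro h; apply hw; rw [← hz, h, zero_mul]
  set g := conjDivEval p w with hg
  obtain ⟨L, hL, hL1⟩ := exists_between hN
  have hL0 : 0 ≤ L := (norm_nonneg _).trans hL.le
  have hd := (hasDerivAt_div_eval w h0).hasFDerivAt.isLittleO.def
    (show 0 < L - normDerivDivEval p w z₀ by linarith)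
  obtain ⟨r, hr, hball⟩ := Metric.eventually_nhds_iff.1 hd
  have hstep : ∀ z ∈ ball z₀ r, ‖g z - z₀‖ ≤ L * ‖z - z₀‖ := by
    intro z hzr
    have h1 := hball (y := z) hzr
    have h2 : ‖g z - z₀‖ = ‖w / p.eval z - w / p.eval z₀‖ := by
      conv_lhs => rw [← conjDivEval_eq_self hw hz, hg, conjDivEval, conjDivEval, ← map_sub]
      exact RCLike.norm_conj _
    simp only [ContinuousLinearMap.toSpanSingleton_apply, smul_eq_mul] at h1
    have h3 := norm_add_le (w / p.eval z - w / p.eval z₀ -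
      (z - z₀) * -(w * p.derivative.eval z₀ / p.eval z₀ ^ 2))
      ((z - z₀) * -(w * p.derivative.eval z₀ / p.eval z₀ ^ 2))
    rw [sub_add_cancel, norm_mul (z - z₀), norm_neg] at h3
    rw [h2]
    calc _ ≤ _ := h3
      _ ≤ (L - normDerivDivEval p w z₀) * ‖z - z₀‖ + ‖z - z₀‖ * normDerivDivEval p w z₀ := by
        gcongr; exact le_rfl
      _ = _ := by ring
  refine ⟨r, hr, fun z hzr ↦ ?_⟩
  have hiter : ∀ k, ‖g^[k] z - z₀‖ ≤ L ^ k * ‖z - z₀‖ := by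
    intro k
    induction k with
    | zero => simp
    | succ k ih =>
      rw [Function.iterate_succ_apply', pow_succ', mul_assoc]
      refine (hstep _ ?_).trans (by gcongr)
      rw [mem_ball, dist_eq_norm] at hzr ⊢
      exact ih.trans_lt ((mul_le_of_le_one_left (norm_nonneg _)
        (pow_le_one₀ hL0 hL1.le)).trans_lt hzr)
  rw [mem_ofPred_eq, tendsto_iff_norm_sub_tendsto_zero]
  refine squeeze_zero (fun _ ↦ norm_nonneg _) hiter ?_
  simpa using (tendsto_pow_atTop_nhds_zero_of_lt_one hL0 hL1).mul_const ‖z - z₀‖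


theorem continuousAt_conjDivEval {p : ℂ[X]} (w : ℂ) {z : ℂ} (hz : p.eval z ≠ 0) :
    ContinuousAt (conjDivEval p w) z :=
  Complex.continuous_conj.continuousAt.comp (hasDerivAt_div_eval w hz).continuousAt

theorem hasDerivAt_conjDivEval_sq {p : ℂ[X]} {w z : ℂ} (hz : p.eval z ≠ 0)
    (hz' : p.eval (conjDivEval p w z) ≠ 0) :
    HasDerivAt (fun z ↦ conjDivEval p w (conjDivEval p w z))
      ((w * p.derivative.eval z / p.eval z ^ 2) *
        conj (w * p.derivative.eval (conjDivEval p w z) / p.eval (conjDivEval p w z) ^ 2)) z := by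
  have h1 := hasDerivAt_div_eval w hz
  have h2 := (hasDerivAt_div_eval w hz').conj_conj
  have hc : conj (conjDivEval p w z) = w / p.eval z := by simp [conjDivEval]
  rw [hc] at h2
  refine (h2.comp z h1).congr_deriv ?_
  rw [map_neg]
  ring

theorem norm_deriv_conjDivEval_sq_ge (p : ℂ[X]) (w z : ℂ) :
    normDerivDivEval p w z * normDerivDivEval p w (conjDivEval p w z) ≤
      ‖deriv (fun z ↦ conjDivEval p w (conjDivEval p w z)) z‖ := by
  by_cases hz : p.eval z = 0
  · simp [normDerivDivEval, hz]
  by_cases hz' : p.eval (conjDivEval p w z) = 0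
  · simp [normDerivDivEval, hz']
  rw [(hasDerivAt_conjDivEval_sq hz hz').deriv, norm_mul, RCLike.norm_conj, normDerivDivEval,
    normDerivDivEval]

theorem exists_ball_subset_basin_of_neutral {p : ℂ[X]} {w z₀ : ℂ} (hw : w ≠ 0)
    (hz : p.eval z₀ * conj z₀ = w) (hN : normDerivDivEval p w z₀ = 1)
    (hid : ¬ ∀ᶠ z in 𝓝 z₀, conjDivEval p w (conjDivEval p w z) = z) :
    ∃ b, ∀ C : ℝ, ∃ k, ∃ ρ > 0, ball ((conjDivEval p w)^[k] b) ρ ⊆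
        {x | Tendsto (fun j ↦ (conjDivEval p w)^[j] x) atTop (𝓝 z₀)} ∧
      C * ∏ j ∈ Finset.range k, normDerivDivEval p w ((conjDivEval p w)^[j] b) < ρ := by
  have h0 : p.eval z₀ ≠ 0 := by rintro h; apply hw; rw [← hz, h, zero_mul]
  have hfix := conjDivEval_eq_self hw hz
  set g := conjDivEval p w with hg
  set q : ℂ → ℂ := fun z ↦ g (g z) with hq
  have hq2 : q = g^[2] := rfl
  have hgc : ContinuousAt g z₀ := continuousAt_conjDivEval w h0
  have hne : ∀ᶠ z in 𝓝 z₀, p.eval z ≠ 0 := p.continuous.continuousAt.eventually_ne h0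
  have hne' : ∀ᶠ z in 𝓝 z₀, p.eval (g z) ≠ 0 := by
    have h := hgc.eventually (p := fun z ↦ p.eval z ≠ 0) (by rwa [hfix])
    exact h
  have han : AnalyticAt ℂ q z₀ := by
    refine DifferentiableOn.analyticAt (s := {z | p.eval z ≠ 0 ∧ p.eval (g z) ≠ 0})
      (fun z hz ↦ ?_) (hne.and hne')
    exact (hasDerivAt_conjDivEval_sq hz.1 hz.2).differentiableAt.differentiableWithinAt
  have hder : deriv q z₀ = 1 := by
    rw [(hasDerivAt_conjDivEval_sq h0 (by rwa [← hg, hfix])).deriv, ← hg, hfix, Complex.mul_conj,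
      Complex.normSq_eq_norm_sq, ← normDerivDivEval, hN]
    simp
  obtain ⟨b, c, hc, hb, hlim, horb⟩ := exists_parabolic_orbit han (by simp [hq, hfix]) hder hid
  have hiter : ∀ j x, q^[j] x = g^[2 * j] x := fun j x ↦ by rw [hq2, Function.iterate_mul]
  have hbasin : ∀ x, Tendsto (fun j ↦ q^[j] x) atTop (𝓝 z₀) →
      Tendsto (fun j ↦ g^[j] x) atTop (𝓝 z₀) := by
    intro x hx
    have h2 : Tendsto (fun j ↦ g (q^[j] x)) atTop (𝓝 z₀) := by
      have := hgc.tendsto.comp hx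
      rwa [hfix] at this
    rw [Filter.tendsto_atTop'] at hx h2 ⊢
    intro s hs
    obtain ⟨a, ha⟩ := hx s hs
    obtain ⟨a', ha'⟩ := h2 s hs
    refine ⟨2 * (a + a') + 2, fun j hj ↦ ?_⟩
    obtain ⟨i, rfl | rfl⟩ := j.even_or_odd'
    · rw [← hiter]; exact ha i (by omega)
    · rw [Function.iterate_succ_apply', ← hiter]; exact ha' i (by omega)
  have hprod : ∀ k, ∏ j ∈ Finset.range (2 * k), normDerivDivEval p w (g^[j] b) ≤
      ∏ j ∈ Finset.range k, ‖deriv q (q^[j] b)‖ := by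
    intro k
    induction k with
    | zero => simp
    | succ k ih =>
      rw [show 2 * (k + 1) = 2 * k + 1 + 1 by ring, Finset.prod_range_succ, Finset.prod_range_succ,
        Finset.prod_range_succ, mul_assoc]
      refine mul_le_mul ih ?_ (mul_nonneg (norm_nonneg _) (norm_nonneg _))
        (Finset.prod_nonneg fun _ _ ↦ norm_nonneg _)
      rw [hiter, Function.iterate_succ_apply']
      exact norm_deriv_conjDivEval_sq_ge p w _
  refine ⟨b, fun C ↦ ?_⟩
  set D := |C| + 1 with hD
  set β := ‖b - z₀‖ with hβ
  have hβ0 : 0 < β := norm_pos_iff.2 (sub_ne_zero.2 hb)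
  have hnorm := tendsto_iff_norm_sub_tendsto_zero.1 hlim
  obtain ⟨k, hk⟩ := (hnorm.eventually_lt_const
    (show 0 < c ^ 2 * β ^ 3 / D ^ 2 by positivity)).exists
  obtain ⟨hk0, hkb, hkp⟩ := horb k
  set x := ‖q^[k] b - z₀‖ with hx
  have hx0 : 0 < x := norm_pos_iff.2 (sub_ne_zero.2 hk0)
  refine ⟨2 * k, c * x, by positivity, ?_, ?_⟩
  · rw [← hiter]
    exact fun z hz ↦ hbasin z (hkb hz)
  · set P := ∏ j ∈ Finset.range k, ‖deriv q (q^[j] b)‖ with hP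
    have hP0 : 0 ≤ P := Finset.prod_nonneg fun _ _ ↦ norm_nonneg _
    calc _ ≤ D * ∏ j ∈ Finset.range (2 * k), normDerivDivEval p w (g^[j] b) := by
          refine mul_le_mul_of_nonneg_right ?_ (Finset.prod_nonneg fun _ _ ↦ norm_nonneg _)
          linarith [le_abs_self C]
      _ ≤ D * P := by gcongr; exact hprod k
      _ < c * x := by
        refine lt_of_pow_lt_pow_left₀ 2 (by positivity) ?_
        rw [mul_pow, mul_pow]
        calc _ ≤ D ^ 2 * (x / β) ^ 3 := by gcongr
          _ = x ^ 2 * (x * (D ^ 2 / β ^ 3)) := by rw [div_pow]; ring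
          _ < x ^ 2 * (c ^ 2) := by
            gcongr
            rw [lt_div_iff₀ (by positivity)] at hk
            rw [← mul_div_assoc, div_lt_iff₀ (by positivity)]
            exact hk
          _ = _ := by ring

theorem exists_ball_subset_basin {p : ℂ[X]} (hp : 1 < p.natDegree) {w z₀ : ℂ} (hw : w ≠ 0)
    (hz : p.eval z₀ * conj z₀ = w) (hN : normDerivDivEval p w z₀ ≤ 1) :
    ∃ b, ∀ C : ℝ, ∃ k, ∃ ρ > 0, ball ((conjDivEval p w)^[k] b) ρ ⊆
        {x | Tendsto (fun j ↦ (conjDivEval p w)^[j] x) atTop (𝓝 z₀)} ∧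
      C * ∏ j ∈ Finset.range k, normDerivDivEval p w ((conjDivEval p w)^[j] b) < ρ := by
  have h0 : p.eval z₀ ≠ 0 := by rintro h; apply hw; rw [← hz, h, zero_mul]
  rcases hN.lt_or_eq with hN | hN
  · obtain ⟨r, hr, hb⟩ := exists_ball_subset_basin_of_attracting hw hz hN
    have hit : ∀ j, (conjDivEval p w)^[j] z₀ = z₀ := fun j ↦
      Function.iterate_fixed (conjDivEval_eq_self hw hz) j
    refine ⟨z₀, fun C ↦ ?_⟩
    have := (tendsto_pow_atTop_nhds_zero_of_lt_one (norm_nonneg _) hN).const_mul C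
    rw [mul_zero] at this
    obtain ⟨k, hk⟩ := (this.eventually_lt_const hr).exists
    refine ⟨k, r, hr, by rwa [hit], ?_⟩
    simp only [hit, Finset.prod_const, Finset.card_range]
    exact hk
  · refine exists_ball_subset_basin_of_neutral hw hz hN fun h ↦ ?_
    have hne : ∀ᶠ z in 𝓝 z₀, p.eval z ≠ 0 := p.continuous.continuousAt.eventually_ne h0
    exact (infinite_of_mem_nhds z₀ (hne.and h)) (finite_fixedPoints_conjDivEval_sq hp hw)

theorem exists_critical_mem_basin {p : ℂ[X]} (hp : 1 < p.natDegree) {w z₀ z₁ : ℂ} (hw : w ≠ 0)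
    (hz : p.eval z₀ * conj z₀ = w) (hN : normDerivDivEval p w z₀ ≤ 1)
    (hz₁ : p.eval z₁ * conj z₁ = w) (hN₁ : normDerivDivEval p w z₁ ≤ 1) (hne : z₁ ≠ z₀) :
    ∃ c, (c = 0 ∨ p.derivative.eval c = 0) ∧
      Tendsto (fun j ↦ (conjDivEval p w)^[j] c) atTop (𝓝 z₀) := by
  by_contra! hcon
  obtain ⟨b₁, h₁⟩ := exists_ball_subset_basin hp hw hz₁ hN₁
  obtain ⟨k₁, δ, hδ, hball₁, -⟩ := h₁ 0
  obtain ⟨b, h⟩ := exists_ball_subset_basin hp hw hz hN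
  set a := (conjDivEval p w)^[k₁] b₁
  obtain ⟨k, ρ, hρ, hball, hlt⟩ := h (‖b - a‖ ^ 2 / δ)
  refine hlt.not_ge (radius_mul_le_of_inverse_branches hw (fun z hz ↦ ?_) (hcon 0 (Or.inl rfl))
    (fun c hc h ↦ hcon c (Or.inr h) hc) hδ (fun z hz ↦ ?_) b k hρ hball)
  · replace hz : Tendsto _ _ _ := hz
    exact (tendsto_add_atTop_iff_nat 1).1 hz
  · by_contra! hlt
    have := hball₁ (show z ∈ ball a δ by rwa [mem_ball, dist_eq_norm])
    exact hne (tendsto_nhds_unique this hz)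

theorem normDerivDivEval_eq {p : ℂ[X]} {w z : ℂ} (hw : w ≠ 0) (hz : p.eval z * conj z = w) :
    normDerivDivEval p w z = ‖z * p.derivative.eval z‖ / ‖p.eval z‖ := by
  have h0 : p.eval z ≠ 0 := by rintro h; apply hw; rw [← hz, h, zero_mul]
  rw [normDerivDivEval, ← hz]
  simp only [norm_div, norm_mul, norm_pow, RCLike.norm_conj]
  have := norm_ne_zero_iff.2 h0
  field_simp

theorem finite_logharmonic_solutions {p : ℂ[X]} (hp : 1 < p.natDegree) {w : ℂ} (hw : w ≠ 0) :
    {z | p.eval z * conj z = w}.Finite := by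
  refine (finite_fixedPoints_conjDivEval_sq hp hw).subset fun z hz ↦ ⟨?_, ?_⟩
  · rintro h; apply hw; rw [← hz, h, zero_mul]
  · rw [conjDivEval_eq_self hw hz, conjDivEval_eq_self hw hz]

theorem ncard_nonrepelling_le {p : ℂ[X]} (hp : 1 < p.natDegree) {w : ℂ} (hw : w ≠ 0) :
    {z | p.eval z * conj z = w ∧ ‖z * p.derivative.eval z‖ ≤ ‖p.eval z‖}.ncard ≤ p.natDegree := by
  set S := {z | p.eval z * conj z = w ∧ ‖z * p.derivative.eval z‖ ≤ ‖p.eval z‖} with hS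
  have hN : ∀ z ∈ S, normDerivDivEval p w z ≤ 1 := fun z hz ↦ by
    rw [normDerivDivEval_eq hw hz.1]
    exact div_le_one_of_le₀ hz.2 (norm_nonneg _)
  by_cases hsub : S.Subsingleton
  · exact ((ncard_le_one hsub.finite).2 fun a ha b hb ↦ hsub ha hb).trans hp.le
  have hex : ∀ z ∈ S, ∃ c, (c = 0 ∨ p.derivative.eval c = 0) ∧
      Tendsto (fun j ↦ (conjDivEval p w)^[j] c) atTop (𝓝 z) := by
    intro z hz
    obtain ⟨z₁, h₁, hne⟩ := (not_subsingleton_iff.1 hsub).exists_ne z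
    exact exists_critical_mem_basin hp hw hz.1 (hN z hz) h₁.1 (hN z₁ h₁) hne
  choose! c hc hlim using hex
  have hd : p.derivative ≠ 0 := fun h ↦ by
    have := derivative_eq_zero.1 h
    omega
  classical
  calc S.ncard ≤ (insert 0 p.derivative.roots.toFinset : Finset ℂ).card := by
        rw [← ncard_coe_finset]
        refine ncard_le_ncard_of_injOn c (fun z hz ↦ ?_) (fun z hz z' hz' h ↦ ?_)
          (Finset.finite_toSet _)
        · simpa [hd] using hc z hz
        · exact tendsto_nhds_unique (hlim z hz) (h ▸ hlim z' hz')
    _ ≤ p.derivative.roots.toFinset.card + 1 := Finset.card_insert_le _ _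
    _ ≤ p.derivative.natDegree + 1 := by
      gcongr; exact (Multiset.toFinset_card_le _).trans (card_roots' _)
    _ ≤ p.natDegree := by have := natDegree_derivative_le p; omega

end Dynamics

section Degree

open Polynomial Metric Set Filter Topology ComplexConjugate MeasureTheory

theorem exists_contDiff_mul_eq_one {d : ℝ} (hd : 0 < d) :
    ∃ v : ℝ → ℝ, ContDiff ℝ 1 v ∧ ∀ s, d ≤ s → s * v s = 1 := by
  refine ⟨fun s ↦ Real.smoothTransition (2 * s / d - 1) / s, ?_, fun s hs ↦ ?_⟩
  · rw [contDiff_iff_contDiffAt]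
    intro s
    by_cases hs : s = 0
    · subst hs
      refine (contDiffAt_const (c := (0 : ℝ))).congr_of_eventuallyEq ?_
      filter_upwards [Iio_mem_nhds (show (0 : ℝ) < d / 2 by positivity)] with s hs
      rw [Real.smoothTransition.zero_of_nonpos, zero_div]
      rw [sub_nonpos, div_le_one hd]
      linarith [mem_Iio.1 hs]
    · refine ContDiffAt.div ?_ contDiffAt_id hs
      exact (Real.smoothTransition.contDiff.comp (by fun_prop)).contDiffAt
  · have hs0 : s ≠ 0 := (hd.trans_le hs).ne'
    dsimp only
    rw [Real.smoothTransition.one_of_one_le, mul_one_div_cancel hs0]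
    rw [le_sub_iff_add_le, le_div_iff₀ hd]
    linarith

theorem hasDerivAt_normSq_mul_im {g h : ℝ → ℂ} {v : ℝ → ℝ} {g' h' : ℂ} {v' t : ℝ}
    (hg : HasDerivAt g g' t) (hh : HasDerivAt h h' t)
    (hv : HasDerivAt v v' (Complex.normSq (g t))) :
    HasDerivAt (fun t ↦ v (Complex.normSq (g t)) * (conj (g t) * h t).im)
      (2 * v' * (conj (g t) * g').re * (conj (g t) * h t).im +
        v (Complex.normSq (g t)) * ((conj g' * h t).im + (conj (g t) * h').im)) t := by
  have hre : ∀ {k : ℝ → ℂ} {k' : ℂ}, HasDerivAt k k' t → HasDerivAt (fun t ↦ (k t).re) k'.re t :=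
    fun hk ↦ Complex.reCLM.hasFDerivAt.comp_hasDerivAt t hk
  have him : ∀ {k : ℝ → ℂ} {k' : ℂ}, HasDerivAt k k' t → HasDerivAt (fun t ↦ (k t).im) k'.im t :=
    fun hk ↦ Complex.imCLM.hasFDerivAt.comp_hasDerivAt t hk
  have hn : HasDerivAt (fun t ↦ Complex.normSq (g t)) (2 * (conj (g t) * g').re) t := by
    simp only [Complex.normSq_apply]
    refine (((hre hg).fun_mul (hre hg)).fun_add ((him hg).fun_mul (him hg))).congr_deriv ?_
    simp
    ring
  have hi : HasDerivAt (fun t ↦ (conj (g t) * h t).im)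
      ((conj g' * h t).im + (conj (g t) * h').im) t := by
    simp only [Complex.mul_im, Complex.conj_re, Complex.conj_im]
    refine (((hre hg).fun_mul (him hh)).fun_add ((him hg).fun_neg.fun_mul (hre hh))).congr_deriv ?_
    ring
  refine ((hv.comp t hn).fun_mul hi).congr_deriv ?_
  simp only [Function.comp]
  ring

theorem contDiff_normSq_mul_im {G : ℝ × ℝ → ℂ} (hG : ContDiff ℝ 2 G) {v : ℝ → ℝ}
    (hv : ContDiff ℝ 1 v) (e : ℝ × ℝ) :
    ContDiff ℝ 1 fun y ↦ v (Complex.normSq (G y)) * (conj (G y) * fderiv ℝ G y e).im := by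
  have hG0 : ContDiff ℝ 1 G := hG.of_le (by norm_num)
  have hG1 : ContDiff ℝ 1 (fun y ↦ fderiv ℝ G y e) :=
    (hG.fderiv_right (m := 1) (by norm_num)).clm_apply contDiff_const
  have hre : ∀ {k : ℝ × ℝ → ℂ}, ContDiff ℝ 1 k → ContDiff ℝ 1 fun y ↦ (k y).re :=
    fun hk ↦ Complex.reCLM.contDiff.comp hk
  have him : ∀ {k : ℝ × ℝ → ℂ}, ContDiff ℝ 1 k → ContDiff ℝ 1 fun y ↦ (k y).im :=
    fun hk ↦ Complex.imCLM.contDiff.comp hk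
  refine (hv.comp ?_).mul (him ((Complex.conjCLE.contDiff.comp hG0).mul hG1))
  simp only [Complex.normSq_apply]
  exact ((hre hG0).mul (hre hG0)).add ((him hG0).mul (him hG0))

theorem fderiv_sub_fderiv_normSq_mul_im {G : ℝ × ℝ → ℂ} (hG : ContDiff ℝ 2 G) {v : ℝ → ℝ}
    (hv : ContDiff ℝ 1 v) (x e₁ e₂ : ℝ × ℝ) :
    fderiv ℝ (fun y ↦ v (Complex.normSq (G y)) * (conj (G y) * fderiv ℝ G y e₂).im) x e₁ -
      fderiv ℝ (fun y ↦ v (Complex.normSq (G y)) * (conj (G y) * fderiv ℝ G y e₁).im) x e₂ =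
    2 * (v (Complex.normSq (G x)) + Complex.normSq (G x) * deriv v (Complex.normSq (G x))) *
      (conj (fderiv ℝ G x e₁) * fderiv ℝ G x e₂).im := by
  have hG1 : ContDiff ℝ 1 (fderiv ℝ G) := hG.fderiv_right (by norm_num)
  have key : ∀ a b : ℝ × ℝ,
      fderiv ℝ (fun y ↦ v (Complex.normSq (G y)) * (conj (G y) * fderiv ℝ G y b).im) x a =
      2 * deriv v (Complex.normSq (G x)) * (conj (G x) * fderiv ℝ G x a).re *
        (conj (G x) * fderiv ℝ G x b).im + v (Complex.normSq (G x)) *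
        ((conj (fderiv ℝ G x a) * fderiv ℝ G x b).im +
          (conj (G x) * fderiv ℝ (fderiv ℝ G) x a b).im) := by
    intro a b
    have hl : HasDerivAt (fun t : ℝ ↦ x + t • a) a 0 := by
      simpa using ((hasDerivAt_id (0 : ℝ)).smul_const a).const_add x
    have hx : x = x + (0 : ℝ) • a := by simp
    have h1 : HasDerivAt (fun t : ℝ ↦ G (x + t • a)) (fderiv ℝ G x a) 0 := by
      refine HasFDerivAt.comp_hasDerivAt _ ?_ hl
      rw [← hx]
      exact (hG.differentiable (by norm_num) x).hasFDerivAt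
    have h2 : HasDerivAt (fun t : ℝ ↦ fderiv ℝ G (x + t • a) b)
        (fderiv ℝ (fderiv ℝ G) x a b) 0 := by
      have : HasDerivAt (fun t : ℝ ↦ fderiv ℝ G (x + t • a)) (fderiv ℝ (fderiv ℝ G) x a) 0 := by
        refine HasFDerivAt.comp_hasDerivAt _ ?_ hl
        rw [← hx]
        exact (hG1.differentiable (by norm_num) x).hasFDerivAt
      simpa using this.clm_apply (hasDerivAt_const 0 b)
    have h3 := hasDerivAt_normSq_mul_im h1 h2
      ((hv.differentiable (by norm_num) (Complex.normSq (G (x + (0 : ℝ) • a)))).hasDerivAt)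
    rw [← hx] at h3
    have h4 : DifferentiableAt ℝ
        (fun y ↦ v (Complex.normSq (G y)) * (conj (G y) * fderiv ℝ G y b).im) x := by
      exact (contDiff_normSq_mul_im hG hv b).differentiable (by norm_num) x
    have h5 : HasDerivAt (fun t : ℝ ↦ v (Complex.normSq (G (x + t • a))) *
        (conj (G (x + t • a)) * fderiv ℝ G (x + t • a) b).im) (fderiv ℝ
        (fun y ↦ v (Complex.normSq (G y)) * (conj (G y) * fderiv ℝ G y b).im) x a) 0 := by
      refine HasFDerivAt.comp_hasDerivAt (f := fun t : ℝ ↦ x + t • a)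
        (l := fun y ↦ v (Complex.normSq (G y)) * (conj (G y) * fderiv ℝ G y b).im) _ ?_ hl
      rw [← hx]
      exact h4.hasFDerivAt
    exact h5.unique h3
  have hsymm : fderiv ℝ (fderiv ℝ G) x e₁ e₂ = fderiv ℝ (fderiv ℝ G) x e₂ e₁ :=
    (hG.contDiffAt.isSymmSndFDerivAt (by simp)) e₁ e₂
  rw [key, key, hsymm]
  simp only [Complex.normSq_apply, Complex.mul_im, Complex.mul_re, Complex.conj_re, Complex.conj_im]
  ring

theorem det_eq_im (L : ℂ →L[ℝ] ℂ) : L.det = (conj (L 1) * L Complex.I).im := by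
  rw [ContinuousLinearMap.det, ← LinearMap.det_toMatrix Complex.basisOneI, Matrix.det_fin_two]
  simp [LinearMap.toMatrix_apply]
  ring

theorem im_conj_apply_mul_apply (L : ℂ →L[ℝ] ℂ) (a b : ℂ) :
    (conj (L a) * L b).im = L.det * (conj a * b).im := by
  have h : ∀ z : ℂ, L z = z.re * L 1 + z.im * L Complex.I := fun z ↦ by
    conv_lhs => rw [← Complex.re_add_im z, mul_comm, ← mul_one (z.re : ℂ)]
    rw [mul_comm Complex.I, map_add, ← Complex.real_smul, ← Complex.real_smul, map_smul, map_smul]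
    simp
  rw [h a, h b, det_eq_im]
  simp
  ring

theorem integral_mul_det_eq_boundary {f : ℂ → ℂ} (hf : ContDiff ℝ 2 f) (w : ℂ) {v : ℝ → ℝ}
    (hv : ContDiff ℝ 1 v) {R : ℝ} (hR : 0 ≤ R)
    (hsupp : ∀ z, R < ‖z‖ → v (Complex.normSq (f z - w)) +
      Complex.normSq (f z - w) * deriv v (Complex.normSq (f z - w)) = 0) :
    ∫ z, 2 * (v (Complex.normSq (f z - w)) +
      Complex.normSq (f z - w) * deriv v (Complex.normSq (f z - w))) * (fderiv ℝ f z).det =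
    ∫ θ in (-Real.pi)..Real.pi, v (Complex.normSq (f (circleMap 0 R θ) - w)) *
      (conj (f (circleMap 0 R θ) - w) *
        fderiv ℝ f (circleMap 0 R θ) (Complex.I * circleMap 0 R θ)).im := by
  let P : ℝ × ℝ → ℂ := fun x ↦ x.1 * Complex.exp (x.2 * Complex.I)
  have hP : ContDiff ℝ 2 P := by
    have h1 : ContDiff ℝ 2 fun x : ℝ × ℝ ↦ (x.1 : ℂ) := Complex.ofRealCLM.contDiff.comp contDiff_fst
    have h2 : ContDiff ℝ 2 fun x : ℝ × ℝ ↦ (x.2 : ℂ) := Complex.ofRealCLM.contDiff.comp contDiff_snd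
    exact h1.mul ((h2.mul contDiff_const).cexp)
  let G : ℝ × ℝ → ℂ := fun x ↦ f (P x) - w
  have hG : ContDiff ℝ 2 G := (hf.comp hP).sub contDiff_const
  have hP1 : ∀ x, fderiv ℝ P x (1, 0) = Complex.exp (x.2 * Complex.I) := fun x ↦ by
    have hl : HasDerivAt (fun t : ℝ ↦ (t, x.2)) ((1, 0) : ℝ × ℝ) x.1 :=
      (hasDerivAt_id _).prodMk (hasDerivAt_const _ _)
    have h1 := ((hP.differentiable (by norm_num) x).hasFDerivAt).comp_hasDerivAt x.1 hl
    refine h1.unique ?_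
    refine ((hasDerivAt_id x.1).ofReal_comp.mul_const
      (Complex.exp (x.2 * Complex.I))).congr_deriv ?_
    simp
  have hP2 : ∀ x, fderiv ℝ P x (0, 1) = Complex.I * P x := fun x ↦ by
    have hl : HasDerivAt (fun t : ℝ ↦ (x.1, t)) ((0, 1) : ℝ × ℝ) x.2 :=
      (hasDerivAt_const _ _).prodMk (hasDerivAt_id _)
    have h1 := ((hP.differentiable (by norm_num) x).hasFDerivAt).comp_hasDerivAt x.2 hl
    refine h1.unique ?_
    refine ((((hasDerivAt_id x.2).ofReal_comp.mul_const Complex.I).cexp).const_mul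
      (x.1 : ℂ)).congr_deriv ?_
    simp [P]
    ring
  have hGe : ∀ x e, fderiv ℝ G x e = fderiv ℝ f (P x) (fderiv ℝ P x e) := fun x e ↦ by
    have h1 := (hf.differentiable (by norm_num) (P x)).hasFDerivAt.comp x
      (hP.differentiable (by norm_num) x).hasFDerivAt
    have h2 := h1.sub_const w
    have : fderiv ℝ G x = _ := h2.fderiv
    rw [this]; rfl
  have hdet : ∀ x, (conj (fderiv ℝ G x (1, 0)) * fderiv ℝ G x (0, 1)).im =
      x.1 * (fderiv ℝ f (P x)).det := fun x ↦ by
    rw [hGe, hGe, im_conj_apply_mul_apply, hP1, hP2, mul_comm]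
    congr 1
    have : conj (Complex.exp (x.2 * Complex.I)) * Complex.exp (x.2 * Complex.I) = 1 := by
      rw [mul_comm, Complex.mul_conj, Complex.normSq_eq_norm_sq, Complex.norm_exp_ofReal_mul_I]
      simp
    calc _ = (conj (Complex.exp (x.2 * Complex.I)) * Complex.exp (x.2 * Complex.I) *
          (x.1 * Complex.I)).im := by congr 1; simp only [P]; ring
      _ = _ := by rw [this]; simp
  let F : ℝ × ℝ → ℝ × ℝ → ℝ := fun e y ↦
    v (Complex.normSq (G y)) * (conj (G y) * fderiv ℝ G y e).im
  have hF : ∀ e, ContDiff ℝ 1 (F e) := contDiff_normSq_mul_im hG hv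
  have hdiv := integral_divergence_prod_Icc_of_hasFDerivAt_of_le (F (0, 1)) (fun y ↦ -F (1, 0) y)
    (fderiv ℝ (F (0, 1))) (fun y ↦ -fderiv ℝ (F (1, 0)) y) (0, -Real.pi) (R, Real.pi)
    ⟨hR, by linarith [Real.pi_pos]⟩ (hF _).continuous.continuousOn
    (hF _).continuous.neg.continuousOn
    (fun x _ ↦ ((hF _).differentiable (by norm_num) x).hasFDerivAt)
    (fun x _ ↦ ((hF _).differentiable (by norm_num) x).hasFDerivAt.neg)
    (Continuous.integrableOn_Icc (by
      have h1 := (hF (0, 1)).continuous_fderiv (by norm_num)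
      have h2 := (hF (1, 0)).continuous_fderiv (by norm_num)
      fun_prop))
  let K : ℂ → ℝ := fun z ↦ 2 * (v (Complex.normSq (f z - w)) +
      Complex.normSq (f z - w) * deriv v (Complex.normSq (f z - w))) * (fderiv ℝ f z).det
  have hK : ∀ x, fderiv ℝ (F (0, 1)) x (1, 0) + (-fderiv ℝ (F (1, 0)) x) (0, 1) =
      x.1 * K (P x) := fun x ↦ by
    have := fderiv_sub_fderiv_normSq_mul_im hG hv x (1, 0) (0, 1)
    rw [hdet] at this
    rw [neg_apply, ← sub_eq_add_neg]
    refine this.trans ?_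
    simp only [K, G]
    ring
  have hpolar : ∫ z, K z = ∫ x in Icc ((0, -Real.pi) : ℝ × ℝ) (R, Real.pi), x.1 * K (P x) := by
    rw [← Complex.integral_comp_polarCoord_symm]
    have hPs : ∀ x : ℝ × ℝ, Complex.polarCoord.symm x = P x := fun x ↦ by
      rw [Complex.polarCoord_symm_apply, Complex.ofReal_cos, Complex.ofReal_sin,
        ← Complex.exp_mul_I]
    simp only [hPs, smul_eq_mul]
    rw [show polarCoord.target = Ioi (0 : ℝ) ×ˢ Ioo (-Real.pi) Real.pi from rfl,
      ← Icc_prod_Icc]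
    rw [setIntegral_eq_of_subset_of_forall_sdiff_eq_zero
      (measurableSet_Ioi.prod measurableSet_Ioo)
      (s := Ioc 0 R ×ˢ Ioo (-Real.pi) Real.pi) (Set.prod_mono Ioc_subset_Ioi_self Subset.rfl)]
    · refine setIntegral_congr_set ?_
      rw [Measure.volume_eq_prod]
      exact Measure.set_prod_ae_eq Ioc_ae_eq_Icc Ioo_ae_eq_Icc
    · rintro x ⟨hx, hx'⟩
      have hR' : R < x.1 := by
        by_contra! h
        exact hx' ⟨⟨hx.1, h⟩, hx.2⟩
      have : ‖P x‖ = x.1 := by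
        simp only [P, norm_mul, Complex.norm_exp_ofReal_mul_I, Complex.norm_real]
        rw [mul_one, Real.norm_of_nonneg (le_of_lt hx.1)]
      simp only [K]
      rw [hsupp _ (by rwa [this])]
      simp
  simp only [hK] at hdiv
  change ∫ z, K z = _
  rw [hpolar, hdiv]
  have hper : ∀ r, F (1, 0) (r, Real.pi) = F (1, 0) (r, -Real.pi) := fun r ↦ by
    have : P (r, Real.pi) = P (r, -Real.pi) := by simp [P, Complex.exp_neg]
    simp only [F, G, hGe, hP1, this]
    simp [Complex.exp_neg]
  have hzero : ∀ θ, F (0, 1) (0, θ) = 0 := fun θ ↦ by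
    simp [F, hGe, hP2, P]
  simp only [hper, hzero, sub_self, intervalIntegral.integral_zero, zero_add, sub_zero]
  refine intervalIntegral.integral_congr fun θ _ ↦ ?_
  have : P (R, θ) = circleMap 0 R θ := by simp [P, circleMap]
  simp only [F, G, hGe, hP2, this]

theorem add_mul_deriv_eq_zero {v : ℝ → ℝ} (hv : ContDiff ℝ 1 v) {d : ℝ}
    (hvd : ∀ s, d ≤ s → s * v s = 1) {s : ℝ} (hs : d ≤ s) : v s + s * deriv v s = 0 := by
  have h1 : HasDerivWithinAt (fun s ↦ s * v s) (v s + s * deriv v s) (Ici s) s := by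
    simpa using ((hasDerivAt_id s).fun_mul
      (hv.differentiable (by norm_num) s).hasDerivAt).hasDerivWithinAt
  have h2 : HasDerivWithinAt (fun s ↦ s * v s) 0 (Ici s) s :=
    (hasDerivWithinAt_const s (Ici s) (1 : ℝ)).congr (fun t ht ↦ hvd t (hs.trans ht)) (hvd s hs)
  exact (uniqueDiffOn_Ici s s self_mem_Ici).eq_deriv _ h1 h2

theorem integral_radial_eq_two_pi {v : ℝ → ℝ} (hv : ContDiff ℝ 1 v) {d : ℝ} (hd : 0 < d)
    (hvd : ∀ s, d ≤ s → s * v s = 1) (w : ℂ) :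
    ∫ z, 2 * (v (Complex.normSq (z - w)) +
      Complex.normSq (z - w) * deriv v (Complex.normSq (z - w))) = 2 * Real.pi := by
  rw [integral_sub_right_eq_self (fun z ↦ 2 * (v (Complex.normSq z) +
    Complex.normSq z * deriv v (Complex.normSq z))) w]
  have hR : ∀ z : ℂ, d + 1 ≤ ‖z‖ → d ≤ Complex.normSq z := fun z hz ↦ by
    rw [Complex.normSq_eq_norm_sq]; nlinarith
  have h := integral_mul_det_eq_boundary (f := id) contDiff_id 0 hv (R := d + 1) (by positivity)
    (fun z hz ↦ by
      rw [id, sub_zero]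
      exact add_mul_deriv_eq_zero hv hvd (hR z hz.le))
  have hid : (ContinuousLinearMap.id ℝ ℂ).det = 1 := by simp [det_eq_im]
  simp only [id, sub_zero, fderiv_id, hid, mul_one,
    ContinuousLinearMap.id_apply] at h
  rw [h, intervalIntegral.integral_congr (g := fun _ ↦ (1 : ℝ))]
  · simp; ring
  · intro θ _
    have h1 : (conj (circleMap 0 (d + 1) θ) * (Complex.I * circleMap 0 (d + 1) θ)).im =
        Complex.normSq (circleMap 0 (d + 1) θ) := by
      simp only [Complex.normSq_apply, Complex.mul_im, Complex.mul_re, Complex.conj_re,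
        Complex.conj_im, Complex.I_re, Complex.I_im]
      ring
    dsimp only
    rw [h1, mul_comm]
    refine hvd _ (hR _ ?_)
    rw [norm_circleMap_zero]
    exact le_abs_self _

theorem exists_isOpen_injOn_image_mem_nhds {f : ℂ → ℂ} (hf : ContDiff ℝ 2 f) {z : ℂ}
    (hz : (fderiv ℝ f z).det ≠ 0) {N : Set ℂ} (hN : N ∈ 𝓝 z) :
    ∃ U ⊆ N, IsOpen U ∧ z ∈ U ∧ InjOn f U ∧ f '' U ∈ 𝓝 (f z) := by
  have h : HasStrictFDerivAt f
      ((fderiv ℝ f z).toContinuousLinearEquivOfDetNeZero hz : ℂ →L[ℝ] ℂ) z := by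
    simpa using hf.contDiffAt.hasStrictFDerivAt (by norm_num)
  have hU : (h.toOpenPartialHomeomorph f).source ∩ interior N ∈ 𝓝 z :=
    inter_mem ((h.toOpenPartialHomeomorph f).open_source.mem_nhds
      h.mem_toOpenPartialHomeomorph_source) (interior_mem_nhds.2 hN)
  refine ⟨(h.toOpenPartialHomeomorph f).source ∩ interior N,
    inter_subset_right.trans interior_subset,
    (h.toOpenPartialHomeomorph f).open_source.inter isOpen_interior, mem_of_mem_nhds hU,
    (h.toOpenPartialHomeomorph f).injOn.mono inter_subset_left, ?_⟩
  rw [← h.map_nhds_eq_of_equiv]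
  exact image_mem_map hU

theorem continuous_det_fderiv {f : ℂ → ℂ} (hf : ContDiff ℝ 2 f) :
    Continuous fun z ↦ (fderiv ℝ f z).det := by
  simp only [det_eq_im]
  have h1 := hf.continuous_fderiv (by norm_num)
  fun_prop

theorem eventually_sign_eq {g : ℂ → ℝ} {z : ℂ} (hg : ContinuousAt g z) (hz : g z ≠ 0) :
    ∀ᶠ y in 𝓝 z, SignType.sign (g y) = SignType.sign (g z) := by
  rcases hz.lt_or_gt with h | h
  · filter_upwards [hg.eventually_lt_const h] with y hy
    rw [sign_neg hy, sign_neg h]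
  · filter_upwards [hg.eventually_const_lt h] with y hy
    rw [sign_pos hy, sign_pos h]

theorem exists_integral_mul_det_eq_sum_sign {f : ℂ → ℂ} (hf : ContDiff ℝ 2 f)
    (hproper : Tendsto f (cocompact ℂ) (cocompact ℂ)) {w : ℂ} {S : Finset ℂ}
    (hS : ∀ z, z ∈ S ↔ f z = w) (hdet : ∀ z ∈ S, (fderiv ℝ f z).det ≠ 0) :
    ∃ d > 0, ∀ φ : ℝ → ℝ, Continuous φ → (∀ s, d ≤ s → φ s = 0) →
      ∫ z, φ (Complex.normSq (f z - w)) * (fderiv ℝ f z).det =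
        (∑ z ∈ S, (SignType.sign (fderiv ℝ f z).det : ℝ)) *
          ∫ z, φ (Complex.normSq (z - w)) := by
  obtain ⟨V, hV, hdisj⟩ := S.finite_toSet.t2_separation
  have hcont := continuous_det_fderiv hf
  have hex : ∀ z ∈ S, ∃ U ⊆ V z ∩ {y | SignType.sign (fderiv ℝ f y).det =
      SignType.sign (fderiv ℝ f z).det}, IsOpen U ∧ z ∈ U ∧ InjOn f U ∧ f '' U ∈ 𝓝 w := by
    intro z hz
    have := exists_isOpen_injOn_image_mem_nhds hf (hdet z hz)
      (inter_mem ((hV z).2.mem_nhds (hV z).1) (eventually_sign_eq hcont.continuousAt (hdet z hz)))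
    rwa [(hS z).1 hz] at this
  choose! U hUsub hUo hUmem hUinj hUimg using hex
  have hnear : ∀ᶠ u in 𝓝 w, ∀ z ∈ S, u ∈ f '' U z := by
    rw [eventually_all_finset]
    exact hUimg
  have hfar : ∀ᶠ u in 𝓝 w, ∀ z, f z = u → z ∈ ⋃ z ∈ S, U z := by
    have hopen : IsOpen (⋃ z ∈ S, U z) := isOpen_biUnion hUo
    have hclosed : IsClosed (f '' (⋃ z ∈ S, U z)ᶜ) := by
      have hp : IsProperMap f := isProperMap_iff_tendsto_cocompact.2 ⟨hf.continuous, hproper⟩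
      exact hp.isClosedMap _ hopen.isClosed_compl
    have hw : w ∈ (f '' (⋃ z ∈ S, U z)ᶜ)ᶜ := by
      rintro ⟨z, hz, hzw⟩
      have hzS := (hS z).2 hzw
      exact hz (mem_biUnion hzS (hUmem z hzS))
    filter_upwards [hclosed.isOpen_compl.mem_nhds hw] with u hu z hz
    by_contra hzU
    exact hu ⟨z, hzU, hz⟩
  obtain ⟨δ, hδ, hball⟩ := Metric.eventually_nhds_iff.1 (hnear.and hfar)
  refine ⟨δ ^ 2, by positivity, fun φ hφ hφd ↦ ?_⟩
  have hsmall : ∀ u, φ (Complex.normSq (u - w)) ≠ 0 → dist u w < δ := fun u hu ↦ by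
    by_contra! h
    refine hu (hφd _ ?_)
    rw [Complex.normSq_eq_norm_sq, ← dist_eq_norm]
    gcongr
  have hcφ : Continuous fun u ↦ φ (Complex.normSq (u - w)) :=
    hφ.comp (Complex.continuous_normSq.comp (by fun_prop))
  have h_integrable : Integrable fun z ↦ φ (Complex.normSq (f z - w)) * (fderiv ℝ f z).det := by
    refine ((hcφ.comp hf.continuous).mul hcont).integrable_of_hasCompactSupport ?_
    have hp : IsProperMap f := isProperMap_iff_tendsto_cocompact.2 ⟨hf.continuous, hproper⟩
    refine HasCompactSupport.intro (hp.isCompact_preimage (isCompact_closedBall w δ)) fun z hz ↦ ?_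
    by_contra h
    exact hz (hsmall _ (left_ne_zero_of_mul h)).le
  have hdisjU : (S : Set ℂ).Pairwise (Function.onFun Disjoint U) := fun z hz z' hz' hne ↦
    (hdisj hz hz' hne).mono ((hUsub z hz).trans inter_subset_left)
      ((hUsub z' hz').trans inter_subset_left)
  rw [← setIntegral_eq_integral_of_forall_compl_eq_zero (s := ⋃ z ∈ S, U z),
    integral_biUnion_finset _ (fun z hz ↦ (hUo z hz).measurableSet) hdisjU
      (fun z _ ↦ h_integrable.integrableOn), Finset.sum_mul]
  · refine Finset.sum_congr rfl fun z hz ↦ ?_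
    have h1 : ∫ x in U z, φ (Complex.normSq (f x - w)) * (fderiv ℝ f x).det =
        ∫ x in U z, (SignType.sign (fderiv ℝ f z).det : ℝ) *
          (|(fderiv ℝ f x).det| • φ (Complex.normSq (f x - w))) := by
      refine setIntegral_congr_fun (hUo z hz).measurableSet fun x hx ↦ ?_
      have hs : SignType.sign (fderiv ℝ f x).det = SignType.sign (fderiv ℝ f z).det :=
        (hUsub z hz hx).2
      rw [← hs, smul_eq_mul, ← mul_assoc, sign_mul_abs, mul_comm]
    rw [h1, integral_const_mul, ← integral_image_eq_integral_abs_det_fderiv_smul volume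
      (hUo z hz).measurableSet (fun x _ ↦
        (hf.differentiable (by norm_num) x).hasFDerivAt.hasFDerivWithinAt) (hUinj z hz)
      (fun u ↦ φ (Complex.normSq (u - w)))]
    congr 1
    refine setIntegral_eq_integral_of_forall_compl_eq_zero fun u hu ↦ ?_
    by_contra h
    exact hu ((hball (hsmall u h)).1 z hz)
  · intro z hz
    by_contra h
    exact hz ((hball (hsmall _ (left_ne_zero_of_mul h))).2 z rfl)

theorem exists_sum_sign_det_eq_boundary {f : ℂ → ℂ} (hf : ContDiff ℝ 2 f)
    (hproper : Tendsto f (cocompact ℂ) (cocompact ℂ)) {w : ℂ} {S : Finset ℂ}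
    (hS : ∀ z, z ∈ S ↔ f z = w) (hdet : ∀ z ∈ S, (fderiv ℝ f z).det ≠ 0) :
    ∀ᶠ R in atTop, (∑ z ∈ S, (SignType.sign (fderiv ℝ f z).det : ℝ)) * (2 * Real.pi) =
      ∫ θ in (-Real.pi)..Real.pi, (fderiv ℝ f (circleMap 0 R θ) (Complex.I * circleMap 0 R θ) /
        (f (circleMap 0 R θ) - w)).im := by
  obtain ⟨d, hd, h⟩ := exists_integral_mul_det_eq_sum_sign hf hproper hS hdet
  obtain ⟨v, hv, hvd⟩ := exists_contDiff_mul_eq_one hd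
  have hfar : ∀ᶠ z in cocompact ℂ, d ≤ Complex.normSq (f z - w) := by
    have h1 := hproper.eventually (isCompact_closedBall w (d + 1)).compl_mem_cocompact
    filter_upwards [h1] with z hz
    rw [mem_closedBall, dist_eq_norm, not_le] at hz
    rw [Complex.normSq_eq_norm_sq]
    nlinarith
  rw [← cobounded_eq_cocompact, ← comap_norm_atTop, eventually_comap, eventually_atTop] at hfar
  obtain ⟨R₀, hR₀⟩ := hfar
  filter_upwards [eventually_ge_atTop R₀, eventually_ge_atTop 0] with R hR hR'
  have hφ := h (fun s ↦ 2 * (v s + s * deriv v s)) (by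
    have h1 := hv.continuous
    have h2 := hv.continuous_deriv (by norm_num)
    fun_prop) (fun s hs ↦ by rw [add_mul_deriv_eq_zero hv hvd hs, mul_zero])
  rw [integral_radial_eq_two_pi hv hd hvd w] at hφ
  rw [← hφ, integral_mul_det_eq_boundary hf w hv hR'
    (fun z hz ↦ add_mul_deriv_eq_zero hv hvd (hR₀ _ (hR.trans hz.le) z rfl))]
  refine intervalIntegral.integral_congr fun θ _ ↦ ?_
  have h1 := hR₀ R hR (circleMap 0 R θ) (by simp [abs_of_nonneg hR'])
  have h2 := hvd _ h1
  have h3 : Complex.normSq (f (circleMap 0 R θ) - w) ≠ 0 := (hd.trans_le h1).ne'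
  rw [eq_inv_of_mul_eq_one_right h2, div_eq_mul_inv, Complex.inv_def, ← mul_assoc,
    Complex.im_mul_ofReal, mul_comm, mul_comm (conj _)]

theorem contDiff_eval_mul_conj (p : ℂ[X]) : ContDiff ℝ 2 fun z ↦ p.eval z * conj z :=
  ((Differentiable.contDiff p.differentiable).restrict_scalars ℝ).mul Complex.conjCLE.contDiff

theorem fderiv_eval_mul_conj_apply (p : ℂ[X]) (z u : ℂ) :
    fderiv ℝ (fun z ↦ p.eval z * conj z) z u =
      u * p.derivative.eval z * conj z + p.eval z * conj u := by
  have h1 := (p.hasDerivAt z).hasFDerivAt.restrictScalars ℝ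
  have h2 : HasFDerivAt (fun z : ℂ ↦ conj z) (Complex.conjCLE : ℂ →L[ℝ] ℂ) z :=
    Complex.conjCLE.hasFDerivAt
  rw [(h1.fun_mul h2).fderiv]
  simp
  ring

theorem det_fderiv_eval_mul_conj (p : ℂ[X]) (z : ℂ) :
    (fderiv ℝ (fun z ↦ p.eval z * conj z) z).det =
      ‖z * p.derivative.eval z‖ ^ 2 - ‖p.eval z‖ ^ 2 := by
  rw [det_eq_im, fderiv_eval_mul_conj_apply, fderiv_eval_mul_conj_apply, norm_mul, mul_pow,
    ← Complex.normSq_eq_norm_sq, ← Complex.normSq_eq_norm_sq, ← Complex.normSq_eq_norm_sq]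
  simp [Complex.normSq_apply]
  ring

theorem sign_det_fderiv_eval_mul_conj (p : ℂ[X]) (z : ℂ) :
    SignType.sign (fderiv ℝ (fun z ↦ p.eval z * conj z) z).det =
      SignType.sign (‖z * p.derivative.eval z‖ - ‖p.eval z‖) := by
  rw [det_fderiv_eval_mul_conj]
  rcases lt_trichotomy ‖z * p.derivative.eval z‖ ‖p.eval z‖ with h | h | h
  · rw [sign_neg (sub_neg.2 h), sign_neg]
    rw [sub_neg]
    gcongr
  · rw [h]; simp
  · rw [sign_pos (sub_pos.2 h), sign_pos]
    rw [sub_pos]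
    gcongr

theorem tendsto_eval_div_pow_cobounded {p : ℂ[X]} {n : ℕ} (hn : p.natDegree ≤ n) :
    Tendsto (fun z ↦ p.eval z / z ^ n) (Bornology.cobounded ℂ) (𝓝 (p.coeff n)) := by
  have h0 : ∀ᶠ z : ℂ in Bornology.cobounded ℂ, z ≠ 0 := Bornology.eventually_ne_cobounded 0
  have h1 : Tendsto (fun z : ℂ ↦ ∑ i ∈ Finset.range (n + 1), p.coeff i * (z⁻¹) ^ (n - i))
      (Bornology.cobounded ℂ) (𝓝 (∑ i ∈ Finset.range (n + 1), p.coeff i * 0 ^ (n - i))) :=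
    tendsto_finsetSum _ fun i _ ↦ (tendsto_inv₀_cobounded.pow _).const_mul _
  have h2 : ∑ i ∈ Finset.range (n + 1), p.coeff i * 0 ^ (n - i) = p.coeff n := by
    rw [Finset.sum_range_succ, Finset.sum_eq_zero, zero_add, Nat.sub_self, pow_zero, mul_one]
    intro i hi
    rw [zero_pow (Nat.sub_ne_zero_of_lt (Finset.mem_range.1 hi)), mul_zero]
  rw [h2] at h1
  refine h1.congr' ?_
  filter_upwards [h0] with z hz
  rw [eval_eq_sum_range' (Nat.lt_succ_of_le hn), Finset.sum_div]
  refine Finset.sum_congr rfl fun i hi ↦ ?_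
  have hi' : n = i + (n - i) := by have := Finset.mem_range.1 hi; omega
  conv_rhs => rw [hi', pow_add]
  rw [inv_pow]
  field_simp

theorem tendsto_cocompact_eval_mul_conj {p : ℂ[X]} (hp : 0 < p.natDegree) :
    Tendsto (fun z ↦ p.eval z * conj z) (cocompact ℂ) (cocompact ℂ) := by
  rw [← cobounded_eq_cocompact, ← tendsto_norm_atTop_iff_cobounded]
  have h := p.tendsto_norm_atTop (natDegree_pos_iff_degree_pos.1 hp)
    (tendsto_norm_cobounded_atTop (E := ℂ))
  refine (h.atTop_mul_atTop₀ (tendsto_norm_cobounded_atTop (E := ℂ))).congr fun z ↦ ?_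
  simp

theorem tendsto_logDeriv_eval_mul_conj {p : ℂ[X]} (hp : 0 < p.natDegree) (w : ℂ) :
    Tendsto (fun z ↦ (fderiv ℝ (fun z ↦ p.eval z * conj z) z (Complex.I * z) /
      (p.eval z * conj z - w)).im) (Bornology.cobounded ℂ) (𝓝 (p.natDegree - 1)) := by
  set n := p.natDegree with hn
  have hlead : p.coeff n ≠ 0 := by
    rw [hn, coeff_natDegree, ne_eq, leadingCoeff_eq_zero]; rintro rfl; simp at hn; omega
  have h1 := tendsto_eval_div_pow_cobounded (p := p) (n := n) le_rfl
  have h2 := tendsto_eval_div_pow_cobounded (p := X * derivative p) (n := n) (by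
    refine (natDegree_mul_le).trans ?_
    have := natDegree_derivative_le p
    have := natDegree_X_le (R := ℂ)
    omega)
  have hc : (X * derivative p).coeff n = p.coeff n * n := by
    obtain ⟨m, hm⟩ := Nat.exists_eq_add_of_lt hp
    rw [zero_add] at hm
    rw [hm, coeff_X_mul, coeff_derivative]
    push_cast
    ring
  rw [hc] at h2
  have h3 : Tendsto (fun z : ℂ ↦ w * ((conj z)⁻¹ * (z⁻¹) ^ n)) (Bornology.cobounded ℂ) (𝓝 0) := by
    have hi := tendsto_inv₀_cobounded (α := ℂ)
    have := (((Complex.continuous_conj.tendsto 0).comp hi).mul (hi.pow n)).const_mul w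
    simpa [hp.ne'] using this
  have h4 := (h2.sub h1).div (h1.sub h3) (by simpa using hlead)
  have h5 := (Complex.continuous_re.tendsto _).comp h4
  have hval : ((p.coeff n * n - p.coeff n) / (p.coeff n - 0)).re = (n : ℝ) - 1 := by
    rw [sub_zero, show (p.coeff n * n - p.coeff n) / p.coeff n = ((n - 1 : ℝ) : ℂ) by
      push_cast; field_simp, Complex.ofReal_re]
  rw [hval] at h5
  refine h5.congr' ?_
  filter_upwards [Bornology.eventually_ne_cobounded (0 : ℂ)] with z hz
  have hz' : conj z ≠ 0 := by simpa using hz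
  have hzn : conj z * z ^ n ≠ 0 := mul_ne_zero hz' (pow_ne_zero _ hz)
  rw [fderiv_eval_mul_conj_apply]
  have e1 : Complex.I * z * eval z (derivative p) * conj z + eval z p * conj (Complex.I * z) =
      Complex.I * ((z * eval z (derivative p) - eval z p) * conj z) := by
    rw [map_mul, Complex.conj_I]; ring
  rw [e1, mul_div_assoc, Complex.I_mul_im]
  simp only [Function.comp, Pi.div_apply, eval_mul, eval_X]
  congr 1
  have e2 : p.eval z / z ^ n - w * ((conj z)⁻¹ * (z⁻¹) ^ n) =
      (p.eval z * conj z - w) / (conj z * z ^ n) := by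
    rw [inv_pow]; field_simp
  have e3 : z * eval z (derivative p) / z ^ n - p.eval z / z ^ n =
      ((z * eval z (derivative p) - eval z p) * conj z) / (conj z * z ^ n) := by
    field_simp
  rw [e2, e3, div_div_div_cancel_right₀ hzn]

theorem card_pos_lt_card_neg_add {p : ℂ[X]} (hp : 0 < p.natDegree) {w : ℂ} {S : Finset ℂ}
    (hS : ∀ z, z ∈ S ↔ p.eval z * conj z = w)
    (hdet : ∀ z ∈ S, (fderiv ℝ (fun z ↦ p.eval z * conj z) z).det ≠ 0) :
    (S.filter fun z ↦ ‖p.eval z‖ < ‖z * p.derivative.eval z‖).card <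
      (S.filter fun z ↦ ‖z * p.derivative.eval z‖ < ‖p.eval z‖).card + p.natDegree := by
  have h1 := exists_sum_sign_det_eq_boundary (contDiff_eval_mul_conj p)
    (tendsto_cocompact_eval_mul_conj hp) hS hdet
  have hn : (1 : ℝ) ≤ p.natDegree := by exact_mod_cast hp
  have h2 := (tendsto_logDeriv_eval_mul_conj hp w).abs.eventually_lt_const
    (show |(p.natDegree : ℝ) - 1| < p.natDegree - 1 / 2 by
      rw [abs_of_nonneg (by linarith)]; linarith)
  rw [← comap_norm_atTop, eventually_comap] at h2
  obtain ⟨R, hR, hR', hR0⟩ := (h1.and (h2.and (eventually_ge_atTop 0))).exists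
  have h3 := intervalIntegral.norm_integral_le_of_norm_le_const (a := -Real.pi) (b := Real.pi)
    (f := fun θ ↦ (fderiv ℝ (fun z ↦ p.eval z * conj z) (circleMap 0 R θ)
      (Complex.I * circleMap 0 R θ) /
        (p.eval (circleMap 0 R θ) * conj (circleMap 0 R θ) - w)).im)
    (fun θ _ ↦ (hR' (circleMap 0 R θ) (by simp [abs_of_nonneg hR0])).le)
  rw [← hR] at h3
  have h4 : ∑ z ∈ S, (SignType.sign (fderiv ℝ (fun z ↦ p.eval z * conj z) z).det : ℝ) =
      ((S.filter fun z ↦ ‖p.eval z‖ < ‖z * p.derivative.eval z‖).card : ℝ) -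
      (S.filter fun z ↦ ‖z * p.derivative.eval z‖ < ‖p.eval z‖).card := by
    rw [Finset.card_filter, Finset.card_filter]
    push_cast
    rw [← Finset.sum_sub_distrib]
    refine Finset.sum_congr rfl fun z _ ↦ ?_
    rw [sign_det_fderiv_eval_mul_conj]
    generalize ‖z * p.derivative.eval z‖ = a, ‖p.eval z‖ = b
    rcases lt_trichotomy a b with h | h | h
    · simp [sign_neg (sub_neg.2 h), h, h.not_gt]
    · rw [h]; simp
    · simp [sign_pos (sub_pos.2 h), h, h.not_gt]
  rw [h4] at h3
  have h5 := (le_abs_self _).trans h3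
  rw [sub_neg_eq_add, abs_of_nonneg (by positivity)] at h5
  have h6 := Real.pi_pos
  have h7 : ((S.filter fun z ↦ ‖p.eval z‖ < ‖z * p.derivative.eval z‖).card : ℝ) -
      (S.filter fun z ↦ ‖z * p.derivative.eval z‖ < ‖p.eval z‖).card ≤ p.natDegree - 1 / 2 := by
    refine le_of_mul_le_mul_right ?_ (show 0 < 2 * Real.pi by positivity)
    linarith
  have : ((S.filter fun z ↦ ‖p.eval z‖ < ‖z * p.derivative.eval z‖).card : ℝ) <
      (S.filter fun z ↦ ‖z * p.derivative.eval z‖ < ‖p.eval z‖).card + p.natDegree := by linarith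
  exact_mod_cast this

theorem ncard_repelling_lt {p : ℂ[X]} (hp : 1 < p.natDegree) {w : ℂ} (hw : w ≠ 0) :
    {z | p.eval z * conj z = w ∧ ‖p.eval z‖ < ‖z * p.derivative.eval z‖}.ncard <
      2 * p.natDegree := by
  have hf := contDiff_eval_mul_conj p
  set f : ℂ → ℂ := fun z ↦ p.eval z * conj z with hfdef
  set T := {z | p.eval z * conj z = w ∧ ‖p.eval z‖ < ‖z * p.derivative.eval z‖} with hT
  have hTfin : T.Finite := (finite_logharmonic_solutions hp hw).subset fun z hz ↦ hz.1
  obtain ⟨V, hV, hdisj⟩ := hTfin.t2_separation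
  have hopen : IsOpen {z | ‖p.eval z‖ < ‖z * p.derivative.eval z‖} :=
    isOpen_lt p.continuous.norm (continuous_id.mul p.derivative.continuous).norm
  have hex : ∀ z ∈ T, ∃ U ⊆ V z ∩ {z | ‖p.eval z‖ < ‖z * p.derivative.eval z‖}, f '' U ∈ 𝓝 w := by
    intro z hz
    have hd : (fderiv ℝ f z).det ≠ 0 := by
      rw [← sign_ne_zero, sign_det_fderiv_eval_mul_conj, sign_ne_zero]
      exact (sub_pos.2 hz.2).ne'
    obtain ⟨U, hU, -, -, -, h⟩ := exists_isOpen_injOn_image_mem_nhds hf hd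
      (inter_mem ((hV z).2.mem_nhds (hV z).1) (hopen.mem_nhds hz.2))
    have hfz : f z = w := hz.1
    exact ⟨U, hU, hfz ▸ h⟩
  choose! U hU hUimg using hex
  have hnear : ∀ᶠ u in 𝓝 w, u ≠ 0 ∧ ∀ z ∈ T, u ∈ f '' U z :=
    (eventually_ne_nhds hw).and ((eventually_all_finite hTfin).2 hUimg)
  have hsard : volume (f '' {z | (fderiv ℝ f z).det = 0}) = 0 :=
    addHaar_image_eq_zero_of_det_fderivWithin_eq_zero volume
      (fun z _ ↦ (hf.differentiable (by norm_num) z).hasFDerivAt.hasFDerivWithinAt) fun z hz ↦ hz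
  obtain ⟨u, ⟨hu0, hu⟩, hureg⟩ : ∃ u, (u ≠ 0 ∧ ∀ z ∈ T, u ∈ f '' U z) ∧
      u ∉ f '' {z | (fderiv ℝ f z).det = 0} := by
    by_contra! hcon
    exact (Measure.measure_pos_of_mem_nhds volume hnear).ne' (measure_mono_null hcon hsard)
  have hSfin := finite_logharmonic_solutions hp hu0
  have hS : ∀ z, z ∈ hSfin.toFinset ↔ p.eval z * conj z = u := fun z ↦ hSfin.mem_toFinset
  have hlt := card_pos_lt_card_neg_add (by omega) hS (fun z hz h ↦ hureg ⟨z, h, (hS z).1 hz⟩)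
  choose! y hyU hy using hu
  calc T.ncard ≤ (hSfin.toFinset.filter fun z ↦
        ‖p.eval z‖ < ‖z * p.derivative.eval z‖).card := by
        rw [← ncard_coe_finset]
        refine ncard_le_ncard_of_injOn y (fun z hz ↦ ?_) (fun z hz z' hz' h ↦ ?_)
          (Finset.finite_toSet _)
        · rw [Finset.mem_coe, Finset.mem_filter, hS]
          exact ⟨hy z hz, (hU z hz (hyU z hz)).2⟩
        · by_contra hne
          exact disjoint_left.1 (hdisj hz hz' hne) (hU z hz (hyU z hz)).1
            (h ▸ (hU z' hz' (hyU z' hz')).1)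
    _ < _ := hlt
    _ ≤ p.natDegree + p.natDegree := by
      gcongr
      refine le_trans ?_ (ncard_nonrepelling_le hp hu0)
      rw [← ncard_coe_finset]
      refine ncard_le_ncard (fun z hz ↦ ?_) (hSfin.subset fun z hz ↦ hz.1)
      rw [Finset.mem_coe, Finset.mem_filter, hS] at hz
      exact ⟨hz.1, hz.2.le⟩
    _ = _ := by ring

theorem finite_and_ncard_solutions_le {p : ℂ[X]} (hp : 1 < p.natDegree) (w : ℂ) :
    {z | p.eval z * conj z = w}.Finite ∧
      {z | p.eval z * conj z = w}.ncard ≤ 3 * p.natDegree - 1 := by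
  by_cases hw : w = 0
  · subst hw
    have hp0 : p ≠ 0 := by rintro rfl; simp at hp
    classical
    have hsub : {z | p.eval z * conj z = 0} ⊆ (insert 0 p.roots.toFinset : Finset ℂ) := by
      intro z hz
      rcases mul_eq_zero.1 hz with h | h
      · simp [hp0, h]
      · simp [(map_eq_zero _).1 h]
    refine ⟨(Finset.finite_toSet _).subset hsub, (ncard_le_ncard hsub).trans ?_⟩
    rw [ncard_coe_finset]
    have h1 := Finset.card_insert_le 0 p.roots.toFinset
    have h2 := (Multiset.toFinset_card_le p.roots).trans (card_roots' p)
    omega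
  · have hfin := finite_logharmonic_solutions hp hw
    refine ⟨hfin, ?_⟩
    have h1 := ncard_nonrepelling_le hp hw
    have h2 := ncard_repelling_lt hp hw
    have hunion : {z | p.eval z * conj z = w} =
        {z | p.eval z * conj z = w ∧ ‖z * p.derivative.eval z‖ ≤ ‖p.eval z‖} ∪
        {z | p.eval z * conj z = w ∧ ‖p.eval z‖ < ‖z * p.derivative.eval z‖} := by
      ext z
      have := le_or_gt ‖z * p.derivative.eval z‖ ‖p.eval z‖
      simp only [mem_union, mem_ofPred_eq]
      tauto
    have h3 := ncard_union_le
      {z | p.eval z * conj z = w ∧ ‖z * p.derivative.eval z‖ ≤ ‖p.eval z‖}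
      {z | p.eval z * conj z = w ∧ ‖p.eval z‖ < ‖z * p.derivative.eval z‖}
    rw [← hunion] at h3
    omega

end Degree

/-- If `p` is a complex polynomial of degree `n > 1` and `q` is linear, then for every
`w : ℂ` the solution set of `p(z) * conj (q z) = w` is finite with at most `3 * n - 1`
elements. -/
theorem logharmonic_valence_upper_bound (n : ℕ) (hn : 1 < n)
    (p q : Polynomial ℂ) (hp : p.natDegree = n) (hq : q.natDegree = 1) (w : ℂ) :
    {z : ℂ | p.eval z * (starRingEnd ℂ) (q.eval z) = w}.Finite ∧
    {z : ℂ | p.eval z * (starRingEnd ℂ) (q.eval z) = w}.ncard ≤ 3 * n - 1 := by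
  obtain ⟨a, ha, b, rfl⟩ := Polynomial.natDegree_eq_one.1 hq
  let r : Polynomial ℂ := Polynomial.C a⁻¹ * Polynomial.X + Polynomial.C (-(a⁻¹ * b))
  have hr : r.natDegree = 1 := Polynomial.natDegree_linear (inv_ne_zero ha)
  have hdeg : (p.comp r).natDegree = n := by rw [Polynomial.natDegree_comp, hr, mul_one, hp]
  have h := finite_and_ncard_solutions_le (p := p.comp r) (by omega) w
  rw [hdeg] at h
  have hinv : ∀ ζ, r.eval (a * ζ + b) = ζ := fun ζ ↦ by
    simp [r]; field_simp; ring
  have hinj : Function.Injective fun ζ : ℂ ↦ a * ζ + b := fun x y hxy ↦ by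
    rw [← hinv x, ← hinv y]; exact congrArg (Polynomial.eval · r) hxy
  have hmaps : Set.MapsTo (fun ζ : ℂ ↦ a * ζ + b)
      {z : ℂ | p.eval z *
        starRingEnd ℂ ((Polynomial.C a * Polynomial.X + Polynomial.C b).eval z) = w}
      {z | (p.comp r).eval z * starRingEnd ℂ z = w} := fun z hz ↦ by
    rw [Set.mem_ofPred_eq] at hz ⊢
    rw [Polynomial.eval_comp, hinv, ← hz]
    simp
  exact ⟨Set.Finite.of_injOn hmaps hinj.injOn h.1,
    (Set.ncard_le_ncard_of_injOn _ hmaps hinj.injOn h.1).trans h.2⟩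
end

section
/- For each integer n > 1 there exists a complex polynomial p of degree n with all coefficients real such that the derivative p' has exactly n − 1 distinct complex roots, and every root z of p' satisfies conj(p(z)) = z; that is, the anti-polynomial z ↦ conj(p(z)) has n − 1 finite, fixed critical points. -/
open Set Filter Metric Topology ComplexConjugate

section PullBack

variable {E : Type*} [NormedAddCommGroup E] [NormedSpace ℂ E]

theorem IsCoveringMapOn.exists_continuousOn_lift_of_convex {W X Y : Type*} [NormedAddCommGroup W]
    [NormedSpace ℝ W] [TopologicalSpace X] [TopologicalSpace Y] {G : X → Y} {U : Set Y}
    (cov : IsCoveringMapOn G U) {s : Set W} (hs : Convex ℝ s) {f : W → Y} (hf : ContinuousOn f s)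
    (hfU : MapsTo f s U) {w₀ : W} (hw₀ : w₀ ∈ s) {x₀ : X} (hx₀ : G x₀ = f w₀) :
    ∃ g : W → X, ContinuousOn g s ∧ g w₀ = x₀ ∧ ∀ w ∈ s, G (g w) = f w := by
  classical
  have := hs.contractibleSpace ⟨w₀, hw₀⟩
  have := hs.locallyPathConnectedSpace
  obtain ⟨F, ⟨hF₀, hF⟩, -⟩ := cov.existsUnique_continuousMap_lifts
    (⟨s.domRestrict f, hf.domRestrict⟩ : C(s, Y)) (a₀ := ⟨w₀, hw₀⟩) hx₀ fun a ↦ hfU a.2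
  have hext (w : s) : (fun w ↦ if h : w ∈ s then F ⟨w, h⟩ else x₀) w = F w := by simp
  refine ⟨fun w ↦ if h : w ∈ s then F ⟨w, h⟩ else x₀, ?_, ?_, fun w hw ↦ ?_⟩
  · rw [continuousOn_iff_continuous_domRestrict]
    exact F.continuous.congr fun w ↦ (hext w).symm
  · simpa [hw₀] using hF₀
  · exact (congrArg G (hext ⟨w, hw⟩)).trans (congrFun hF ⟨w, hw⟩)

theorem HasDerivAt.of_comp_of_equiv {𝕜 F : Type*} [NontriviallyNormedField 𝕜]
    [NormedAddCommGroup F] [NormedSpace 𝕜 F] {G : F → F} {g f : 𝕜 → F} {t : 𝕜} {v : F}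
    {A : F ≃L[𝕜] F} (hf : HasDerivAt f v t) (hg : ContinuousAt g t)
    (hG : HasFDerivAt G (A : F →L[𝕜] F) (g t)) (h : G ∘ g =ᶠ[𝓝 t] f) :
    HasDerivAt g (A.symm v) t := by
  have := HasFDerivAt.of_comp_of_leftInverse hg hG hf.hasFDerivAt h
    (f'symm := (A.symm : F →L[𝕜] F)) A.symm_apply_apply
  simpa using this.hasDerivAt

/-- The pairs `(x, v)` such that `v` is the velocity at `0` of a holomorphic disc in `U`
centred at `x`. -/
def discTangents (U : Set E) : Set (E × E) :=
  {p | ∃ φ : ℂ → E, DifferentiableOn ℂ φ (ball 0 1) ∧ MapsTo φ (ball 0 1) U ∧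
    φ 0 = p.1 ∧ HasDerivAt φ p.2 0}

theorem mem_discTangents_of_ball_subset {U : Set E} {x v : E} {r : ℝ} (hx : ball x r ⊆ U)
    (hv : ‖v‖ < r) : (x, v) ∈ discTangents U := by
  refine ⟨fun z ↦ x + z • v, ?_, fun z hz ↦ hx ?_, by simp, ?_⟩
  · fun_prop
  · rw [mem_ball_zero_iff] at hz
    rw [mem_ball, dist_eq_norm, add_sub_cancel_left, norm_smul]
    nlinarith [norm_nonneg v]
  · simpa using ((hasDerivAt_id (0 : ℂ)).smul_const v).const_add x

theorem norm_le_of_mem_discTangents {U : Set E} {R : ℝ} (hU : ∀ x ∈ U, ‖x‖ ≤ R) {x v : E}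
    (h : (x, v) ∈ discTangents U) : ‖v‖ ≤ 2 * R := by
  obtain ⟨φ, hφ, hm, -, hd⟩ := h
  change HasDerivAt φ v 0 at hd
  rw [← hd.deriv]
  have := Complex.norm_deriv_le_div_of_mapsTo_ball hφ (R₂ := 2 * R) (fun z hz ↦ ?_) one_pos
  · simpa using this
  · rw [mem_closedBall, dist_eq_norm]
    have h1 := hU _ (hm hz)
    have h2 := hU _ (hm (mem_ball_self one_pos))
    linarith [norm_sub_le (φ z) (φ 0)]

theorem star_mem_discTangents [StarAddMonoid E] [NormedStarGroup E] [StarModule ℂ E] {U : Set E}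
    (hU : ∀ x ∈ U, star x ∈ U) {x v : E} (h : (x, v) ∈ discTangents U) :
    (star x, star v) ∈ discTangents U := by
  obtain ⟨φ, hφ, hm, h0, hd⟩ := h
  refine ⟨star ∘ φ ∘ starRingEnd ℂ, fun z hz ↦ ?_, fun z hz ↦ hU _ (hm ?_), by simp [h0], ?_⟩
  · have hz' : starRingEnd ℂ z ∈ ball (0 : ℂ) 1 := by simpa using hz
    have := (hφ.differentiableAt (isOpen_ball.mem_nhds hz')).star_conj
    simpa using this.differentiableWithinAt
  · simpa using hz
  · simpa using hd.star_conj

theorem mem_discTangents_of_lift {U : Set E} {G : E → E} (cov : IsCoveringMapOn G U)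
    (hG : ∀ x, G x ∈ U → ∃ A : E ≃L[ℂ] E, HasFDerivAt G (A : E →L[ℂ] E) x) {R ε η : ℝ}
    (hU : ∀ x ∈ U, ‖x‖ ≤ R) (hε : ∀ x, G x ∈ U → ball x ε ⊆ U) (hη : 0 ≤ η)
    (hηε : η * (2 * R) < ε) {x v : E} {A : E ≃L[ℂ] E} (hA : HasFDerivAt G (A : E →L[ℂ] E) x)
    (h : (G x, v) ∈ discTangents U) :
    (x, (1 + η : ℂ) • A.symm v) ∈ discTangents U := by
  obtain ⟨φ, hφ, hm, h0, hd⟩ := h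
  have hε0 : 0 < ε := by
    have := (norm_nonneg _).trans (hU _ (hm (mem_ball_self one_pos)))
    exact lt_of_le_of_lt (by positivity) hηε
  have hball : (0 : ℂ) ∈ ball (0 : ℂ) 1 := mem_ball_self one_pos
  obtain ⟨g, hgc, hg0, hg⟩ := cov.exists_continuousOn_lift_of_convex (convex_ball (0 : ℂ) 1)
    hφ.continuousOn hm hball (x₀ := x) h0.symm
  have hgA (z : ℂ) (hz : z ∈ ball (0 : ℂ) 1) : ContinuousAt g z ∧ G ∘ g =ᶠ[𝓝 z] φ :=
    ⟨hgc.continuousAt (isOpen_ball.mem_nhds hz),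
      eventually_of_mem (isOpen_ball.mem_nhds hz) fun w hw ↦ hg w hw⟩
  have hgd (z : ℂ) (hz : z ∈ ball (0 : ℂ) 1) : DifferentiableAt ℂ g z := by
    obtain ⟨B, hB⟩ := hG (g z) (by rw [hg z hz]; exact hm hz)
    exact ((hφ.differentiableAt (isOpen_ball.mem_nhds hz)).hasDerivAt.of_comp_of_equiv
      (hgA z hz).1 hB (hgA z hz).2).differentiableAt
  have hgU (z : ℂ) (hz : z ∈ ball (0 : ℂ) 1) : ball (g z) ε ⊆ U :=
    hε _ (by rw [hg z hz]; exact hm hz)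
  refine ⟨fun z ↦ x + (1 + η : ℂ) • (g z - x), fun z hz ↦ ?_, fun z hz ↦ hgU z hz ?_,
    by simp [hg0], ?_⟩
  · have := hgd z hz
    exact DifferentiableAt.differentiableWithinAt (by fun_prop)
  · have h1 := hU _ (hgU z hz (mem_ball_self hε0))
    have h2 := hU _ (hgU 0 hball (mem_ball_self hε0))
    rw [hg0] at h2
    have : x + (1 + η : ℂ) • (g z - x) - g z = (η : ℂ) • (g z - x) := by module
    rw [mem_ball, dist_eq_norm, this, norm_smul, Complex.norm_real, Real.norm_of_nonneg hη]
    refine lt_of_le_of_lt (mul_le_mul_of_nonneg_left ?_ hη) hηε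
    linarith [norm_sub_le (g z) x]
  · have := hd.of_comp_of_equiv (hgA 0 hball).1 (by rw [hg0]; exact hA) (hgA 0 hball).2
    exact ((this.sub_const x).const_smul (1 + η : ℂ)).const_add x

theorem exists_pullBack_path [StarAddMonoid E] [NormedStarGroup E] [StarModule ℂ E]
    {U : Set E} {G τ : E → E} (cov : IsCoveringMapOn G U)
    (hG : ∀ x, G x ∈ U → ∃ A : E ≃L[ℂ] E, HasFDerivAt G (A : E →L[ℂ] E) x) {R ε η : ℝ}
    (hU : ∀ x ∈ U, ‖x‖ ≤ R) (hstar : ∀ x ∈ U, star x ∈ U) (hε : ∀ x, G x ∈ U → ball x ε ⊆ U)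
    (hη : 0 ≤ η) (hηε : η * (2 * R) < ε) (hτ : Continuous τ)
    (hτs : ∀ x, τ (star x) = star (τ x)) (hτG : ∀ x, G (τ x) = τ (G x)) {γ γ' : ℝ → E}
    {a : ℂ} (hγ : ∀ t, HasDerivAt γ (γ' t) t) (hγS : ∀ t, (γ t, a • γ' t) ∈ discTangents U)
    (hγτ : ∀ t, τ (γ t) = γ t) (h01 : G (γ 1) = star (γ 0)) :
    ∃ β β' : ℝ → E, (∀ t, HasDerivAt β (β' t) t) ∧
      (∀ t, (β t, ((1 + η : ℂ) * conj a) • β' t) ∈ discTangents U) ∧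
      (∀ t, τ (β t) = β t) ∧ (∀ t, G (β t) = star (γ t)) ∧ β 0 = γ 1 := by
  have hγc : Continuous γ := continuous_iff_continuousAt.2 fun t ↦ (hγ t).continuousAt
  have hγU (t : ℝ) : star (γ t) ∈ U := by
    obtain ⟨φ, -, hm, h0, -⟩ := hγS t
    refine hstar _ ?_
    have := hm (mem_ball_self one_pos)
    rwa [h0] at this
  obtain ⟨F, ⟨hF0, hF⟩, huniq⟩ := cov.existsUnique_continuousMap_lifts
    (⟨fun t ↦ star (γ t), hγc.star⟩ : C(ℝ, E)) (a₀ := 0) h01 hγU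
  replace hF (t : ℝ) : G (F t) = star (γ t) := congrFun hF t
  have hFτ : (⟨τ ∘ F, hτ.comp F.continuous⟩ : C(ℝ, E)) = F := by
    refine huniq _ ⟨by simp [hF0, hγτ], ?_⟩
    ext t
    simp [hτG, hF, hτs, hγτ]
  choose A hA using fun t ↦ hG (F t) (by rw [hF]; exact hγU t)
  refine ⟨F, fun t ↦ (A t).symm (star (γ' t)), fun t ↦ ?_, fun t ↦ ?_,
    fun t ↦ DFunLike.congr_fun hFτ t, hF, hF0⟩
  · exact (hγ t).star.of_comp_of_equiv (A := (A t).restrictScalars ℝ) F.continuous.continuousAt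
      ((hA t).restrictScalars ℝ) (.of_forall hF)
  · have h := star_mem_discTangents hstar (hγS t)
    rw [← hF, star_smul] at h
    have := mem_discTangents_of_lift cov hG hU hε hη hηε (hA t) h
    simpa [mul_smul] using this

theorem exists_eq_star_of_pullBack [CompleteSpace E] [StarAddMonoid E] [NormedStarGroup E]
    [StarModule ℂ E]
    {U : Set E} {G τ : E → E} (hGc : Continuous G) (cov : IsCoveringMapOn G U)
    (hG : ∀ x, G x ∈ U → ∃ A : E ≃L[ℂ] E, HasFDerivAt G (A : E →L[ℂ] E) x) {R ε : ℝ}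
    (hU : ∀ x ∈ U, ‖x‖ ≤ R) (hstar : ∀ x ∈ U, star x ∈ U) (hε0 : 0 < ε)
    (hε : ∀ x, G x ∈ U → ball x ε ⊆ U) (hτ : Continuous τ)
    (hτs : ∀ x, τ (star x) = star (τ x)) (hτG : ∀ x, G (τ x) = τ (G x)) {γ γ' : ℝ → E}
    (hγ : ∀ t, HasDerivAt γ (γ' t) t) {r C : ℝ} (hr : 0 < r) (hγU : ∀ t, ball (γ t) r ⊆ U)
    (hC : ∀ t, ‖γ' t‖ ≤ C) (hγτ : ∀ t, τ (γ t) = γ t) (h01 : G (γ 1) = star (γ 0)) :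
    ∃ x ∈ U, G x = star x ∧ τ x = x := by
  have hR : 0 ≤ R := (norm_nonneg _).trans (hU _ (hγU 0 (mem_ball_self hr)))
  have hC0 : 0 ≤ C := (norm_nonneg _).trans (hC 0)
  obtain ⟨η, hη, hηε⟩ : ∃ η : ℝ, 0 < η ∧ η * (2 * R) < ε := by
    refine ⟨ε / (2 * R + 1), by positivity, ?_⟩
    rw [div_mul_eq_mul_div, div_lt_iff₀ (by positivity)]
    nlinarith
  obtain ⟨c, hc, hcr⟩ : ∃ c : ℝ, 0 < c ∧ c * C < r := by
    refine ⟨r / (C + 1), by positivity, ?_⟩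
    rw [div_mul_eq_mul_div, div_lt_iff₀ (by positivity)]
    nlinarith
  let P (k : ℕ) (β : ℝ → E) : Prop := (∀ t, τ (β t) = β t) ∧ G (β 1) = star (β 0) ∧
    ∃ β' : ℝ → E, (∀ t, HasDerivAt β (β' t) t) ∧
      ∀ t, (β t, ((c * (1 + η) ^ k : ℝ) : ℂ) • β' t) ∈ discTangents U
  have hstep (k : ℕ) (p : {β // P k β}) : ∃ q : {β // P (k + 1) β},
      (∀ t, G (q.1 t) = star (p.1 t)) ∧ q.1 0 = p.1 1 := by
    obtain ⟨α, hα, hα1, α', hα', hαS⟩ := p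
    obtain ⟨β, β', h1, h2, h3, h4, h5⟩ :=
      exists_pullBack_path cov hG hU hstar hε hη.le hηε hτ hτs hτG hα' hαS hα hα1
    refine ⟨⟨β, h3, by rw [h4, h5], β', h1, fun t ↦ ?_⟩, h4, h5⟩
    convert h2 t using 3
    rw [Complex.conj_ofReal]
    push_cast
    ring
  choose f hfG hf0 using hstep
  have hP0 : P 0 γ := by
    refine ⟨hγτ, h01, γ', hγ, fun t ↦ mem_discTangents_of_ball_subset (hγU t) ?_⟩
    rw [norm_smul, Complex.norm_real, pow_zero, mul_one, Real.norm_of_nonneg hc.le]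
    exact lt_of_le_of_lt (mul_le_mul_of_nonneg_left (hC t) hc.le) hcr
  let Γ (k : ℕ) : {β // P k β} := Nat.rec ⟨γ, hP0⟩ f k
  have hΓG (k : ℕ) (t : ℝ) : G ((Γ (k + 1)).1 t) = star ((Γ k).1 t) := hfG k (Γ k) t
  have hΓ0 (k : ℕ) : (Γ (k + 1)).1 0 = (Γ k).1 1 := hf0 k (Γ k)
  have hdist (k : ℕ) : dist ((Γ k).1 0) ((Γ (k + 1)).1 0) ≤ 2 * R / c * ((1 + η)⁻¹) ^ k := by
    obtain ⟨-, -, β', hβ', hβS⟩ := (Γ k).2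
    rw [hΓ0, dist_comm, dist_eq_norm]
    have hb (t : ℝ) : ‖β' t‖ ≤ 2 * R / c * ((1 + η)⁻¹) ^ k := by
      have := norm_le_of_mem_discTangents hU (hβS t)
      rw [norm_smul, Complex.norm_real, Real.norm_of_nonneg (by positivity)] at this
      rw [inv_pow, ← div_eq_mul_inv, div_div, le_div_iff₀ (by positivity)]
      linarith
    simpa using (convex_univ (𝕜 := ℝ) (E := ℝ)).norm_image_sub_le_of_norm_hasDerivWithin_le
      (fun t _ ↦ (hβ' t).hasDerivWithinAt) (fun t _ ↦ hb t) (mem_univ 0) (mem_univ 1)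
  have hη1 : (1 + η)⁻¹ < 1 := inv_lt_one_of_one_lt₀ (by linarith)
  obtain ⟨x, hx⟩ := cauchySeq_tendsto_of_complete (cauchySeq_of_le_geometric _ _ hη1 hdist)
  have hx1 := (tendsto_add_atTop_iff_nat 1).2 hx
  refine ⟨x, ?_, ?_, ?_⟩
  · obtain ⟨k, hk⟩ := (hx1.eventually (ball_mem_nhds x hε0)).exists
    refine hε _ ?_ (mem_ball_comm.1 hk)
    rw [hΓG]
    obtain ⟨-, -, β', hβ', hβS⟩ := (Γ k).2
    obtain ⟨φ, -, hm, h0, -⟩ := hβS 0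
    have := hm (mem_ball_self one_pos)
    rw [h0] at this
    exact hstar _ this
  · refine tendsto_nhds_unique ((hGc.tendsto x).comp hx1) (Tendsto.congr (fun k ↦ ?_) hx.star)
    exact (hΓG k 0).symm
  · refine tendsto_nhds_unique ((hτ.tendsto x).comp hx) (hx.congr fun k ↦ ?_)
    exact ((Γ k).2.1 0).symm

end PullBack

section ReflectionPath

variable {ι : Type*}

theorem exists_pos_forall_le_norm_of_periodic {κ : Type*} [Finite κ] {f : κ → ℝ → ℂ} {c : ℝ}
    (hc : c ≠ 0) (hp : ∀ k, Function.Periodic (f k) c) (hf : ∀ k, Continuous (f k))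
    (h : ∀ k t, f k t ≠ 0) : ∃ δ > 0, ∀ k t, δ ≤ ‖f k t‖ := by
  have key (k : κ) : ∃ δ > 0, ∀ t, δ ≤ ‖f k t‖ := by
    obtain ⟨_, ⟨s, rfl⟩, hs⟩ := ((hp k).compact_of_continuous hc (hf k)).exists_isMinOn
      (range_nonempty (f k)) continuous_norm.continuousOn
    exact ⟨‖f k s‖, norm_pos_iff.2 (h k s), fun t ↦ hs (mem_range_self t)⟩
  choose δ hδ hle using key
  rcases isEmpty_or_nonempty κ with _ | _
  · exact ⟨1, one_pos, fun k ↦ isEmptyElim k⟩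
  · obtain ⟨k₀, hk₀⟩ := Finite.exists_min δ
    exact ⟨δ k₀, hδ k₀, fun k t ↦ (hk₀ k).trans (hle k t)⟩

/-- A loop of configurations which is `e + exp (iθ)` at time `1` and the reflection of that
configuration in the imaginary axis at time `0`. -/
noncomputable def reflectionPath (e : ℕ) (θ : ι → ℝ) (t : ℝ) (j : ι) : ℂ :=
  ⟨-Real.cos (Real.pi * t) * (e + Real.cos (θ j)),
    Real.cos (Real.pi * t) ^ 2 * Real.sin (θ j) + Real.sin (Real.pi * t) ^ 2 * θ j⟩

theorem reflectionPath_eq (e : ℕ) (θ : ι → ℝ) : reflectionPath e θ = fun t j ↦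
    (((-Real.cos (Real.pi * t) * (e + Real.cos (θ j)) : ℝ) : ℂ) +
      ((Real.cos (Real.pi * t) ^ 2 * Real.sin (θ j) + Real.sin (Real.pi * t) ^ 2 * θ j : ℝ) : ℂ) *
        Complex.I) := by
  funext t j
  exact Complex.mk_eq_add_mul_I _ _

theorem contDiff_reflectionPath [Fintype ι] (e : ℕ) (θ : ι → ℝ) :
    ContDiff ℝ 1 (reflectionPath e θ) := by
  rw [reflectionPath_eq, contDiff_pi]
  intro j
  have h1 : ContDiff ℝ 1 fun t ↦ Real.cos (Real.pi * t) :=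
    Real.contDiff_cos.comp (contDiff_const.mul contDiff_id)
  have h2 : ContDiff ℝ 1 fun t ↦ Real.sin (Real.pi * t) :=
    Real.contDiff_sin.comp (contDiff_const.mul contDiff_id)
  exact (Complex.ofRealCLM.contDiff.comp (h1.neg.mul contDiff_const)).add
    ((Complex.ofRealCLM.contDiff.comp (((h1.pow 2).mul contDiff_const).add
      ((h2.pow 2).mul contDiff_const))).mul contDiff_const)

theorem periodic_reflectionPath (e : ℕ) (θ : ι → ℝ) :
    Function.Periodic (reflectionPath e θ) 2 := by
  intro t
  funext j
  have : Real.pi * (t + 2) = Real.pi * t + 2 * Real.pi := by ring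
  simp [reflectionPath, this]

theorem reflectionPath_im_ne_zero {a y : ℝ} (hy : y ≠ 0) (hy' : |y| < Real.pi) :
    Real.cos a ^ 2 * Real.sin y + Real.sin a ^ 2 * y ≠ 0 := by
  have hpos {y : ℝ} (h0 : 0 < y) (h1 : y < Real.pi) :
      0 < Real.cos a ^ 2 * Real.sin y + Real.sin a ^ 2 * y := by
    have hs := Real.sin_pos_of_pos_of_lt_pi h0 h1
    rcases eq_or_ne (Real.cos a) 0 with hc | hc
    · have h := Real.sin_sq_add_cos_sq a
      rw [hc] at h ⊢
      nlinarith
    · have := sq_pos_of_ne_zero hc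
      positivity
  rw [abs_lt] at hy'
  rcases hy.lt_or_gt with h | h
  · have := hpos (y := -y) (by linarith) (by linarith)
    rw [Real.sin_neg] at this
    nlinarith
  · exact (hpos h hy'.2).ne'

theorem reflectionPath_ne_zero (e : ℕ) {θ : ι → ℝ} (hθ0 : ∀ j, θ j ≠ 0)
    (hθπ : ∀ j, |θ j| < Real.pi) (t : ℝ) (j : ι) : reflectionPath e θ t j ≠ 0 := fun h ↦
  reflectionPath_im_ne_zero (a := Real.pi * t) (hθ0 j) (hθπ j) (congrArg Complex.im h)

theorem reflectionPath_injective (e : ℕ) {θ : ι → ℝ} (hθ0 : ∀ j, θ j ≠ 0)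
    (hθπ : ∀ j, |θ j| < Real.pi) (hθ : Function.Injective θ) (t : ℝ) :
    Function.Injective (reflectionPath e θ t) := by
  intro i j h
  have hre := congrArg Complex.re h
  have him := congrArg Complex.im h
  simp only [reflectionPath] at hre him
  rcases eq_or_ne (Real.cos (Real.pi * t)) 0 with hc | hc
  · have h1 := Real.sin_sq_add_cos_sq (Real.pi * t)
    rw [hc] at h1 him
    apply hθ
    nlinarith
  · have hcos : Real.cos (θ i) = Real.cos (θ j) := by
      simpa using mul_left_cancel₀ (neg_ne_zero.2 hc) hre
    rw [← Real.cos_abs (θ i), ← Real.cos_abs (θ j)] at hcos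
    have habs := Real.injOn_cos ⟨abs_nonneg _, (hθπ i).le⟩ ⟨abs_nonneg _, (hθπ j).le⟩ hcos
    rcases abs_eq_abs.1 habs with h1 | h1
    · exact hθ h1
    · rw [h1, Real.sin_neg] at him
      exact absurd (by linarith) (reflectionPath_im_ne_zero (a := Real.pi * t) (hθ0 j) (hθπ j))

theorem reflectionPath_one (e : ℕ) (θ : ι → ℝ) :
    reflectionPath e θ 1 = fun j ↦ e + Complex.exp (θ j * Complex.I) := by
  funext j
  apply Complex.ext <;>
  simp [reflectionPath, Complex.exp_ofReal_mul_I_re, Complex.exp_ofReal_mul_I_im]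

end ReflectionPath

section CriticalValues

open Polynomial

variable {ι : Type*} [Fintype ι]

/-- The monic polynomial with roots `x i`. -/
noncomputable def rootPoly (x : ι → ℂ) : ℂ[X] := ∏ i, (X - C (x i))

/-- The antiderivative of `X ^ e * rootPoly x` vanishing at `0`. -/
noncomputable def rootPrimitive (e : ℕ) (x : ι → ℂ) : ℂ[X] :=
  ∑ k ∈ Finset.range (Fintype.card ι + 1),
    C ((rootPoly x).coeff k / ((k + e + 1 : ℕ) : ℂ)) * X ^ (k + e + 1)

/-- The values of `rootPrimitive e x` at the critical points `x i`. -/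
noncomputable def critVal (e : ℕ) (x : ι → ℂ) : ι → ℂ := fun j ↦ (rootPrimitive e x).eval (x j)

theorem monic_rootPoly (x : ι → ℂ) : (rootPoly x).Monic := monic_prod_X_sub_C _ _

theorem natDegree_rootPoly (x : ι → ℂ) : (rootPoly x).natDegree = Fintype.card ι :=
  natDegree_finsetProd_X_sub_C_eq_card _ _

theorem eval_rootPoly (x : ι → ℂ) (z : ℂ) : (rootPoly x).eval z = ∏ i, (z - x i) := by
  simp [rootPoly, eval_prod]

theorem eval_rootPoly_self (x : ι → ℂ) (j : ι) : (rootPoly x).eval (x j) = 0 := by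
  rw [eval_rootPoly]
  exact Finset.prod_eq_zero (Finset.mem_univ j) (sub_self _)

theorem derivative_rootPrimitive (e : ℕ) (x : ι → ℂ) :
    derivative (rootPrimitive e x) = X ^ e * rootPoly x := by
  conv_rhs => rw [(rootPoly x).as_sum_range_C_mul_X_pow, natDegree_rootPoly, Finset.mul_sum]
  rw [rootPrimitive, derivative_sum]
  refine Finset.sum_congr rfl fun k _ ↦ ?_
  rw [derivative_C_mul_X_pow, div_mul_cancel₀ _ (Nat.cast_ne_zero.2 (k + e).succ_ne_zero),
    Nat.add_sub_cancel, pow_add]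
  ring

theorem eval_zero_rootPrimitive (e : ℕ) (x : ι → ℂ) : (rootPrimitive e x).eval 0 = 0 := by
  simp [rootPrimitive, eval_finsetSum]

theorem eq_rootPrimitive {e : ℕ} {x : ι → ℂ} {Q : ℂ[X]}
    (h : derivative Q = X ^ e * rootPoly x) (h0 : Q.eval 0 = 0) : Q = rootPrimitive e x := by
  have h1 : derivative (Q - rootPrimitive e x) = 0 := by
    rw [derivative_sub, h, derivative_rootPrimitive, sub_self]
  rw [← sub_eq_zero, eq_C_of_natDegree_eq_zero (derivative_eq_zero.1 h1),
    coeff_zero_eq_eval_zero, eval_sub, h0, eval_zero_rootPrimitive, sub_zero, C_0]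

theorem natDegree_rootPrimitive (e : ℕ) (x : ι → ℂ) :
    (rootPrimitive e x).natDegree = Fintype.card ι + e + 1 := by
  have h1 : (derivative (rootPrimitive e x)).natDegree = Fintype.card ι + e := by
    rw [derivative_rootPrimitive, (monic_X_pow e).natDegree_mul (monic_rootPoly x),
      natDegree_X_pow, natDegree_rootPoly, add_comm]
  have h2 : (rootPrimitive e x).natDegree ≠ 0 := fun h ↦ by
    have h3 : derivative (rootPrimitive e x) = 0 := by
      rw [eq_C_of_natDegree_eq_zero h, derivative_C]
    rw [derivative_rootPrimitive] at h3
    exact ((monic_X_pow e).mul (monic_rootPoly x)).ne_zero h3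
  rw [natDegree_derivative] at h1
  omega

theorem rootPoly_comp_equiv (σ : ι ≃ ι) (x : ι → ℂ) : rootPoly (x ∘ σ) = rootPoly x :=
  Equiv.prod_comp σ fun i ↦ X - C (x i)

theorem rootPrimitive_comp_equiv (e : ℕ) (σ : ι ≃ ι) (x : ι → ℂ) :
    rootPrimitive e (x ∘ σ) = rootPrimitive e x := by
  simp only [rootPrimitive, rootPoly_comp_equiv]

theorem critVal_comp_equiv (e : ℕ) (σ : ι ≃ ι) (x : ι → ℂ) :
    critVal e (x ∘ σ) = critVal e x ∘ σ := by
  funext j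
  simp only [critVal, rootPrimitive_comp_equiv, Function.comp_apply]

theorem rootPrimitive_star (e : ℕ) (x : ι → ℂ) :
    rootPrimitive e (star x) = (rootPrimitive e x).map (starRingEnd ℂ) := by
  refine (eq_rootPrimitive ?_ ?_).symm
  · rw [derivative_map, derivative_rootPrimitive, rootPoly, rootPoly, Polynomial.map_mul,
      Polynomial.map_prod]
    simp
  · have := eval_map_apply (f := starRingEnd ℂ) (p := rootPrimitive e x) 0
    rwa [map_zero, eval_zero_rootPrimitive, map_zero] at this

theorem critVal_star (e : ℕ) (x : ι → ℂ) : critVal e (star x) = star (critVal e x) := by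
  funext j
  simp only [critVal, rootPrimitive_star]
  exact eval_map_apply (f := starRingEnd ℂ) (p := rootPrimitive e x) (x j)

theorem critVal_smul (e : ℕ) (s : ℂ) (x : ι → ℂ) :
    critVal e (s • x) = s ^ (Fintype.card ι + e + 1) • critVal e x := by
  rcases eq_or_ne s 0 with rfl | hs
  · funext j
    simp [critVal, eval_zero_rootPrimitive]
  have h : C (s ^ (Fintype.card ι + e + 1)) * (rootPrimitive e x).comp (C s⁻¹ * X) =
      rootPrimitive e (s • x) := by
    refine eq_rootPrimitive ?_ ?_
    · have hr : C (s ^ Fintype.card ι) * (rootPoly x).comp (C s⁻¹ * X) = rootPoly (s • x) := by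
        rw [rootPoly, prod_comp, rootPoly, Fintype.card, C_pow, ← Finset.prod_const,
          ← Finset.prod_mul_distrib]
        refine Finset.prod_congr rfl fun i _ ↦ ?_
        rw [sub_comp, X_comp, C_comp, mul_sub, ← mul_assoc, ← C_mul, mul_inv_cancel₀ hs, C_1,
          one_mul, ← C_mul, Pi.smul_apply, smul_eq_mul]
      rw [derivative_C_mul, derivative_comp, derivative_rootPrimitive, ← hr, mul_comp, X_pow_comp,
        mul_pow, derivative_C_mul_X]
      have hs' : C s * C s⁻¹ = (1 : ℂ[X]) := by rw [← C_mul, mul_inv_cancel₀ hs, C_1]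
      have he : C s ^ e * C s⁻¹ ^ e = (1 : ℂ[X]) := by rw [← mul_pow, hs', one_pow]
      simp only [C_pow, C_mul, pow_add, pow_one]
      linear_combination (C s ^ Fintype.card ι * X ^ e * (rootPoly x).comp (C s⁻¹ * X)) *
        (C s ^ e * C s⁻¹ ^ e * hs' + he)
    · simp [eval_comp, eval_zero_rootPrimitive]
  funext j
  simp only [critVal, Pi.smul_apply, ← h, smul_eq_mul]
  rw [eval_mul, eval_C, eval_comp, eval_mul, eval_C, eval_X, inv_mul_cancel_left₀ hs]

theorem eq_zero_of_critVal_eq_zero {e : ℕ} {x : ι → ℂ} (h : critVal e x = 0) : x = 0 := by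
  classical
  set P := rootPrimitive e x with hP
  have hP0 : P ≠ 0 := fun h0 ↦ by
    have := natDegree_rootPrimitive e x
    rw [← hP, h0, natDegree_zero] at this
    omega
  have hP0' : derivative P ≠ 0 := by
    rw [hP, derivative_rootPrimitive]
    exact ((monic_X_pow e).mul (monic_rootPoly x)).ne_zero
  have hx (j : ι) : x j ∈ P.roots.toFinset := by
    rw [Multiset.mem_toFinset, mem_roots hP0]
    exact congrFun h j
  have h0 : (0 : ℂ) ∈ P.roots.toFinset := by
    rw [Multiset.mem_toFinset, mem_roots hP0]
    exact eval_zero_rootPrimitive e x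
  have hsub (z : ℂ) (hz : z ∈ (derivative P).roots) : z ∈ P.roots.toFinset := by
    rw [mem_roots hP0', hP, derivative_rootPrimitive, IsRoot, eval_mul, eval_rootPoly, eval_pow,
      eval_X] at hz
    rcases mul_eq_zero.1 hz with hz | hz
    · rwa [eq_zero_of_pow_eq_zero hz]
    · obtain ⟨i, -, hi⟩ := Finset.prod_eq_zero_iff.1 hz
      rw [sub_eq_zero.1 hi]
      exact hx i
  have hcount (z : ℂ) (hz : z ∈ P.roots.toFinset) :
      P.roots.count z = (derivative P).roots.count z + 1 := by
    rw [Multiset.mem_toFinset, mem_roots hP0] at hz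
    have := (rootMultiplicity_pos hP0).2 hz
    rw [count_roots, count_roots, derivative_rootMultiplicity_of_root hz]
    omega
  have hcard : P.roots.toFinset.card = 1 := by
    have h1 := Multiset.toFinset_sum_count_eq P.roots
    rw [Finset.sum_congr rfl hcount, Finset.sum_add_distrib, Multiset.sum_count_eq_card hsub,
      IsAlgClosed.card_roots_eq_natDegree, IsAlgClosed.card_roots_eq_natDegree,
      natDegree_derivative, hP,
      natDegree_rootPrimitive, ← hP, Finset.sum_const, smul_eq_mul, mul_one] at h1
    omega
  funext j
  exact Finset.card_le_one.1 hcard.le _ (hx j) _ h0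


theorem contDiff_coeff_prod_X_sub_C (s : Finset ι) (k : ℕ) :
    ContDiff ℂ 1 fun x : ι → ℂ ↦ (∏ i ∈ s, (X - C (x i))).coeff k := by
  classical
  induction s using Finset.induction_on generalizing k with
  | empty => simpa using contDiff_const
  | insert i s hi ih =>
    simp only [Finset.prod_insert hi]
    cases k with
    | zero =>
      simp only [sub_mul, coeff_sub, coeff_X_mul_zero, coeff_C_mul]
      exact contDiff_const.sub ((contDiff_apply ℂ ℂ i).mul (ih 0))
    | succ k =>
      simp only [sub_mul, coeff_sub, coeff_X_mul, coeff_C_mul]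
      exact (ih k).sub ((contDiff_apply ℂ ℂ i).mul (ih (k + 1)))

theorem contDiff_coeff_rootPoly (k : ℕ) :
    ContDiff ℂ 1 fun x : ι → ℂ ↦ (rootPoly x).coeff k :=
  contDiff_coeff_prod_X_sub_C _ k

theorem eval_rootPrimitive (e : ℕ) (x : ι → ℂ) (z : ℂ) : (rootPrimitive e x).eval z =
    ∑ k ∈ Finset.range (Fintype.card ι + 1),
      (rootPoly x).coeff k / ((k + e + 1 : ℕ) : ℂ) * z ^ (k + e + 1) := by
  simp [rootPrimitive, eval_finsetSum]

theorem contDiff_critVal (e : ℕ) : ContDiff ℂ 1 (critVal (ι := ι) e) := by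
  refine contDiff_pi.2 fun j ↦ ?_
  simp only [critVal, eval_rootPrimitive]
  exact ContDiff.sum fun k _ ↦
    ((contDiff_coeff_rootPoly k).div_const _).mul ((contDiff_apply ℂ ℂ j).pow _)

theorem eq_zero_of_fderiv_critVal_eq_zero {e : ℕ} {x δ : ι → ℂ} (hx0 : ∀ i, x i ≠ 0)
    (hx : Function.Injective x) (h : fderiv ℂ (critVal e) x δ = 0) : δ = 0 := by
  classical
  have hL : HasDerivAt (fun s : ℂ ↦ x + s • δ) δ 0 := by
    simpa using ((hasDerivAt_id (0 : ℂ)).smul_const δ).const_add x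
  have hx' : x = x + (0 : ℂ) • δ := by simp
  have hLj (j : ι) : HasDerivAt (fun s : ℂ ↦ (x + s • δ) j) (δ j) 0 := hasDerivAt_pi.1 hL j
  set b : ℕ → ℂ := fun k ↦ fderiv ℂ (fun x : ι → ℂ ↦ (rootPoly x).coeff k) x δ with hb
  have hbd (k : ℕ) : HasDerivAt (fun s : ℂ ↦ (rootPoly (x + s • δ)).coeff k) (b k) 0 := by
    have hd := ((contDiff_coeff_rootPoly (ι := ι) k).differentiable one_ne_zero x).hasFDerivAt
    rw [hx'] at hd
    have := hd.comp_hasDerivAt (0 : ℂ) hL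
    rwa [← hx'] at this
  have hbM : b (Fintype.card ι) = 0 := by
    refine (hbd (Fintype.card ι)).unique ?_
    have h1 (y : ι → ℂ) : (rootPoly y).coeff (Fintype.card ι) = 1 := by
      rw [← natDegree_rootPoly y]
      exact monic_rootPoly y
    simp only [h1]
    exact hasDerivAt_const _ _
  have hV (j : ι) : ∑ k ∈ Finset.range (Fintype.card ι + 1),
      b k / ((k + e + 1 : ℕ) : ℂ) * x j ^ (k + e + 1) = 0 := by
    have hd := ((contDiff_critVal (ι := ι) e).differentiable one_ne_zero x).hasFDerivAt
    rw [hx'] at hd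
    have h1 := hasDerivAt_pi.1 (hd.comp_hasDerivAt (0 : ℂ) hL) j
    rw [← hx', h, Pi.zero_apply] at h1
    simp only [Function.comp_def, critVal, eval_rootPrimitive] at h1
    have h2 := HasDerivAt.fun_sum (u := Finset.range (Fintype.card ι + 1)) fun k _ ↦
      ((hbd k).div_const ((k + e + 1 : ℕ) : ℂ)).mul ((hLj j).pow (k + e + 1))
    have h3 := h2.unique h1
    rw [Finset.sum_add_distrib] at h3
    have h4 : ∑ k ∈ Finset.range (Fintype.card ι + 1),
        (rootPoly x).coeff k / ((k + e + 1 : ℕ) : ℂ) *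
          (((k + e + 1 : ℕ) : ℂ) * x j ^ (k + e) * δ j) = 0 := by
      have h5 := eval_rootPoly_self x j
      rw [eval_eq_sum_range, natDegree_rootPoly] at h5
      calc _ = x j ^ e * δ j * ∑ k ∈ Finset.range (Fintype.card ι + 1),
            (rootPoly x).coeff k * x j ^ k := by
            rw [Finset.mul_sum]
            refine Finset.sum_congr rfl fun k _ ↦ ?_
            have : ((k + e + 1 : ℕ) : ℂ) ≠ 0 := Nat.cast_ne_zero.2 (k + e).succ_ne_zero
            rw [div_mul_eq_mul_div, div_eq_iff this, pow_add]
            ring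
        _ = 0 := by rw [h5, mul_zero]
    push_cast at h4
    simpa [h4] using h3
  have hb0 (k : ℕ) (hk : k < Fintype.card ι) : b k = 0 := by
    set Q : ℂ[X] := ∑ k ∈ Finset.range (Fintype.card ι),
      C (b k / ((k + e + 1 : ℕ) : ℂ)) * X ^ k with hQ
    have hQ0 : Q = 0 := by
      refine eq_zero_of_degree_lt_of_eval_index_eq_zero Finset.univ hx.injOn ?_ ?_
      · rw [Finset.card_univ]
        refine (degree_sum_le _ _).trans_lt ((Finset.sup_lt_iff (WithBot.bot_lt_coe _)).2 ?_)
        exact fun k hk ↦ (degree_C_mul_X_pow_le _ _).trans_lt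
          (Nat.cast_lt.2 (Finset.mem_range.1 hk))
      · intro j _
        have h1 := hV j
        rw [Finset.sum_range_succ, hbM, zero_div, zero_mul, add_zero] at h1
        have h2 : x j ^ (e + 1) * Q.eval (x j) = 0 := by
          rw [← h1, hQ, eval_finsetSum, Finset.mul_sum]
          refine Finset.sum_congr rfl fun k _ ↦ ?_
          simp only [eval_mul, eval_C, eval_pow, eval_X]
          ring
        exact (mul_eq_zero.1 h2).resolve_left (pow_ne_zero _ (hx0 j))
    have h1 : Q.coeff k = b k / ((k + e + 1 : ℕ) : ℂ) := by
      rw [hQ, finsetSum_coeff, Finset.sum_eq_single k]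
      · simp
      · intro l _ hl
        rw [coeff_C_mul_X_pow, if_neg hl.symm]
      · simp [hk]
    rw [hQ0, coeff_zero, eq_comm, div_eq_zero_iff] at h1
    exact h1.resolve_right (Nat.cast_ne_zero.2 (k + e).succ_ne_zero)
  funext j
  have h1 : HasDerivAt (fun s : ℂ ↦ (rootPoly (x + s • δ)).eval (x j)) 0 0 := by
    simp only [eval_eq_sum_range, natDegree_rootPoly]
    have h2 := HasDerivAt.fun_sum (u := Finset.range (Fintype.card ι + 1)) fun k _ ↦
      (hbd k).mul_const (x j ^ k)
    rwa [Finset.sum_eq_zero fun k hk ↦ ?_] at h2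
    rcases (Nat.lt_succ_iff.1 (Finset.mem_range.1 hk)).lt_or_eq with hk | rfl
    · rw [hb0 k hk, zero_mul]
    · rw [hbM, zero_mul]
  have h2 : HasDerivAt (fun s : ℂ ↦ (rootPoly (x + s • δ)).eval (x j))
      (-δ j * ∏ i ∈ Finset.univ.erase j, (x j - x i)) 0 := by
    have h3 (s : ℂ) : (rootPoly (x + s • δ)).eval (x j) =
        (x j - (x + s • δ) j) * ∏ i ∈ Finset.univ.erase j, (x j - (x + s • δ) i) := by
      rw [eval_rootPoly, Finset.mul_prod_erase _ (fun i ↦ x j - (x + s • δ) i)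
        (Finset.mem_univ j)]
    simp only [h3]
    have h4 : DifferentiableAt ℂ
        (fun s : ℂ ↦ ∏ i ∈ Finset.univ.erase j, (x j - (x + s • δ) i)) 0 := by
      simp only [Pi.add_apply, Pi.smul_apply]
      fun_prop
    simpa using ((hLj j).const_sub (x j)).fun_mul h4.hasDerivAt
  have h3 := h2.unique h1
  rw [mul_eq_zero, neg_eq_zero] at h3
  refine h3.resolve_right (Finset.prod_ne_zero_iff.2 fun i hi ↦ ?_)
  exact sub_ne_zero.2 (hx.ne (Finset.ne_of_mem_erase hi).symm)

theorem exists_equiv_hasStrictFDerivAt_critVal {e : ℕ} {x : ι → ℂ} (hx0 : ∀ i, x i ≠ 0)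
    (hx : Function.Injective x) :
    ∃ A : (ι → ℂ) ≃L[ℂ] (ι → ℂ), HasStrictFDerivAt (critVal e) (A : (ι → ℂ) →L[ℂ] (ι → ℂ)) x := by
  have hinj : Function.Injective (fderiv ℂ (critVal e) x : (ι → ℂ) →ₗ[ℂ] (ι → ℂ)) :=
    (injective_iff_map_eq_zero _).2 fun δ hδ ↦ eq_zero_of_fderiv_critVal_eq_zero hx0 hx hδ
  have hA : ((LinearEquiv.ofInjectiveEndo _ hinj).toContinuousLinearEquiv :
      (ι → ℂ) →L[ℂ] (ι → ℂ)) = fderiv ℂ (critVal e) x := rfl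
  refine ⟨(LinearEquiv.ofInjectiveEndo _ hinj).toContinuousLinearEquiv, ?_⟩
  rw [hA]
  exact (contDiff_critVal e).contDiffAt.hasStrictFDerivAt one_ne_zero

theorem exists_mul_norm_pow_le_norm_critVal (e : ℕ) :
    ∃ a > 0, ∀ x : ι → ℂ, a * ‖x‖ ^ (Fintype.card ι + e + 1) ≤ ‖critVal e x‖ := by
  have hcont : Continuous fun x : ι → ℂ ↦ ‖critVal e x‖ := (contDiff_critVal e).continuous.norm
  rcases (sphere (0 : ι → ℂ) 1).eq_empty_or_nonempty with hS | hS
  · refine ⟨1, one_pos, fun x ↦ ?_⟩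
    have : ‖x‖ = 0 := by
      by_contra hx
      have : ((‖x‖⁻¹ : ℝ) : ℂ) • x ∈ sphere (0 : ι → ℂ) 1 := by
        rw [mem_sphere_zero_iff_norm, norm_smul, Complex.norm_real, norm_inv, norm_norm,
          inv_mul_cancel₀ hx]
      simp [hS] at this
    rw [this, zero_pow (Nat.succ_ne_zero _), mul_zero]
    exact norm_nonneg _
  · obtain ⟨u, hu, hmin⟩ := (isCompact_sphere (0 : ι → ℂ) 1).exists_isMinOn hS hcont.continuousOn
    rw [mem_sphere_zero_iff_norm] at hu
    refine ⟨‖critVal e u‖, norm_pos_iff.2 fun h ↦ ?_, fun x ↦ ?_⟩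
    · rw [eq_zero_of_critVal_eq_zero h, norm_zero] at hu
      exact zero_ne_one hu
    · rcases eq_or_ne x 0 with rfl | hx
      · rw [norm_zero, zero_pow (Nat.succ_ne_zero _), mul_zero]
        exact norm_nonneg _
      have hx' : ‖x‖ ≠ 0 := norm_ne_zero_iff.2 hx
      have h1 : ((‖x‖⁻¹ : ℝ) : ℂ) • x ∈ sphere (0 : ι → ℂ) 1 := by
        rw [mem_sphere_zero_iff_norm, norm_smul, Complex.norm_real, norm_inv, norm_norm,
          inv_mul_cancel₀ hx']
      have h2 : ‖critVal e u‖ ≤ _ := hmin h1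
      simp only [critVal_smul, norm_smul, norm_pow, Complex.norm_real, norm_inv, norm_norm,
        inv_pow] at h2
      rwa [← div_eq_inv_mul, le_div_iff₀ (by positivity)] at h2

theorem norm_critVal_sub_eval_le (e : ℕ) {R : ℝ} (hR : 0 ≤ R) : ∃ K, 0 ≤ K ∧ ∀ x : ι → ℂ,
    ‖x‖ ≤ R → ∀ i, ∀ y : ℂ, ‖y‖ ≤ R →
      ‖critVal e x i - (rootPrimitive e x).eval y‖ ≤ K * ‖x i - y‖ ^ 2 := by
  classical
  refine ⟨R ^ e * (2 * R) ^ (Fintype.card ι - 1), by positivity, fun x hx i y hy ↦ ?_⟩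
  have hxi (k : ι) : ‖x k‖ ≤ R := (norm_le_pi_norm x k).trans hx
  have key (z : ℂ) (hz : z ∈ segment ℝ y (x i)) : ‖deriv (fun z ↦ (rootPrimitive e x).eval z) z‖ ≤
      R ^ e * (2 * R) ^ (Fintype.card ι - 1) * ‖x i - y‖ := by
    have hzR : ‖z‖ ≤ R := by
      have := (convex_closedBall (0 : ℂ) R).segment_subset
        (mem_closedBall_zero_iff.2 hy) (mem_closedBall_zero_iff.2 (hxi i)) hz
      exact mem_closedBall_zero_iff.1 this
    have hz' : ‖z - x i‖ ≤ ‖x i - y‖ := by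
      rw [segment_symm] at hz
      have := norm_sub_le_of_mem_segment hz
      rwa [norm_sub_rev y] at this
    rw [Polynomial.deriv, derivative_rootPrimitive, eval_mul, eval_pow, eval_X, eval_rootPoly,
      ← Finset.mul_prod_erase _ (fun k ↦ z - x k) (Finset.mem_univ i), norm_mul, norm_mul,
      norm_pow, norm_prod]
    have hprod : ∏ k ∈ Finset.univ.erase i, ‖z - x k‖ ≤ (2 * R) ^ (Fintype.card ι - 1) := by
      rw [← Finset.card_univ, ← Finset.card_erase_of_mem (Finset.mem_univ i)]
      refine (Finset.prod_le_prod (fun k _ ↦ norm_nonneg _) fun k _ ↦ ?_).trans_eq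
        (Finset.prod_const _)
      linarith [norm_sub_le z (x k), hxi k]
    calc ‖z‖ ^ e * (‖z - x i‖ * ∏ k ∈ Finset.univ.erase i, ‖z - x k‖)
        ≤ R ^ e * (‖x i - y‖ * (2 * R) ^ (Fintype.card ι - 1)) := by gcongr
      _ = _ := by ring
  have := (convex_segment y (x i)).norm_image_sub_le_of_norm_deriv_le
    (f := fun z ↦ (rootPrimitive e x).eval z) (fun z _ ↦ (rootPrimitive e x).differentiableAt)
    key (left_mem_segment ℝ y (x i)) (right_mem_segment ℝ y (x i))
  rw [sq, ← mul_assoc]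
  exact this


/-- The points of norm less than `R` whose coordinates are `δ`-separated from each other and
from `0`. -/
def separatedRegion (ι : Type*) [Fintype ι] (δ R : ℝ) : Set (ι → ℂ) :=
  {x | ‖x‖ < R ∧ (∀ i, δ < ‖x i‖) ∧ ∀ i j, i ≠ j → δ < ‖x i - x j‖}

theorem ball_subset_separatedRegion {δ R : ℝ} (hδ : 0 < δ) (hδ1 : δ ≤ 1) {x : ι → ℂ}
    (hx : ‖x‖ ≤ R - 1) (hx0 : ∀ i, 2 * δ ≤ ‖x i‖)
    (hne : ∀ i j, i ≠ j → 2 * δ ≤ ‖x i - x j‖) :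
    ball x (δ / 2) ⊆ separatedRegion ι δ R := by
  intro y hy
  rw [mem_ball, dist_eq_norm] at hy
  have hyi (i : ι) : ‖x i - y i‖ < δ / 2 := by
    rw [norm_sub_rev]
    exact (norm_le_pi_norm (y - x) i).trans_lt hy
  refine ⟨?_, fun i ↦ ?_, fun i j hij ↦ ?_⟩
  · linarith [norm_le_norm_add_norm_sub' y x]
  · linarith [norm_le_norm_add_norm_sub' (x i) (y i), hx0 i, hyi i]
  · have h1 : x i - x j = (y i - y j) + (x i - y i) - (x j - y j) := by ring
    have h2 := hne i j hij
    rw [h1] at h2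
    linarith [norm_sub_le ((y i - y j) + (x i - y i)) (x j - y j),
      norm_add_le (y i - y j) (x i - y i), hyi i, hyi j]

theorem star_mem_separatedRegion {δ R : ℝ} {x : ι → ℂ} (hx : x ∈ separatedRegion ι δ R) :
    star x ∈ separatedRegion ι δ R := by
  refine ⟨by rw [norm_star]; exact hx.1, fun i ↦ ?_, fun i j hij ↦ ?_⟩
  · rw [Pi.star_apply, norm_star]
    exact hx.2.1 i
  · rw [Pi.star_apply, Pi.star_apply, ← star_sub, norm_star]
    exact hx.2.2 i j hij

theorem isProperMap_smul_critVal (e : ℕ) {α : ℂ} (hα : α ≠ 0) :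
    IsProperMap fun x : ι → ℂ ↦ α • critVal e x := by
  obtain ⟨a, ha, hle⟩ := exists_mul_norm_pow_le_norm_critVal (ι := ι) e
  refine isProperMap_iff_tendsto_cocompact.2
    ⟨(contDiff_critVal e).continuous.const_smul α, ?_⟩
  rw [← Metric.cobounded_eq_cocompact, ← tendsto_norm_atTop_iff_cobounded]
  have h1 : Tendsto (fun x : ι → ℂ ↦ ‖α‖ * (a * ‖x‖ ^ (Fintype.card ι + e + 1)))
      (Bornology.cobounded _) atTop :=
    (((tendsto_pow_atTop (Nat.succ_ne_zero _)).comp tendsto_norm_cobounded_atTop).const_mul_atTop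
      ha).const_mul_atTop (norm_pos_iff.2 hα)
  refine tendsto_atTop_mono (fun x ↦ ?_) h1
  rw [norm_smul]
  exact mul_le_mul_of_nonneg_left (hle x) (norm_nonneg _)

theorem exists_smul_critVal_equiv {e : ℕ} {α : ℂ} (hα : α ≠ 0) {x : ι → ℂ}
    (hx0 : ∀ i, x i ≠ 0) (hx : Function.Injective x) :
    ∃ A : (ι → ℂ) ≃L[ℂ] (ι → ℂ),
      HasStrictFDerivAt (fun x ↦ α • critVal e x) (A : (ι → ℂ) →L[ℂ] (ι → ℂ)) x := by
  obtain ⟨A, hA⟩ := exists_equiv_hasStrictFDerivAt_critVal (e := e) hx0 hx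
  exact ⟨A.trans (ContinuousLinearEquiv.smulLeft (Units.mk0 α hα)), hA.const_smul α⟩

theorem isCoveringMapOn_smul_critVal {e : ℕ} {α : ℂ} (hα : α ≠ 0) {U : Set (ι → ℂ)}
    (hU : ∀ x : ι → ℂ, α • critVal e x ∈ U → (∀ i, x i ≠ 0) ∧ Function.Injective x) :
    IsCoveringMapOn (fun x : ι → ℂ ↦ α • critVal e x) U := by
  have hp := isProperMap_smul_critVal (ι := ι) e hα
  have hloc (x : ι → ℂ) (hx : α • critVal e x ∈ U) :
      ∃ φ : OpenPartialHomeomorph (ι → ℂ) (ι → ℂ), x ∈ φ.source ∧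
        (φ : (ι → ℂ) → ι → ℂ) = fun x ↦ α • critVal e x := by
    obtain ⟨A, hA⟩ := exists_smul_critVal_equiv (e := e) hα (hU x hx).1 (hU x hx).2
    exact ⟨hA.toOpenPartialHomeomorph _, hA.mem_toOpenPartialHomeomorph_source,
      hA.toOpenPartialHomeomorph_coe⟩
  refine hp.isClosedMap.isCoveringMapOn_of_isLocalHomeomorphOn (fun y hy ↦ ?_) fun x hx ↦ ?_
  · refine (hp.isCompact_preimage isCompact_singleton).finite
      (.of_openPartialHomeomorph _ subset_rfl fun x hx ↦ hloc x ?_)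
    rw [mem_preimage, mem_singleton_iff] at hx
    rwa [hx]
  · obtain ⟨φ, hφ, h⟩ := hloc x hx
    exact ⟨φ, hφ, h.symm⟩

theorem exists_norm_le_sub_one_of_norm_lt (e : ℕ) (hcard : 0 < Fintype.card ι + e) {α : ℂ}
    (hα : α ≠ 0) (R₀ : ℝ) :
    ∃ R, R₀ ≤ R - 1 ∧ 2 ≤ R ∧ ∀ x : ι → ℂ, ‖α • critVal e x‖ < R → ‖x‖ ≤ R - 1 := by
  obtain ⟨a, ha, hle⟩ := exists_mul_norm_pow_le_norm_critVal (ι := ι) e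
  set b := ‖α‖ * a with hb
  have hb0 : 0 < b := mul_pos (norm_pos_iff.2 hα) ha
  set s := max R₀ (max 1 (2 / b)) with hs
  have hs1 : 1 ≤ s := (le_max_left _ _).trans (le_max_right _ _)
  have hsb : 2 ≤ b * s := by
    rw [mul_comm, ← div_le_iff₀ hb0]
    exact (le_max_right _ _).trans (le_max_right _ _)
  refine ⟨s + 1, by rw [add_sub_cancel_right]; exact le_max_left _ _, by linarith,
    fun x hx ↦ ?_⟩
  rw [add_sub_cancel_right]
  by_contra! hsx
  have h1 : ‖x‖ ^ 2 ≤ ‖x‖ ^ (Fintype.card ι + e + 1) :=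
    pow_le_pow_right₀ (hs1.trans hsx.le) (by omega)
  have h2 : b * ‖x‖ ^ (Fintype.card ι + e + 1) ≤ ‖α • critVal e x‖ := by
    rw [norm_smul, hb, mul_assoc]
    exact mul_le_mul_of_nonneg_left (hle x) (norm_nonneg _)
  have h3 : b * s * s ≤ b * ‖x‖ ^ 2 := by
    rw [mul_assoc, ← sq]
    gcongr
  nlinarith [mul_le_mul_of_nonneg_left h1 hb0.le]

theorem exists_smul_critVal_eq_star {e : ℕ} (hcard : 0 < Fintype.card ι + e) (σ : ι ≃ ι) {α : ℝ}
    (hα : α ≠ 0) {γ γ' : ℝ → ι → ℂ} (hγ : ∀ t, HasDerivAt γ (γ' t) t) {δ₀ R₀ C : ℝ}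
    (hδ₀ : 0 < δ₀) (hR₀ : ∀ t, ‖γ t‖ ≤ R₀) (hγ0 : ∀ t i, δ₀ ≤ ‖γ t i‖)
    (hγne : ∀ t i j, i ≠ j → δ₀ ≤ ‖γ t i - γ t j‖) (hC : ∀ t, ‖γ' t‖ ≤ C)
    (hγσ : ∀ t, star (γ t ∘ σ) = γ t) (h01 : (α : ℂ) • critVal e (γ 1) = star (γ 0)) :
    ∃ x : ι → ℂ, (∀ i, x i ≠ 0) ∧ Function.Injective x ∧ (α : ℂ) • critVal e x = star x ∧
      star (x ∘ σ) = x := by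
  have hα' : (α : ℂ) ≠ 0 := Complex.ofReal_ne_zero.2 hα
  obtain ⟨R, hR₀R, hR2, hGR⟩ := exists_norm_le_sub_one_of_norm_lt (ι := ι) e hcard hα' R₀
  obtain ⟨K, hK, hquad⟩ := norm_critVal_sub_eval_le (ι := ι) e (R := R) (by linarith)
  set L := |α| * K + 1 with hL
  have hL0 : 0 < L := by positivity
  set δ := min (min 1 (δ₀ / 2)) (1 / (8 * L)) with hδ
  have hδ0 : 0 < δ := by positivity
  have hδ1 : δ ≤ 1 := (min_le_left _ _).trans (min_le_left _ _)
  have hδδ₀ : 2 * δ ≤ δ₀ := by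
    linarith [(min_le_left _ _ : δ ≤ min 1 (δ₀ / 2)).trans (min_le_right _ _)]
  have hδL : δ * (8 * L) ≤ 1 := by
    rw [← le_div_iff₀ (by positivity)]
    exact min_le_right _ _
  have hsep (u v : ℝ) (hv : 0 ≤ v) (hu : δ < |α| * u) (huv : u ≤ K * v ^ 2) : 2 * δ ≤ v := by
    by_contra! h
    have h1 : |α| * u ≤ |α| * (K * v ^ 2) := mul_le_mul_of_nonneg_left huv (abs_nonneg α)
    have h2 : v ^ 2 ≤ (2 * δ) ^ 2 := by gcongr
    have h3 : |α| * (K * v ^ 2) ≤ L * (2 * δ) ^ 2 := by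
      rw [← mul_assoc]
      exact mul_le_mul (by rw [hL]; linarith) h2 (sq_nonneg v) hL0.le
    nlinarith
  have hpull (x : ι → ℂ) (hx : (α : ℂ) • critVal e x ∈ separatedRegion ι δ R) :
      ‖x‖ ≤ R - 1 ∧ (∀ i, 2 * δ ≤ ‖x i‖) ∧ ∀ i j, i ≠ j → 2 * δ ≤ ‖x i - x j‖ := by
    obtain ⟨h1, h2, h3⟩ := hx
    have hx1 := hGR x h1
    have hxR : ‖x‖ ≤ R := by linarith
    refine ⟨hx1, fun i ↦ hsep ‖critVal e x i‖ _ (norm_nonneg _) ?_ ?_,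
      fun i j hij ↦ hsep ‖critVal e x i - critVal e x j‖ _ (norm_nonneg _) ?_ ?_⟩
    · simpa [norm_smul] using h2 i
    · simpa [eval_zero_rootPrimitive] using hquad x hxR i 0 (by rw [norm_zero]; linarith)
    · simpa [← mul_sub] using h3 i j hij
    · exact hquad x hxR i (x j) ((norm_le_pi_norm x j).trans hxR)
  have hball (x : ι → ℂ) (hx : (α : ℂ) • critVal e x ∈ separatedRegion ι δ R) :
      ball x (δ / 2) ⊆ separatedRegion ι δ R :=
    ball_subset_separatedRegion hδ0 hδ1 (hpull x hx).1 (hpull x hx).2.1 (hpull x hx).2.2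
  have hreg (x : ι → ℂ) (hx : x ∈ separatedRegion ι δ R) :
      (∀ i, x i ≠ 0) ∧ Function.Injective x := by
    refine ⟨fun i ↦ norm_pos_iff.1 (hδ0.trans (hx.2.1 i)), fun i j hij ↦ ?_⟩
    by_contra h
    have := hx.2.2 i j h
    rw [hij, sub_self, norm_zero] at this
    exact this.not_gt hδ0
  have hpre (x : ι → ℂ) (hx : (α : ℂ) • critVal e x ∈ separatedRegion ι δ R) :=
    hreg x (hball x hx (mem_ball_self (by positivity)))
  have hσ (x : ι → ℂ) :
      (α : ℂ) • critVal e (star (x ∘ σ)) = star (((α : ℂ) • critVal e x) ∘ σ) := by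
    rw [critVal_star, critVal_comp_equiv]
    funext i
    simp
  obtain ⟨x, hxU, hx, hxσ⟩ := exists_eq_star_of_pullBack
    (τ := fun x : ι → ℂ ↦ star (x ∘ σ))
    (isProperMap_smul_critVal (ι := ι) e hα').continuous
    (isCoveringMapOn_smul_critVal hα' hpre)
    (fun x hx ↦ (exists_smul_critVal_equiv (e := e) hα' (hpre x hx).1 (hpre x hx).2).imp
      fun A hA ↦ hA.hasFDerivAt)
    (fun x hx ↦ hx.1.le) (fun x hx ↦ star_mem_separatedRegion hx) (by positivity : 0 < δ / 2)
    hball (by fun_prop) (fun x ↦ rfl) hσ hγ (by positivity : 0 < δ / 2)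
    (fun t ↦ ball_subset_separatedRegion hδ0 hδ1 ((hR₀ t).trans hR₀R)
      (fun i ↦ hδδ₀.trans (hγ0 t i)) fun i j hij ↦ hδδ₀.trans (hγne t i j hij))
    hC hγσ h01
  exact ⟨x, (hreg x hxU).1, (hreg x hxU).2, hx, hxσ⟩

theorem exists_fixed_configuration {e : ℕ} (hcard : 0 < Fintype.card ι + e) (σ : ι ≃ ι)
    {α : ℝ} (hα : α ≠ 0) {θ : ι → ℝ} (hθ0 : ∀ j, θ j ≠ 0) (hθπ : ∀ j, |θ j| < Real.pi)
    (hθ : Function.Injective θ) (hθσ : ∀ j, θ (σ j) = -θ j)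
    (hval : ∀ j, (α : ℂ) * critVal e (fun j ↦ e + Complex.exp (θ j * Complex.I)) j =
      -(e + Complex.exp (θ j * Complex.I))) :
    ∃ x : ι → ℂ, (∀ i, x i ≠ 0) ∧ Function.Injective x ∧ (α : ℂ) • critVal e x = star x ∧
      star (x ∘ σ) = x := by
  set γ := reflectionPath e θ with hγ
  have hd := contDiff_reflectionPath e θ
  have hper := periodic_reflectionPath e θ
  have hper' : Function.Periodic (deriv γ) 2 := fun t ↦ by
    rw [← deriv_comp_add_const, hper.funext]
  obtain ⟨δ₁, hδ₁, h1⟩ := exists_pos_forall_le_norm_of_periodic two_ne_zero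
    (f := fun i t ↦ γ t i) (fun i t ↦ congrFun (hper t) i)
    (fun i ↦ (continuous_apply i).comp hd.continuous)
    (fun i t ↦ reflectionPath_ne_zero e hθ0 hθπ t i)
  obtain ⟨δ₂, hδ₂, h2⟩ := exists_pos_forall_le_norm_of_periodic two_ne_zero
    (f := fun (p : {p : ι × ι // p.1 ≠ p.2}) t ↦ γ t p.1.1 - γ t p.1.2)
    (fun p t ↦ by simp only [hγ, hper t])
    (fun p ↦ ((continuous_apply p.1.1).comp hd.continuous).sub
      ((continuous_apply p.1.2).comp hd.continuous))
    (fun p t ↦ sub_ne_zero.2 fun h ↦ p.2 (reflectionPath_injective e hθ0 hθπ hθ t h))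
  obtain ⟨R₀, hR₀⟩ := (hper.isBounded_of_continuous two_ne_zero hd.continuous).exists_norm_le
  obtain ⟨C, hC⟩ := (hper'.isBounded_of_continuous two_ne_zero
    (hd.continuous_deriv le_rfl)).exists_norm_le
  refine exists_smul_critVal_eq_star hcard σ hα
    (fun t ↦ (hd.differentiable one_ne_zero t).hasDerivAt) (lt_min hδ₁ hδ₂)
    (fun t ↦ hR₀ _ (mem_range_self t)) (fun t i ↦ (min_le_left _ _).trans (h1 i t))
    (fun t i j hij ↦ (min_le_right _ _).trans (h2 ⟨(i, j), hij⟩ t))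
    (fun t ↦ hC _ (mem_range_self t)) (fun t ↦ ?_) ?_
  · funext j
    apply Complex.ext <;> simp [reflectionPath, hθσ]
    ring
  · funext j
    rw [reflectionPath_one, Pi.smul_apply, smul_eq_mul, hval]
    apply Complex.ext <;>
    simp [reflectionPath, Complex.exp_ofReal_mul_I_re, Complex.exp_ofReal_mul_I_im]

theorem X_pow_mul_rootPoly_eq {e m : ℕ} (he : e ≤ 1) (hm : Fintype.card ι = 2 * m) {x : ι → ℂ}
    (hx0 : ∀ i, x i ≠ 0) (hx : Function.Injective x)
    (hpow : ∀ i, (x i - e) ^ (2 * m + e) = -1) (hN : 0 < 2 * m + e) :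
    X ^ e * rootPoly x = (X - C (e : ℂ)) ^ (2 * m + e) + 1 := by
  have hdeg : ((X - C (e : ℂ)) ^ (2 * m + e) : ℂ[X]).natDegree = 2 * m + e := by
    rw [natDegree_pow, natDegree_X_sub_C, mul_one]
  have hmon : ((X - C (e : ℂ)) ^ (2 * m + e) + 1 : ℂ[X]).Monic :=
    ((monic_X_sub_C (e : ℂ)).pow _).add_of_left (degree_lt_degree (by rwa [natDegree_one, hdeg]))
  have hmon' : (X ^ e * rootPoly x).Monic := (monic_X_pow e).mul (monic_rootPoly x)
  refine eq_of_dvd_of_natDegree_le_of_leadingCoeff ?_ ?_ (hmon'.trans hmon.symm)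
  · refine IsCoprime.mul_dvd ?_ ?_ ?_
    · refine IsCoprime.pow_left (IsCoprime.prod_right fun i _ ↦ ?_)
      simpa using isCoprime_X_sub_C_of_isUnit_sub (R := ℂ) (a := 0) (b := x i)
        (by simpa using hx0 i)
    · interval_cases e
      · simp
      · rw [pow_one, X_dvd_iff, coeff_zero_eq_eval_zero]
        simp [pow_succ, pow_mul]
    · refine Fintype.prod_dvd_of_coprime (pairwise_coprime_X_sub_C hx) fun i ↦ ?_
      rw [dvd_iff_isRoot]
      simp [IsRoot.def, hpow]
  · rw [(monic_X_pow e).natDegree_mul (monic_rootPoly x), natDegree_X_pow, natDegree_rootPoly, hm,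
      natDegree_add_eq_left_of_natDegree_lt (by rwa [natDegree_one, hdeg]), hdeg, add_comm]

theorem critVal_polygon {e m : ℕ} (he : e ≤ 1) (hm : Fintype.card ι = 2 * m) {x : ι → ℂ}
    (hx0 : ∀ i, x i ≠ 0) (hx : Function.Injective x)
    (hpow : ∀ i, (x i - e) ^ (2 * m + e) = -1) (hN : 0 < 2 * m + e) (j : ι) :
    ((2 * m + e + 1 : ℕ) : ℂ) * critVal e x j = (2 * m + e : ℕ) * x j := by
  have hn : ((2 * m + e + 1 : ℕ) : ℂ) ≠ 0 := Nat.cast_ne_zero.2 (Nat.succ_ne_zero _)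
  have h : C (((2 * m + e + 1 : ℕ) : ℂ)⁻¹) *
      ((X - C (e : ℂ)) ^ (2 * m + e + 1) - C ((-e : ℂ) ^ (2 * m + e + 1))) + X =
      rootPrimitive e x := by
    refine eq_rootPrimitive ?_ ?_
    · rw [X_pow_mul_rootPoly_eq he hm hx0 hx hpow hN, derivative_add, derivative_C_mul,
        derivative_sub, derivative_C, derivative_X_sub_C_pow, derivative_X, sub_zero,
        Nat.add_sub_cancel, ← mul_assoc, ← C_mul, inv_mul_cancel₀ hn, C_1, one_mul]
    · simp
  have he' : (-e : ℂ) ^ (2 * m + e + 1) = e := by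
    interval_cases e
    · simp
    · rw [add_assoc, pow_add, pow_mul]
      simp
  rw [critVal, ← h, he', eval_add, eval_mul, eval_C, eval_sub, eval_pow, eval_sub, eval_X, eval_C,
    pow_succ, hpow, mul_add, mul_inv_cancel_left₀ hn]
  push_cast
  ring

theorem exists_symmetric_fixed_configuration (m : ℕ) {e : ℕ} (he : e ≤ 1) (hN : 0 < 2 * m + e) :
    ∃ (α : ℝ) (x : Fin m × Bool → ℂ), α ≠ 0 ∧ (∀ i, x i ≠ 0) ∧ Function.Injective x ∧
      (α : ℂ) • critVal e x = star x ∧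
      star (x ∘ (Equiv.refl (Fin m)).prodCongr Equiv.boolNot) = x := by
  have hcard : Fintype.card (Fin m × Bool) = 2 * m := by simp [mul_comm]
  have hN' : (0 : ℝ) < (2 * m + e : ℕ) := Nat.cast_pos.2 hN
  set θ : Fin m × Bool → ℝ := fun p ↦
    (if p.2 then 1 else -1) * (Real.pi * (2 * (p.1 : ℕ) + 1) / (2 * m + e : ℕ)) with hθ
  have hpos (k : ℕ) : 0 < Real.pi * (2 * k + 1) / (2 * m + e : ℕ) := by positivity
  have habs (p : Fin m × Bool) : |θ p| = Real.pi * (2 * (p.1 : ℕ) + 1) / (2 * m + e : ℕ) := by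
    rcases p with ⟨k, _ | _⟩ <;> simp only [hθ] <;> simp [abs_of_pos (hpos k), -Nat.cast_add]
  have hθ0 (p) : θ p ≠ 0 := by
    rw [← abs_pos, habs]
    exact hpos _
  have hθπ (p) : |θ p| < Real.pi := by
    rw [habs, div_lt_iff₀ hN']
    have := p.1.2
    have h : ((2 * (p.1 : ℕ) + 1 : ℕ) : ℝ) < (2 * m + e : ℕ) := by
      rw [Nat.cast_lt]
      omega
    push_cast at h ⊢
    exact mul_lt_mul_of_pos_left h Real.pi_pos
  have hinj : Function.Injective θ := by
    rintro ⟨k, b⟩ ⟨l, c⟩ h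
    have h1 := congrArg abs h
    rw [habs, habs, div_left_inj' hN'.ne', mul_right_inj' Real.pi_ne_zero, add_left_inj,
      mul_right_inj' two_ne_zero, Nat.cast_inj, Fin.val_inj] at h1
    simp only at h1
    subst h1
    have := hpos k
    rcases b with _ | _ <;> rcases c with _ | _ <;> simp only [hθ] at h <;>
      first | rfl | (exfalso; simp only [Bool.false_eq_true, if_true, if_false] at h; linarith)
  have hpow (p) : Complex.exp (θ p * Complex.I) ^ (2 * m + e) = -1 := by
    have hN'' : ((2 * m + e : ℕ) : ℂ) ≠ 0 := Nat.cast_ne_zero.2 hN.ne'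
    have key (k : ℕ) : Complex.exp (((Real.pi * (2 * k + 1) / (2 * m + e : ℕ) : ℝ) : ℂ) *
        Complex.I) ^ (2 * m + e) = -1 := by
      rw [← Complex.exp_nat_mul]
      have : ((2 * m + e : ℕ) : ℂ) * (((Real.pi * (2 * k + 1) / (2 * m + e : ℕ) : ℝ) : ℂ) *
          Complex.I) = Real.pi * Complex.I + k * (2 * Real.pi * Complex.I) := by
        rw [Complex.ofReal_div, Complex.ofReal_natCast]
        field_simp
        push_cast
        ring
      rw [this, Complex.exp_periodic.nat_mul, Complex.exp_pi_mul_I]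
    rcases p with ⟨k, _ | _⟩
    · have : θ (k, false) = -(Real.pi * (2 * (k : ℕ) + 1) / (2 * m + e : ℕ)) := by simp [hθ]
      rw [this, Complex.ofReal_neg, neg_mul, Complex.exp_neg, inv_pow, key]
      norm_num
    · have : θ (k, true) = Real.pi * (2 * (k : ℕ) + 1) / (2 * m + e : ℕ) := by simp [hθ]
      rw [this, key]
  have hx1 := reflectionPath_injective e hθ0 hθπ hinj 1
  have hx0 := reflectionPath_ne_zero e hθ0 hθπ 1
  rw [reflectionPath_one] at hx1 hx0
  set α : ℝ := -((2 * m + e + 1 : ℕ) / (2 * m + e : ℕ)) with hαdef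
  have hα : α ≠ 0 := neg_ne_zero.2 (by positivity)
  refine ⟨α, (exists_fixed_configuration (by omega) _ hα hθ0 hθπ hinj (fun p ↦ ?_)
    fun p ↦ ?_).imp fun x hx ↦ ⟨hα, hx⟩⟩
  · rcases p with ⟨k, _ | _⟩ <;> simp [hθ]
  · have h := critVal_polygon he hcard hx0 hx1 (fun i ↦ by simp [hpow]) hN p
    have hN'' : ((2 * m + e : ℕ) : ℂ) ≠ 0 := Nat.cast_ne_zero.2 hN.ne'
    rw [hαdef, Complex.ofReal_neg, Complex.ofReal_div, Complex.ofReal_natCast,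
      Complex.ofReal_natCast, neg_mul, div_mul_eq_mul_div, h, mul_div_cancel_left₀ _ hN'']

end CriticalValues

/-- (Geyer) For each `n > 1` there exists a degree-`n` complex polynomial `p` with all
coefficients real such that `p'` has exactly `n - 1` distinct complex roots and every
root `z` of `p'` satisfies `conj (p z) = z`; i.e. the anti-polynomial `z ↦ conj (p z)`
has `n - 1` finite, fixed critical points. -/
theorem exists_real_poly_fixed_critical_points (n : ℕ) (hn : 1 < n) :
    ∃ p : Polynomial ℂ, p.natDegree = n ∧
      (∀ k : ℕ, (p.coeff k).im = 0) ∧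
      {z : ℂ | (Polynomial.derivative p).eval z = 0}.ncard = n - 1 ∧
      ∀ z : ℂ, (Polynomial.derivative p).eval z = 0 → (starRingEnd ℂ) (p.eval z) = z := by
  obtain ⟨m, e, he, hne⟩ : ∃ m e, e ≤ 1 ∧ n = 2 * m + e + 1 :=
    ⟨(n - 1) / 2, (n - 1) % 2, by omega, by omega⟩
  obtain ⟨α, x, hα, hx0, hx, hval, hsymm⟩ :=
    exists_symmetric_fixed_configuration m he (by omega)
  have hcard : Fintype.card (Fin m × Bool) = 2 * m := by simp [mul_comm]
  have hα' : (α : ℂ) ≠ 0 := Complex.ofReal_ne_zero.2 hα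
  have hroot (z : ℂ) : (Polynomial.derivative (Polynomial.C (α : ℂ) * rootPrimitive e x)).eval z = 0
      ↔ (e ≠ 0 ∧ z = 0) ∨ z ∈ range x := by
    rw [Polynomial.derivative_C_mul, derivative_rootPrimitive]
    simp only [Polynomial.eval_mul, Polynomial.eval_C, Polynomial.eval_pow, Polynomial.eval_X,
      eval_rootPoly, mul_eq_zero, hα', false_or, pow_eq_zero_iff', Finset.prod_eq_zero_iff,
      Finset.mem_univ, true_and, sub_eq_zero, mem_range, eq_comm (a := z), and_comm]
  refine ⟨Polynomial.C (α : ℂ) * rootPrimitive e x, ?_, fun k ↦ ?_, ?_, fun z hz ↦ ?_⟩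
  · rw [Polynomial.natDegree_C_mul hα', natDegree_rootPrimitive, hcard, hne]
  · have hreal : (rootPrimitive e x).map (starRingEnd ℂ) = rootPrimitive e x := by
      rw [← rootPrimitive_star]
      conv_rhs => rw [← hsymm]
      rw [rootPrimitive_star, rootPrimitive_star, rootPrimitive_comp_equiv]
    have him : ((rootPrimitive e x).coeff k).im = 0 := by
      rw [← Complex.conj_eq_iff_im, ← Polynomial.coeff_map, hreal]
    rw [Polynomial.coeff_C_mul, Complex.im_ofReal_mul, him, mul_zero]
  · simp only [hroot]
    have hr : (range x).ncard = 2 * m := by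
      rw [ncard_range_of_injective hx, Nat.card_eq_fintype_card, hcard]
    interval_cases e
    · have : {z | ((0 : ℕ) ≠ 0 ∧ z = 0) ∨ z ∈ range x} = range x := by
        ext
        simp only [ne_eq, not_true_eq_false, false_and, false_or, mem_ofPred_eq]
      rw [this, hr, hne, add_zero, Nat.add_sub_cancel]
    · have : {z | ((1 : ℕ) ≠ 0 ∧ z = 0) ∨ z ∈ range x} = insert 0 (range x) := by
        ext
        simp only [ne_eq, one_ne_zero, not_false_eq_true, true_and, mem_ofPred_eq, mem_insert_iff]
      have h0 : (0 : ℂ) ∉ range x := fun ⟨i, hi⟩ ↦ hx0 i hi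
      rw [this, ncard_insert_of_notMem h0 (finite_range x), hr, hne, Nat.add_sub_cancel]
  · rw [Polynomial.eval_mul, Polynomial.eval_C]
    rcases (hroot z).1 hz with ⟨-, rfl⟩ | ⟨i, rfl⟩
    · rw [eval_zero_rootPrimitive, mul_zero, map_zero]
    · have h := congrFun hval i
      simp only [Pi.smul_apply, critVal, smul_eq_mul] at h
      rw [h]
      exact star_star (x i)
end

section
/- Let n ≥ 1 and let P, Q be coprime complex polynomials with Q ≠ 0 and max(deg P, deg Q) = n, and let r = P/Q as a rational function. Then the following are equivalent: (a) there exist c ∈ ℂ and a complex polynomial p of degree n such that r = c + 1/p as rational functions; (b) deg Q = n and there exist c ∈ ℂ and a nonzero constant k ∈ ℂ with P = c·Q + k (as polynomials). Condition (b) is the algebraic formulation of the statement that r has a critical point of degree n − 1 at ∞ and r(∞) ∈ ℂ, i.e., r takes a finite value c at ∞ and r − c vanishes to order n at ∞. -/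
/-- Let `n ≥ 1` and let `P, Q` be coprime complex polynomials with `Q ≠ 0` and
`max (deg P) (deg Q) = n`, and let `r = P / Q` in `RatFunc ℂ`. Then `r` can be written
as `c + 1 / p` with `p` a polynomial of degree `n` iff `deg Q = n` and `P = c • Q + k`
for some constants `c` and `k ≠ 0` (the algebraic form of: `r` has a degree `n - 1`
critical point at `∞` with `r ∞ = c ∈ ℂ`). -/
theorem ratfunc_form_c_add_inv_poly_iff (n : ℕ) (hn : 1 ≤ n)
    (P Q : Polynomial ℂ) (hcop : IsCoprime P Q) (hQ : Q ≠ 0)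
    (hdeg : max P.natDegree Q.natDegree = n)
    (r : RatFunc ℂ)
    (hr : r = algebraMap (Polynomial ℂ) (RatFunc ℂ) P /
        algebraMap (Polynomial ℂ) (RatFunc ℂ) Q) :
    (∃ (c : ℂ) (p : Polynomial ℂ), p.natDegree = n ∧
        r = RatFunc.C c + 1 / algebraMap (Polynomial ℂ) (RatFunc ℂ) p) ↔
      (Q.natDegree = n ∧ ∃ c k : ℂ, k ≠ 0 ∧
        P = Polynomial.C c * Q + Polynomial.C k) := by
  have hQ' : algebraMap (Polynomial ℂ) (RatFunc ℂ) Q ≠ 0 :=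
    RatFunc.algebraMap_ne_zero hQ
  constructor
  · rintro ⟨c, p, hp, hrp⟩
    have hp0 : p ≠ 0 := by
      rintro rfl
      simp at hp
      omega
    have hp' := RatFunc.algebraMap_ne_zero hp0
    have key : (P - Polynomial.C c * Q) * p = Q := by
      apply RatFunc.algebraMap_injective ℂ
      rw [hr, ← RatFunc.algebraMap_C] at hrp
      field_simp at hrp
      simp only [map_mul, map_sub]
      linear_combination hrp
    have hcop' : IsCoprime (P - Polynomial.C c * Q) Q := by
      obtain ⟨a, b, hab⟩ := hcop
      exact ⟨a, b + a * Polynomial.C c, by linear_combination hab⟩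
    obtain ⟨k, hk, hkP⟩ := Polynomial.isUnit_iff.mp
      (hcop'.isUnit_of_dvd' dvd_rfl (Dvd.intro _ key))
    refine ⟨?_, c, k, hk.ne_zero, by linear_combination -hkP⟩
    rw [← key, ← hkP, Polynomial.natDegree_C_mul hk.ne_zero, hp]
  · rintro ⟨hQn, c, k, hk, rfl⟩
    refine ⟨c, Polynomial.C k⁻¹ * Q, ?_, ?_⟩
    · rw [Polynomial.natDegree_C_mul (inv_ne_zero hk), hQn]
    · have hk' : (RatFunc.C k : RatFunc ℂ) ≠ 0 := by simpa using hk
      rw [hr]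
      simp only [map_add, map_mul, RatFunc.algebraMap_C, map_inv₀]
      field_simp
end
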